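/- Let e be a uniform resource expression (e ¨ e). For every resource expression e' in the support of the →∂-normal form NF(e), the coefficient of e' in NF(e) equals m(e)/m(e'). -/

import Mathlib

set_option maxHeartbeats 1000000

/-! ### Rigid resource terms -/

/-- Rigid resource terms (de Bruijn indices for variables):
`a ::= x | λ.a | ⟨a⟩b⃗ | a⊕• | •⊕a` where argument lists are ordered. -/
inductive Rt : Type
  | var : ℕ → Rt
  | lam : Rt → Rt
  | app : Rt → List Rt → Rt
  | inl : Rt → Rt
  | inr : Rt → Rt
deriving Inhabited

/-- Rigid resource expressions: terms or (rigid) monomials. -/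
abbrev REx : Type := Rt ⊕ List Rt

/-! ### Isomorphism of rigid expressions -/

mutual
  /-- Two rigid terms are isomorphic (`≅`) when they differ only by
  permutations of argument lists. -/
  inductive IsoT : Rt → Rt → Prop
    | var (x : ℕ) : IsoT (.var x) (.var x)
    | lam {a a'} : IsoT a a' → IsoT (.lam a) (.lam a')
    | inl {a a'} : IsoT a a' → IsoT (.inl a) (.inl a')
    | inr {a a'} : IsoT a a' → IsoT (.inr a) (.inr a')
    | app {c c' : Rt} {ds ds' : List Rt} :
        IsoT c c' → IsoM ds ds' → IsoT (.app c ds) (.app c' ds')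
  /-- Isomorphism of rigid monomials: a permutation `σ` together with
  isomorphisms `aᵢ ≅ a'_{σ(i)}`. -/
  inductive IsoM : List Rt → List Rt → Prop
    | mk (as as' : List Rt) (h : as'.length = as.length) (σ : Equiv.Perm (Fin as.length))
        (H : ∀ i : Fin as.length, IsoT (as.get i) (as'.get ((σ i).cast h.symm))) :
        IsoM as as'
end

/-! ### Resource expressions as quotients of rigid expressions -/

/-- Resource terms: rigid terms up to permutations of arguments, i.e. terms
whose argument lists are multisets. -/
def ResTerm : Type := Quot IsoT

instance : Inhabited ResTerm := ⟨Quot.mk _ (.var 0)⟩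

/-- The resource term represented by a rigid term (`r ◁ |r|`). -/
def rmk : Rt → ResTerm := Quot.mk IsoT

/-- A choice of rigid representation of a resource term. -/
noncomputable def rout : ResTerm → Rt := Quot.out

/-- The resource monomial (multiset) represented by a rigid monomial (list). -/
def toMul (bs : List Rt) : Multiset ResTerm := ↑(bs.map rmk)

/-- Resource expressions: terms or monomials (finite multisets of terms). -/
abbrev ResExpr : Type := ResTerm ⊕ Multiset ResTerm

/-- The resource expression represented by a rigid expression. -/
def toQ : REx → ResExpr := Sum.map rmk toMul

/-- A choice of rigid representation of a resource expression. -/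
noncomputable def outE : ResExpr → REx :=
  Sum.map rout (fun m => m.toList.map rout)

/-- Variable as a resource term. -/
def qVar (x : ℕ) : ResTerm := rmk (.var x)

/-- Abstraction on resource terms. -/
noncomputable def qLam (s : ResTerm) : ResTerm := rmk (.lam (rout s))

/-- Left injection `(-) ⊕ •` on resource terms. -/
noncomputable def qInl (s : ResTerm) : ResTerm := rmk (.inl (rout s))

/-- Right injection `• ⊕ (-)` on resource terms. -/
noncomputable def qInr (s : ResTerm) : ResTerm := rmk (.inr (rout s))

/-- Application `⟨s⟩t̄` of a resource term to a resource monomial. -/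
noncomputable def qApp (s : ResTerm) (t : Multiset ResTerm) : ResTerm :=
  rmk (.app (rout s) (t.toList.map rout))

/-! ### Coherence -/

mutual
  /-- Coherence on rigid resource terms. -/
  inductive CohT : Rt → Rt → Prop
    | var (x : ℕ) : CohT (.var x) (.var x)
    | lam {a a'} : CohT a a' → CohT (.lam a) (.lam a')
    | app {c c' : Rt} {ds ds' : List Rt} :
        CohT c c' → CohM ds ds' → CohT (.app c ds) (.app c' ds')
    | inl {a a'} : CohT a a' → CohT (.inl a) (.inl a')
    | inr {a a'} : CohT a a' → CohT (.inr a) (.inr a')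
    | mix (a a' : Rt) : CohT (.inl a) (.inr a')
  /-- Coherence on rigid monomials: all elements pairwise coherent. -/
  inductive CohM : List Rt → List Rt → Prop
    | mk {ds ds' : List Rt} (H : ∀ b ∈ ds ++ ds', ∀ b' ∈ ds ++ ds', CohT b b') :
        CohM ds ds'
end

/-- Coherence on rigid expressions. -/
def CohE : REx → REx → Prop
  | .inl a, .inl a' => CohT a a'
  | .inr l, .inr l' => CohM l l'
  | _, _ => False

/-! ### Coherence on resource expressions -/

/-- Coherence on resource terms. -/
def CohQT (s s' : ResTerm) : Prop :=
  ∃ a a', rmk a = s ∧ rmk a' = s' ∧ CohT a a'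

/-- Coherence on resource monomials. -/
def CohQM (m m' : Multiset ResTerm) : Prop :=
  ∃ bs bs', toMul bs = m ∧ toMul bs' = m' ∧ CohM bs bs'

/-- Coherence on resource expressions. -/
def CohQE : ResExpr → ResExpr → Prop
  | .inl s, .inl s' => CohQT s s'
  | .inr m, .inr m' => CohQM m m'
  | _, _ => False

/-! ### Occurrence counting and rigid substitution -/

namespace Rt

/-- Shift free de Bruijn indices `≥ c` up by one in a rigid term. -/
def shiftR (c : ℕ) : Rt → Rt
  | .var n => .var (if n < c then n else n + 1)
  | .lam a => .lam (a.shiftR (c + 1))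
  | .inl a => .inl (a.shiftR c)
  | .inr a => .inr (a.shiftR c)
  | .app d es => .app (d.shiftR c) (es.attach.map fun e => e.1.shiftR c)
termination_by r => sizeOf r
decreasing_by
  all_goals simp_wf
  all_goals try omega
  all_goals (have := List.sizeOf_lt_of_mem e.2; omega)

end Rt

/-- Number of free occurrences `n_x(a)` of the variable `x` in a rigid term. -/
def nx (x : ℕ) : Rt → ℕ
  | .var n => if n = x then 1 else 0
  | .lam a => nx (x + 1) a
  | .inl a => nx x a
  | .inr a => nx x a
  | .app d es => nx x d + (es.attach.map fun e => nx x e.1).sum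
termination_by r => sizeOf r
decreasing_by
  all_goals simp_wf
  all_goals try omega
  all_goals (have := List.sizeOf_lt_of_mem e.2; omega)

/-- Number of free occurrences of `x` in a rigid monomial. -/
def nxL (x : ℕ) (l : List Rt) : ℕ := (l.map (nx x)).sum

/-- Number of free occurrences of `x` in a rigid expression. -/
def nxE (x : ℕ) : REx → ℕ := Sum.elim (nx x) (nxL x)

mutual
  /-- Rigid substitution `r[b⃗/x]`: the occurrences of `x` in `r`, taken from
  left to right, are replaced by the successive elements of `b⃗`; it is
  undefined (`none`, i.e. the partial rigid expression `0`) unless `n_x(r) = |b⃗|`. -/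
  def rsubst : Rt → ℕ → List Rt → Option Rt
    | .var n, x, bs =>
        if n = x then (match bs with | [b] => some b | _ => none)
        else (match bs with
              | [] => some (.var (if x < n then n - 1 else n))
              | _ => none)
    | .lam a, x, bs => (rsubst a (x + 1) (bs.map (Rt.shiftR 0))).map .lam
    | .inl a, x, bs => (rsubst a x bs).map .inl
    | .inr a, x, bs => (rsubst a x bs).map .inr
    | .app c ds, x, bs =>
        match rsubst c x (bs.take (nx x c)), rsubstL ds x (bs.drop (nx x c)) with
        | some c', some ds' => some (.app c' ds')
        | _, _ => none
  /-- Rigid substitution in a rigid monomial. -/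
  def rsubstL : List Rt → ℕ → List Rt → Option (List Rt)
    | [], _, bs => (match bs with | [] => some [] | _ => none)
    | a :: as, x, bs =>
        match rsubst a x (bs.take (nx x a)), rsubstL as x (bs.drop (nx x a)) with
        | some a', some as' => some (a' :: as')
        | _, _ => none
end

/-- Rigid substitution on rigid expressions. -/
def rsubstE : REx → ℕ → List Rt → Option REx
  | .inl r, x, bs => (rsubst r x bs).map .inl
  | .inr l, x, bs => (rsubstL l x bs).map .inr

/-- Left action of a permutation on a list:
`σ·(b₁,…,bₙ) = (b_{σ⁻¹(1)},…,b_{σ⁻¹(n)})` (identity if the length is not `n`). -/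
def permList {α : Type*} {n : ℕ} (σ : Equiv.Perm (Fin n)) (l : List α) : List α :=
  if h : l.length = n then List.ofFn (fun j : Fin n => l.get ((σ.symm j).cast h.symm))
  else l

/-! ### Symmetric multilinear substitution -/

/-- Symmetric multilinear substitution computed on rigid representatives:
`∑_{σ ∈ S_n} |r[σ·b⃗/x]|`, as a finite ℕ-linear sum of resource expressions. -/
noncomputable def dsubRig (x : ℕ) (r : REx) (bs : List Rt) : ResExpr →₀ ℕ :=
  ∑ σ : Equiv.Perm (Fin bs.length),
    (rsubstE r x (permList σ bs)).elim 0 (fun u => Finsupp.single (toQ u) 1)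

/-- The symmetric multilinear substitution `∂_x e · t̄`, a finite ℕ-linear sum
of resource expressions. -/
noncomputable def dsub (x : ℕ) (e : ResExpr) (t : Multiset ResTerm) : ResExpr →₀ ℕ :=
  dsubRig x (outE e) (t.toList.map rout)

/-! ### Multiplicity coefficients -/

/-- The factor `∏ᵢ kᵢ!` of the multiplicity of a rigid monomial, where the `kᵢ`
are the multiplicities of the pairwise distinct resource terms represented in it. -/
noncomputable def stabFac (bs : List Rt) : ℕ :=
  letI := Classical.decEq ResTerm
  (toMul bs).toFinset.prod fun t => Nat.factorial ((toMul bs).count t)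

/-- Multiplicity coefficient of a rigid term; for a monomial representing
`[t₁]^{k₁}·…·[tₚ]^{kₚ}` (the `tᵢ` pairwise distinct) the factor contributed is
`∏ᵢ kᵢ! · m(tᵢ)^{kᵢ} = (∏ᵢ kᵢ!) · ∏_{b ∈ b⃗} m(b)`. -/
noncomputable def mRig : Rt → ℕ
  | .var _ => 1
  | .lam a => mRig a
  | .inl a => mRig a
  | .inr a => mRig a
  | .app c ds => mRig c * (stabFac ds * (ds.attach.map fun e => mRig e.1).prod)
termination_by r => sizeOf r
decreasing_by
  all_goals simp_wf
  all_goals try omega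
  all_goals (have := List.sizeOf_lt_of_mem e.2; omega)

/-- Multiplicity coefficient `m(s)` of a resource term. -/
noncomputable def mT (s : ResTerm) : ℕ := mRig (rout s)

/-- Multiplicity coefficient `m(t̄) = ∏ᵢ kᵢ! · m(tᵢ)^{kᵢ}` of a resource
monomial `[t₁]^{k₁}·…·[tₚ]^{kₚ}` with the `tᵢ` pairwise distinct. -/
noncomputable def mMon (m : Multiset ResTerm) : ℕ :=
  letI := Classical.decEq ResTerm
  m.toFinset.prod fun t => Nat.factorial (m.count t) * (mT t) ^ (m.count t)

/-- Multiplicity coefficient of a resource expression. -/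
noncomputable def mE : ResExpr → ℕ := Sum.elim mT mMon

/-! ### Resource reduction -/

/-- Context `λx.(-)` applied to a sum element. -/
noncomputable def cLam : ResExpr → ResExpr
  | .inl s => .inl (qLam s)
  | e => e

/-- Context `(-)⊕•`. -/
noncomputable def cInl : ResExpr → ResExpr
  | .inl s => .inl (qInl s)
  | e => e

/-- Context `•⊕(-)`. -/
noncomputable def cInr : ResExpr → ResExpr
  | .inl s => .inl (qInr s)
  | e => e

/-- Context `⟨-⟩t̄`. -/
noncomputable def cAppL (t : Multiset ResTerm) : ResExpr → ResExpr
  | .inl s => .inl (qApp s t)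
  | e => e

/-- Context `⟨s⟩(-)`. -/
noncomputable def cAppR (s : ResTerm) : ResExpr → ResExpr
  | .inr m => .inl (qApp s m)
  | e => e

/-- Context `[-]·t̄`. -/
noncomputable def cMon (t : Multiset ResTerm) : ResExpr → ResExpr
  | .inl s => .inr (s ::ₘ t)
  | e => e

/-- One-step reduction `→∂` from resource expressions to finite ℕ-linear sums
of resource expressions. -/
inductive Red : ResExpr → (ResExpr →₀ ℕ) → Prop
  | beta (s : ResTerm) (t : Multiset ResTerm) :
      Red (.inl (qApp (qLam s) t)) (dsub 0 (.inl s) t)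
  | appInl (s : ResTerm) (t : Multiset ResTerm) :
      Red (.inl (qApp (qInl s) t)) (Finsupp.single (.inl (qInl (qApp s t))) 1)
  | appInr (s : ResTerm) (t : Multiset ResTerm) :
      Red (.inl (qApp (qInr s) t)) (Finsupp.single (.inl (qInr (qApp s t))) 1)
  | lamInl (s : ResTerm) :
      Red (.inl (qLam (qInl s))) (Finsupp.single (.inl (qInl (qLam s))) 1)
  | lamInr (s : ResTerm) :
      Red (.inl (qLam (qInr s))) (Finsupp.single (.inl (qInr (qLam s))) 1)
  | lamCtx {s : ResTerm} {S : ResExpr →₀ ℕ} :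
      Red (.inl s) S → Red (.inl (qLam s)) (S.mapDomain cLam)
  | appLCtx {s : ResTerm} {S : ResExpr →₀ ℕ} (t : Multiset ResTerm) :
      Red (.inl s) S → Red (.inl (qApp s t)) (S.mapDomain (cAppL t))
  | appRCtx {t : Multiset ResTerm} {T : ResExpr →₀ ℕ} (s : ResTerm) :
      Red (.inr t) T → Red (.inl (qApp s t)) (T.mapDomain (cAppR s))
  | inlCtx {s : ResTerm} {S : ResExpr →₀ ℕ} :
      Red (.inl s) S → Red (.inl (qInl s)) (S.mapDomain cInl)
  | inrCtx {s : ResTerm} {S : ResExpr →₀ ℕ} :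
      Red (.inl s) S → Red (.inl (qInr s)) (S.mapDomain cInr)
  | monCtx {s : ResTerm} {S : ResExpr →₀ ℕ} (t : Multiset ResTerm) :
      Red (.inl s) S → Red (.inr (s ::ₘ t)) (S.mapDomain (cMon t))

/-- Reduction `→∂` on finite ℕ-linear sums of resource expressions:
`e + F →∂ E₀ + F` whenever `e →∂ E₀`. -/
def RedS (E E' : ResExpr →₀ ℕ) : Prop :=
  ∃ (e : ResExpr) (E₀ F : ResExpr →₀ ℕ),
    Red e E₀ ∧ E = Finsupp.single e 1 + F ∧ E' = E₀ + F

/-- The (unique) `→∂`-normal form of a resource expression: the normal sum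
reachable from it (`→∂` being confluent and strongly normalizing). -/
noncomputable def NF (e : ResExpr) : ResExpr →₀ ℕ :=
  Classical.epsilon fun E =>
    Relation.ReflTransGen RedS (Finsupp.single e 1) E ∧ ∀ E', ¬ RedS E E'


/-! ### Quotient presentation of resource terms -/

theorem Rt.ind {P : Rt → Prop} (var : ∀ n, P (.var n)) (lam : ∀ a, P a → P (.lam a))
    (app : ∀ c ds, P c → (∀ d ∈ ds, P d) → P (.app c ds)) (inl : ∀ a, P a → P (.inl a))
    (inr : ∀ a, P a → P (.inr a)) : ∀ a, P a
  | .var n => var n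
  | .lam a => lam a (Rt.ind var lam app inl inr a)
  | .app c ds => app c ds (Rt.ind var lam app inl inr c)
      (fun d _ => Rt.ind var lam app inl inr d)
  | .inl a => inl a (Rt.ind var lam app inl inr a)
  | .inr a => inr a (Rt.ind var lam app inl inr a)
termination_by a => sizeOf a
decreasing_by
  all_goals simp_wf
  all_goals try omega
  all_goals (have := List.sizeOf_lt_of_mem ‹_ ∈ _›; omega)

theorem IsoT.refl (a : Rt) : IsoT a a := by
  induction a using Rt.ind with
  | var n => exact .var n
  | lam a h => exact .lam h
  | inl a h => exact .inl h
  | inr a h => exact .inr h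
  | app c ds hc hd =>
    exact .app hc (.mk _ _ rfl 1 fun i => hd _ (List.get_mem _ _))

theorem List.Perm.exists_equiv_get {α : Type*} {l l' : List α} (h : l.Perm l') :
    ∃ σ : Fin l.length ≃ Fin l'.length, ∀ i, l'.get (σ i) = l.get i := by
  induction h with
  | nil => exact ⟨Equiv.refl _, fun i => i.elim0⟩
  | @cons x l₁ l₂ _ ih =>
    obtain ⟨σ, hσ⟩ := ih
    refine ⟨(finSuccEquiv _).trans ((Equiv.optionCongr σ).trans (finSuccEquiv _).symm), ?_⟩
    intro i
    refine Fin.cases ?_ (fun j => ?_) i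
    · simp
    · simpa using hσ j
  | swap x y l =>
    refine ⟨Equiv.swap (0 : Fin (l.length + 2)) 1, ?_⟩
    intro i
    refine Fin.cases ?_ (fun j => ?_) i
    · have : Equiv.swap (0 : Fin (l.length + 2)) 1 0 = 1 := Equiv.swap_apply_left _ _
      exact (congrArg (List.get (x :: y :: l)) this).trans rfl
    · refine Fin.cases ?_ (fun j => ?_) j
      · have : Equiv.swap (0 : Fin (l.length + 2)) 1 1 = 0 := Equiv.swap_apply_right _ _
        exact (congrArg (List.get (x :: y :: l)) this).trans rfl
      · have : Equiv.swap (0 : Fin (l.length + 2)) 1 j.succ.succ = j.succ.succ :=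
          Equiv.swap_apply_of_ne_of_ne (Fin.succ_ne_zero _)
            (by intro h; exact Fin.succ_ne_zero j (Fin.succ_injective _ h))
        exact (congrArg (List.get (x :: y :: l)) this).trans rfl
  | trans _ _ ih₁ ih₂ =>
    obtain ⟨σ, hσ⟩ := ih₁
    obtain ⟨τ, hτ⟩ := ih₂
    exact ⟨σ.trans τ, fun i => (hτ _).trans (hσ i)⟩

theorem IsoM.of_perm {ds ds' : List Rt} (h : ds.Perm ds') : IsoM ds ds' := by
  obtain ⟨σ, hσ⟩ := h.exists_equiv_get
  refine .mk _ _ h.length_eq.symm (σ.trans (finCongr h.length_eq.symm)) fun i => ?_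
  have : ds'.get (Fin.cast h.length_eq ((σ.trans (finCongr h.length_eq.symm)) i)) = ds.get i :=
    hσ i
  rw [this]
  exact IsoT.refl _

theorem IsoM.of_forall₂ {ds ds' : List Rt} (h : List.Forall₂ IsoT ds ds') : IsoM ds ds' := by
  refine .mk _ _ h.length_eq.symm 1 fun i => ?_
  exact (List.forall₂_iff_get.mp h).2 i i.2 (h.length_eq ▸ i.2)

theorem rmk_rout (s : ResTerm) : rmk (rout s) = s := Quot.out_eq s

theorem map_rmk_rout (l : List ResTerm) : (l.map rout).map rmk = l := by
  simp [Function.comp_def, rmk_rout]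

theorem toMul_map_rout (l : List ResTerm) : toMul (l.map rout) = ↑l := by
  rw [toMul, map_rmk_rout]

theorem rmk_lam (a : Rt) : rmk (.lam a) = qLam (rmk a) := by
  have := congrArg (Quot.map Rt.lam (rb := IsoT) fun _ _ h => .lam h) (rmk_rout (rmk a))
  exact this.symm

theorem rmk_inl (a : Rt) : rmk (.inl a) = qInl (rmk a) := by
  have := congrArg (Quot.map Rt.inl (rb := IsoT) fun _ _ h => .inl h) (rmk_rout (rmk a))
  exact this.symm

theorem rmk_inr (a : Rt) : rmk (.inr a) = qInr (rmk a) := by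
  have := congrArg (Quot.map Rt.inr (rb := IsoT) fun _ _ h => .inr h) (rmk_rout (rmk a))
  exact this.symm

theorem rmk_app_congr_head {c c' : Rt} (h : rmk c = rmk c') (ds : List Rt) :
    rmk (.app c ds) = rmk (.app c' ds) :=
  congrArg (Quot.map (fun c => Rt.app c ds) (rb := IsoT)
    fun _ _ h => .app h (.of_perm (.refl _))) h

theorem rmk_app_congr_arg (c : Rt) {d d' : Rt} (h : rmk d = rmk d') (l₁ l₂ : List Rt) :
    rmk (.app c (l₁ ++ d :: l₂)) = rmk (.app c (l₁ ++ d' :: l₂)) := by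
  refine congrArg (Quot.map (fun d => Rt.app c (l₁ ++ d :: l₂)) (rb := IsoT)
    fun _ _ h => .app (.refl _) (.of_forall₂ ?_)) h
  refine List.rel_append ?_ (.cons h ?_) <;>
  exact List.forall₂_same.mpr fun x _ => IsoT.refl x

theorem rmk_app_congr_map (c : Rt) (ds : List Rt) : ∀ (l₁ ds' : List Rt),
    ds.map rmk = ds'.map rmk → rmk (.app c (l₁ ++ ds)) = rmk (.app c (l₁ ++ ds')) := by
  induction ds with
  | nil => intro l₁ ds' h; cases ds' <;> simp_all
  | cons d ds ih =>
    intro l₁ ds' h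
    cases ds' with
    | nil => simp at h
    | cons d' ds' =>
      simp only [List.map_cons, List.cons.injEq] at h
      rw [rmk_app_congr_arg c h.1]
      have := ih (l₁ ++ [d']) ds' h.2
      simpa using this

theorem rmk_app_congr {c c' : Rt} {ds ds' : List Rt} (hc : rmk c = rmk c')
    (h : toMul ds = toMul ds') : rmk (.app c ds) = rmk (.app c' ds') := by
  rw [rmk_app_congr_head hc]
  have h' : (ds.map rmk).Perm (ds'.map rmk) := Multiset.coe_eq_coe.mp h
  obtain ⟨es, h₁, h₂⟩ : Relation.Comp (· = List.map rmk ·) List.Perm (ds'.map rmk) ds := by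
    rw [List.eq_map_comp_perm]; exact h'.symm
  have h₁' : ds'.map rmk = es.map rmk := h₁
  have := rmk_app_congr_map c' ds' [] es h₁'
  simp only [List.nil_append] at this
  rw [this]
  exact Quot.sound (.app (.refl _) (.of_perm h₂.symm))

theorem rmk_app (c : Rt) (ds : List Rt) : rmk (.app c ds) = qApp (rmk c) (toMul ds) :=
  rmk_app_congr (rmk_rout _).symm (by rw [toMul_map_rout, Multiset.coe_toList])

/-- Structural induction on resource terms. -/
theorem ResTerm.ind {P : ResTerm → Prop} (var : ∀ n, P (qVar n)) (lam : ∀ s, P s → P (qLam s))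
    (inl : ∀ s, P s → P (qInl s)) (inr : ∀ s, P s → P (qInr s))
    (app : ∀ s t, P s → (∀ u ∈ t, P u) → P (qApp s t)) : ∀ s, P s := by
  have key : ∀ a, P (rmk a) := by
    intro a
    induction a using Rt.ind with
    | var n => exact var n
    | lam a h => rw [rmk_lam]; exact lam _ h
    | inl a h => rw [rmk_inl]; exact inl _ h
    | inr a h => rw [rmk_inr]; exact inr _ h
    | app c ds hc hd =>
      rw [rmk_app]
      refine app _ _ hc fun u hu => ?_
      obtain ⟨d, hd', rfl⟩ := List.mem_map.mp (Multiset.mem_coe.mp hu)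
      exact hd d hd'
  intro s
  rw [← rmk_rout s]
  exact key _

/-- Data for a definition by structural recursion on resource terms. -/
structure ResAlg (A : Type*) where
  var : ℕ → A
  lam : ResTerm → A → A
  inl : ResTerm → A → A
  inr : ResTerm → A → A
  app : ResTerm → A → Multiset (ResTerm × A) → A

namespace ResAlg

variable {A : Type*} (alg : ResAlg A)

/-- Structural recursion on rigid terms. -/
def recRt : Rt → A
  | .var n => alg.var n
  | .lam a => alg.lam (rmk a) (recRt a)
  | .inl a => alg.inl (rmk a) (recRt a)
  | .inr a => alg.inr (rmk a) (recRt a)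
  | .app c ds => alg.app (rmk c) (recRt c) ↑(ds.attach.map fun d => (rmk d.1, recRt d.1))
termination_by a => sizeOf a
decreasing_by
  all_goals simp_wf
  all_goals try omega
  all_goals (have := List.sizeOf_lt_of_mem d.2; omega)

theorem recRt_app (c : Rt) (ds : List Rt) : alg.recRt (.app c ds) =
    alg.app (rmk c) (alg.recRt c) ↑(ds.map fun d => (rmk d, alg.recRt d)) := by
  rw [recRt, List.attach_map_val (f := fun d => (rmk d, alg.recRt d))]

theorem recRt_congr (a : Rt) : ∀ a', IsoT a a' → alg.recRt a = alg.recRt a' := by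
  induction a using Rt.ind with
  | var n => rintro _ ⟨⟩; rfl
  | lam a ih =>
    rintro _ ⟨⟩
    rename_i h
    rw [recRt, recRt, ih _ h, show rmk a = _ from Quot.sound h]; rfl
  | inl a ih =>
    rintro _ (_ | _ | h)
    rw [recRt, recRt, ih _ h, show rmk a = _ from Quot.sound h]; rfl
  | inr a ih =>
    rintro _ (_ | _ | _ | h)
    rw [recRt, recRt, ih _ h, show rmk a = _ from Quot.sound h]; rfl
  | app c ds hc hd =>
    rintro _ (_ | _ | _ | _ | @⟨_, c', _, ds', h, h'⟩)
    rw [recRt_app, recRt_app, hc _ h, show rmk c = _ from Quot.sound h]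
    congr 1
    obtain ⟨_, _, hl, σ, H⟩ := h'
    rw [Multiset.coe_eq_coe]
    set f := fun d => (rmk d, alg.recRt d) with hf
    have e : ds.map f =
        List.ofFn (fun i : Fin ds.length => f (ds'.get ((σ i).cast hl.symm))) := by
      conv_lhs => rw [← List.ofFn_get ds, List.map_ofFn]
      congr 1
      funext i
      simp only [Function.comp, hf]
      rw [hd _ (List.get_mem _ _) _ (H i), show rmk (ds.get i) = _ from Quot.sound (H i)]
      rfl
    rw [e]
    refine (Equiv.Perm.ofFn_comp_perm σ fun i => f (ds'.get (i.cast hl.symm))).trans ?_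
    have : ds'.map f = List.ofFn fun i : Fin ds.length => f (ds'.get (i.cast hl.symm)) := by
      conv_lhs => rw [← List.ofFn_get ds', List.map_ofFn]
      rw [List.ofFn_congr hl]
      rfl
    rw [this]

/-- Structural recursion on resource terms. -/
def fold (s : ResTerm) : A := Quot.lift alg.recRt (fun a a' h => alg.recRt_congr a a' h) s

theorem fold_rmk (a : Rt) : alg.fold (rmk a) = alg.recRt a := rfl

theorem fold_var (n : ℕ) : alg.fold (qVar n) = alg.var n := by
  rw [qVar, fold_rmk, recRt]

theorem fold_lam (s : ResTerm) : alg.fold (qLam s) = alg.lam s (alg.fold s) := by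
  rw [qLam, fold_rmk, recRt, ← fold_rmk, rmk_rout]

theorem fold_inl (s : ResTerm) : alg.fold (qInl s) = alg.inl s (alg.fold s) := by
  rw [qInl, fold_rmk, recRt, ← fold_rmk, rmk_rout]

theorem fold_inr (s : ResTerm) : alg.fold (qInr s) = alg.inr s (alg.fold s) := by
  rw [qInr, fold_rmk, recRt, ← fold_rmk, rmk_rout]

theorem fold_app (s : ResTerm) (t : Multiset ResTerm) :
    alg.fold (qApp s t) = alg.app s (alg.fold s) (t.map fun u => (u, alg.fold u)) := by
  rw [qApp, fold_rmk, recRt_app, ← fold_rmk, rmk_rout]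
  congr 1
  conv_rhs => rw [← Multiset.coe_toList t]
  rw [List.map_map, Multiset.map_coe]
  simp only [Function.comp_def, ← fold_rmk, rmk_rout]

end ResAlg

/-- The outermost shape of a resource term. -/
inductive Shape
  | var (n : ℕ)
  | lam (s : ResTerm)
  | inl (s : ResTerm)
  | inr (s : ResTerm)
  | app (s : ResTerm) (t : Multiset ResTerm)

/-- The outermost shape of a resource term. -/
def shape (s : ResTerm) : Shape :=
  ResAlg.fold ⟨.var, fun s _ => .lam s, fun s _ => .inl s, fun s _ => .inr s,
    fun s _ t => .app s (t.map Prod.fst)⟩ s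

@[simp] theorem shape_var (n : ℕ) : shape (qVar n) = .var n := ResAlg.fold_var _ n
@[simp] theorem shape_lam (s : ResTerm) : shape (qLam s) = .lam s := ResAlg.fold_lam _ s
@[simp] theorem shape_inl (s : ResTerm) : shape (qInl s) = .inl s := ResAlg.fold_inl _ s
@[simp] theorem shape_inr (s : ResTerm) : shape (qInr s) = .inr s := ResAlg.fold_inr _ s
@[simp] theorem shape_app (s : ResTerm) (t : Multiset ResTerm) :
    shape (qApp s t) = .app s t := by
  rw [shape, ResAlg.fold_app]; simp

@[simp] theorem qLam_inj {s s' : ResTerm} : qLam s = qLam s' ↔ s = s' :=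
  ⟨fun h => by simpa using congrArg shape h, congrArg _⟩
@[simp] theorem qInl_inj {s s' : ResTerm} : qInl s = qInl s' ↔ s = s' :=
  ⟨fun h => by simpa using congrArg shape h, congrArg _⟩
@[simp] theorem qInr_inj {s s' : ResTerm} : qInr s = qInr s' ↔ s = s' :=
  ⟨fun h => by simpa using congrArg shape h, congrArg _⟩
@[simp] theorem qApp_inj {s s' : ResTerm} {t t' : Multiset ResTerm} :
    qApp s t = qApp s' t' ↔ s = s' ∧ t = t' :=
  ⟨fun h => by simpa using congrArg shape h, fun h => by rw [h.1, h.2]⟩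

theorem ne_of_shape_ne {s s' : ResTerm} (h : shape s ≠ shape s') : s ≠ s' :=
  fun e => h (congrArg shape e)

/-! ### Linear and bilinear extensions with natural coefficients -/

section Linear

variable {X Y Z : Type} {K K' : Type} [CommSemiring K] [CommSemiring K']

/-- Coefficientwise cast of a finite sum with natural coefficients. -/
noncomputable def castF (K : Type) [CommSemiring K] (F : Z →₀ ℕ) : Z →₀ K :=
  F.mapRange Nat.cast Nat.cast_zero

@[simp] theorem castF_apply (F : Z →₀ ℕ) (z : Z) : castF K F z = (F z : K) := rfl

@[simp] theorem castF_zero : castF K (0 : Z →₀ ℕ) = 0 := by ext; simp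

@[simp] theorem castF_add (F G : Z →₀ ℕ) : castF K (F + G) = castF K F + castF K G := by
  ext; simp

@[simp] theorem castF_single (z : Z) (n : ℕ) :
    castF K (Finsupp.single z n) = Finsupp.single z (n : K) := by
  simp [castF]

@[simp] theorem castF_nat (F : Z →₀ ℕ) : castF ℕ F = F := by ext; simp

/-- Linear extension of a family of sums with natural coefficients. -/
noncomputable def lin (g : X → Z →₀ ℕ) : (X →₀ K) →ₗ[K] (Z →₀ K) :=
  Finsupp.linearCombination K fun x => castF K (g x)

/-- Bilinear extension of a family of sums with natural coefficients. -/
noncomputable def bil (g : X → Y → Z →₀ ℕ) : (X →₀ K) →ₗ[K] (Y →₀ K) →ₗ[K] (Z →₀ K) :=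
  Finsupp.linearCombination K fun x => Finsupp.linearCombination K fun y => castF K (g x y)

theorem lin_single (g : X → Z →₀ ℕ) (x : X) (a : K) :
    lin g (Finsupp.single x a) = a • castF K (g x) := by
  simp [lin]

theorem bil_single (g : X → Y → Z →₀ ℕ) (x : X) (y : Y) (a b : K) :
    bil g (Finsupp.single x a) (Finsupp.single y b) = (a * b) • castF K (g x y) := by
  simp [bil, mul_smul]

/-- Change of coefficients along an additive map. -/
noncomputable def bc (ψ : K →+ K') : (Z →₀ K) →+ (Z →₀ K') := Finsupp.mapRange.addMonoidHom ψ

@[simp] theorem bc_apply (ψ : K →+ K') (F : Z →₀ K) (z : Z) : bc ψ F z = ψ (F z) := rfl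

@[simp] theorem bc_single (ψ : K →+ K') (z : Z) (a : K) :
    bc ψ (Finsupp.single z a) = Finsupp.single z (ψ a) := by simp [bc]

theorem bc_smul_castF (ψ : K →+ K') (a : K) (F : Z →₀ ℕ) :
    bc ψ (a • castF K F) = ψ a • castF K' F := by
  ext z
  simp only [bc_apply, Finsupp.smul_apply, castF_apply, smul_eq_mul]
  rw [mul_comm, ← nsmul_eq_mul, map_nsmul, nsmul_eq_mul, mul_comm]

theorem bc_castF (φ : K →+* K') (F : Z →₀ ℕ) :
    bc (φ : K →+ K') (castF K F) = castF K' F := by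
  ext; simp

theorem bc_smul (φ : K →+* K') (a : K) (F : Z →₀ K) :
    bc (φ : K →+ K') (a • F) = φ a • bc (φ : K →+ K') F := by
  ext; simp

theorem bc_lin (ψ : K →+ K') (g : X → Z →₀ ℕ) (S : X →₀ K) :
    bc ψ (lin g S) = lin g (bc ψ S) := by
  induction S using Finsupp.induction_linear with
  | zero => simp
  | add f g hf hg => simp only [map_add, hf, hg]
  | single x a => rw [bc_single, lin_single, lin_single, bc_smul_castF]

theorem bc_bil (φ : K →+* K') (g : X → Y → Z →₀ ℕ) (S : X →₀ K) (T : Y →₀ K) :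
    bc (φ : K →+ K') (bil g S T) = bil g (bc (φ : K →+ K') S) (bc (φ : K →+ K') T) := by
  induction S using Finsupp.induction_linear with
  | zero => simp
  | add f g hf hg => simp only [map_add, LinearMap.add_apply, hf, hg]
  | single x a =>
    induction T using Finsupp.induction_linear with
    | zero => simp
    | add f g hf hg => simp only [map_add, hf, hg]
    | single y b =>
      rw [bc_single, bc_single, bil_single, bil_single, bc_smul_castF]
      simp

/-- Equality of linear maps on sums is checked on basis elements. -/
theorem lin_ext {V : Type} [AddCommMonoid V] [Module K V] {F G : (X →₀ K) →ₗ[K] V}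
    (h : ∀ x, F (Finsupp.single x 1) = G (Finsupp.single x 1)) (S : X →₀ K) : F S = G S := by
  have : F = G := Finsupp.lhom_ext' fun x => LinearMap.ext_ring (h x)
  rw [this]

theorem bil_ext {V : Type} [AddCommMonoid V] [Module K V]
    {F G : (X →₀ K) →ₗ[K] (Y →₀ K) →ₗ[K] V}
    (h : ∀ x y, F (Finsupp.single x 1) (Finsupp.single y 1) =
      G (Finsupp.single x 1) (Finsupp.single y 1)) (S : X →₀ K) (T : Y →₀ K) :
    F S T = G S T := by
  have : F S = G S := lin_ext (F := F) (G := G) (fun x => by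
    ext1 y; exact LinearMap.ext_ring (h x y)) S
  rw [this]

end Linear

/-! ### Constructors commuting with sums -/

/-- Sums of resource terms. -/
abbrev TS (K : Type) [CommSemiring K] : Type := ResTerm →₀ K

/-- Sums of resource monomials. -/
abbrev BS (K : Type) [CommSemiring K] : Type := Multiset ResTerm →₀ K

/-- Extend a function through the outermost injections of a term. -/
noncomputable def push {A : Type} (f : ResTerm → A) (i r : A → A) (s : ResTerm) : A :=
  ResAlg.fold ⟨fun n => f (qVar n), fun s _ => f (qLam s), fun _ => i, fun _ => r,
    fun s _ t => f (qApp s (t.map Prod.fst))⟩ s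

section Push
variable {A : Type} (f : ResTerm → A) (i r : A → A)
@[simp] theorem push_var (n : ℕ) : push f i r (qVar n) = f (qVar n) := ResAlg.fold_var _ n
@[simp] theorem push_lam (s : ResTerm) : push f i r (qLam s) = f (qLam s) := ResAlg.fold_lam _ s
@[simp] theorem push_inl (s : ResTerm) : push f i r (qInl s) = i (push f i r s) :=
  ResAlg.fold_inl _ s
@[simp] theorem push_inr (s : ResTerm) : push f i r (qInr s) = r (push f i r s) :=
  ResAlg.fold_inr _ s
@[simp] theorem push_app (s : ResTerm) (t : Multiset ResTerm) :
    push f i r (qApp s t) = f (qApp s t) := by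
  rw [push, ResAlg.fold_app]; simp
end Push

/-- Induction through the outermost injections. -/
theorem ResTerm.pushInd {P : ResTerm → Prop} (var : ∀ n, P (qVar n)) (lam : ∀ s, P (qLam s))
    (inl : ∀ s, P s → P (qInl s)) (inr : ∀ s, P s → P (qInr s))
    (app : ∀ s t, P (qApp s t)) (s : ResTerm) : P s :=
  ResTerm.ind var (fun s _ => lam s) inl inr (fun s t _ _ => app s t) s

/-- Abstraction, pushed under injections. -/
noncomputable def lamP : ResTerm → ResTerm := push qLam qInl qInr

/-- Application, pushed under injections of the function. -/
noncomputable def appP (s : ResTerm) (t : Multiset ResTerm) : ResTerm :=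
  push (fun s => qApp s t) qInl qInr s

@[simp] theorem lamP_inl (s : ResTerm) : lamP (qInl s) = qInl (lamP s) := push_inl _ _ _ s
@[simp] theorem lamP_inr (s : ResTerm) : lamP (qInr s) = qInr (lamP s) := push_inr _ _ _ s
@[simp] theorem lamP_var (n : ℕ) : lamP (qVar n) = qLam (qVar n) := push_var _ _ _ n
@[simp] theorem lamP_lam (s : ResTerm) : lamP (qLam s) = qLam (qLam s) := push_lam _ _ _ s
@[simp] theorem lamP_app (s : ResTerm) (t : Multiset ResTerm) :
    lamP (qApp s t) = qLam (qApp s t) := push_app _ _ _ s t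
@[simp] theorem appP_inl (s : ResTerm) (t : Multiset ResTerm) :
    appP (qInl s) t = qInl (appP s t) := push_inl _ _ _ s
@[simp] theorem appP_inr (s : ResTerm) (t : Multiset ResTerm) :
    appP (qInr s) t = qInr (appP s t) := push_inr _ _ _ s
@[simp] theorem appP_var (n : ℕ) (t : Multiset ResTerm) :
    appP (qVar n) t = qApp (qVar n) t := push_var _ _ _ n
@[simp] theorem appP_lam (s : ResTerm) (t : Multiset ResTerm) :
    appP (qLam s) t = qApp (qLam s) t := push_lam _ _ _ s
@[simp] theorem appP_app (s : ResTerm) (t' t : Multiset ResTerm) :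
    appP (qApp s t') t = qApp (qApp s t') t := push_app _ _ _ s t'

section Ops

variable {K K' : Type} [CommSemiring K] [CommSemiring K']

/-- Linear extension of abstraction. -/
noncomputable def LAM : TS K →ₗ[K] TS K := lin fun s => Finsupp.single (lamP s) 1
/-- Linear extension of the left injection. -/
noncomputable def INL : TS K →ₗ[K] TS K := lin fun s => Finsupp.single (qInl s) 1
/-- Linear extension of the right injection. -/
noncomputable def INR : TS K →ₗ[K] TS K := lin fun s => Finsupp.single (qInr s) 1
/-- Bilinear extension of application. -/
noncomputable def APP : TS K →ₗ[K] BS K →ₗ[K] TS K :=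
  bil fun s t => Finsupp.single (appP s t) 1
/-- Bilinear extension of insertion in a monomial. -/
noncomputable def CONS : TS K →ₗ[K] BS K →ₗ[K] BS K :=
  bil fun s t => Finsupp.single (s ::ₘ t) 1

@[simp] theorem LAM_single (s : ResTerm) (a : K) :
    LAM (Finsupp.single s a) = Finsupp.single (lamP s) a := by simp [LAM, lin_single]
@[simp] theorem INL_single (s : ResTerm) (a : K) :
    INL (Finsupp.single s a) = Finsupp.single (qInl s) a := by simp [INL, lin_single]
@[simp] theorem INR_single (s : ResTerm) (a : K) :
    INR (Finsupp.single s a) = Finsupp.single (qInr s) a := by simp [INR, lin_single]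
@[simp] theorem APP_single (s : ResTerm) (t : Multiset ResTerm) (a b : K) :
    APP (Finsupp.single s a) (Finsupp.single t b) = Finsupp.single (appP s t) (a * b) := by
  simp [APP, bil_single]
@[simp] theorem CONS_single (s : ResTerm) (t : Multiset ResTerm) (a b : K) :
    CONS (Finsupp.single s a) (Finsupp.single t b) = Finsupp.single (s ::ₘ t) (a * b) := by
  simp [CONS, bil_single]

theorem LAM_INL (S : TS K) : LAM (INL S) = INL (LAM S) :=
  lin_ext (F := LAM.comp INL) (G := INL.comp LAM) (by simp) S
theorem LAM_INR (S : TS K) : LAM (INR S) = INR (LAM S) :=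
  lin_ext (F := LAM.comp INR) (G := INR.comp LAM) (by simp) S
theorem APP_INL (S : TS K) (T : BS K) : APP (INL S) T = INL (APP S T) :=
  bil_ext (F := APP.comp INL) (G := APP.compr₂ INL) (by simp) S T
theorem APP_INR (S : TS K) (T : BS K) : APP (INR S) T = INR (APP S T) :=
  bil_ext (F := APP.comp INR) (G := APP.compr₂ INR) (by simp) S T

theorem CONS_left_comm (S S' : TS K) (T : BS K) :
    CONS S (CONS S' T) = CONS S' (CONS S T) := by
  induction S using Finsupp.induction_linear with
  | zero => simp
  | add f g hf hg => simp only [map_add, LinearMap.add_apply, hf, hg]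
  | single x a =>
    induction S' using Finsupp.induction_linear with
    | zero => simp
    | add f g hf hg => simp only [map_add, LinearMap.add_apply, hf, hg]
    | single x' a' =>
      induction T using Finsupp.induction_linear with
      | zero => simp
      | add f g hf hg => simp only [map_add, hf, hg]
      | single y b =>
        simp only [CONS_single]
        rw [Multiset.cons_swap, mul_left_comm]

instance : LeftCommutative fun (S : TS K) (T : BS K) => CONS S T :=
  ⟨CONS_left_comm⟩

/-- The product of a multiset of sums of terms, as a sum of monomials. -/
noncomputable def bagP (m : Multiset (TS K)) : BS K :=
  m.foldr (fun S T => CONS S T) (Finsupp.single 0 1)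

@[simp] theorem bagP_zero : bagP (0 : Multiset (TS K)) = Finsupp.single 0 1 :=
  Multiset.foldr_zero _ _
@[simp] theorem bagP_cons (S : TS K) (m : Multiset (TS K)) :
    bagP (S ::ₘ m) = CONS S (bagP m) := Multiset.foldr_cons _ _ _ _

theorem bc_LAM (ψ : K →+ K') (S : TS K) : bc ψ (LAM S) = LAM (bc ψ S) := bc_lin _ _ _
theorem bc_INL (ψ : K →+ K') (S : TS K) : bc ψ (INL S) = INL (bc ψ S) := bc_lin _ _ _
theorem bc_INR (ψ : K →+ K') (S : TS K) : bc ψ (INR S) = INR (bc ψ S) := bc_lin _ _ _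
theorem bc_APP (φ : K →+* K') (S : TS K) (T : BS K) :
    bc (φ : K →+ K') (APP S T) = APP (bc (φ : K →+ K') S) (bc (φ : K →+ K') T) := bc_bil _ _ _ _
theorem bc_CONS (φ : K →+* K') (S : TS K) (T : BS K) :
    bc (φ : K →+ K') (CONS S T) = CONS (bc (φ : K →+ K') S) (bc (φ : K →+ K') T) :=
  bc_bil _ _ _ _

theorem bagP_single (f : ResTerm → ResTerm) (t : Multiset ResTerm) :
    bagP (t.map fun u => Finsupp.single (f u) (1 : K)) = Finsupp.single (t.map f) 1 := by
  induction t using Multiset.induction with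
  | empty => simp
  | cons u t ih => simp [ih]

end Ops

/-! ### Renaming and substitution -/

/-- Lift a renaming under a binder. -/
def upr (ξ : ℕ → ℕ) : ℕ → ℕ
  | 0 => 0
  | n + 1 => ξ n + 1

/-- Renaming, producing terms whose injections are pushed outwards. -/
noncomputable def ren (ξ : ℕ → ℕ) (s : ResTerm) : ResTerm :=
  ResAlg.fold (A := (ℕ → ℕ) → ResTerm) ⟨fun n ξ => qVar (ξ n), fun _ r ξ => lamP (r (upr ξ)),
    fun _ r ξ => qInl (r ξ), fun _ r ξ => qInr (r ξ),
    fun _ r t ξ => appP (r ξ) (t.map fun p => p.2 ξ)⟩ s ξ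

@[simp] theorem ren_var (ξ : ℕ → ℕ) (n : ℕ) : ren ξ (qVar n) = qVar (ξ n) :=
  congrFun (ResAlg.fold_var _ n) ξ
@[simp] theorem ren_lam (ξ : ℕ → ℕ) (s : ResTerm) : ren ξ (qLam s) = lamP (ren (upr ξ) s) :=
  congrFun (ResAlg.fold_lam _ s) ξ
@[simp] theorem ren_inl (ξ : ℕ → ℕ) (s : ResTerm) : ren ξ (qInl s) = qInl (ren ξ s) :=
  congrFun (ResAlg.fold_inl _ s) ξ
@[simp] theorem ren_inr (ξ : ℕ → ℕ) (s : ResTerm) : ren ξ (qInr s) = qInr (ren ξ s) :=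
  congrFun (ResAlg.fold_inr _ s) ξ
@[simp] theorem ren_app (ξ : ℕ → ℕ) (s : ResTerm) (t : Multiset ResTerm) :
    ren ξ (qApp s t) = appP (ren ξ s) (t.map (ren ξ)) := by
  rw [ren, ResAlg.fold_app]
  simp only [Multiset.map_map, Function.comp_def]
  rfl

theorem ren_lamP (ξ : ℕ → ℕ) (s : ResTerm) : ren ξ (lamP s) = lamP (ren (upr ξ) s) := by
  induction s using ResTerm.pushInd <;> simp_all

theorem ren_appP (ξ : ℕ → ℕ) (s : ResTerm) (t : Multiset ResTerm) :
    ren ξ (appP s t) = appP (ren ξ s) (t.map (ren ξ)) := by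
  induction s using ResTerm.pushInd <;> simp_all

theorem upr_comp (ξ ζ : ℕ → ℕ) : upr (ξ ∘ ζ) = upr ξ ∘ upr ζ := by
  funext n; cases n <;> rfl

theorem upr_id : upr id = id := by
  funext n; cases n <;> rfl

theorem ren_ren (ξ ζ : ℕ → ℕ) (s : ResTerm) : ren ξ (ren ζ s) = ren (ξ ∘ ζ) s := by
  induction s using ResTerm.ind generalizing ξ ζ with
  | var n => simp
  | lam s ih => rw [ren_lam, ren_lam, ren_lamP, ih, upr_comp]
  | inl s ih => simp [ih]
  | inr s ih => simp [ih]
  | app s t hs ht =>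
    rw [ren_app, ren_app, ren_appP, hs, Multiset.map_map]
    congr 1
    exact Multiset.map_congr rfl fun u hu => ht u hu ξ ζ

section Subst

variable {K K' : Type} [CommSemiring K] [CommSemiring K']

/-- Linear extension of renaming. -/
noncomputable def renT (ξ : ℕ → ℕ) : TS K →ₗ[K] TS K := lin fun s => Finsupp.single (ren ξ s) 1
/-- Linear extension of renaming to sums of monomials. -/
noncomputable def renB (ξ : ℕ → ℕ) : BS K →ₗ[K] BS K :=
  lin fun t => Finsupp.single (t.map (ren ξ)) 1

@[simp] theorem renT_single (ξ : ℕ → ℕ) (s : ResTerm) (a : K) :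
    renT ξ (Finsupp.single s a) = Finsupp.single (ren ξ s) a := by simp [renT, lin_single]
@[simp] theorem renB_single (ξ : ℕ → ℕ) (t : Multiset ResTerm) (a : K) :
    renB ξ (Finsupp.single t a) = Finsupp.single (t.map (ren ξ)) a := by
  simp [renB, lin_single]

theorem bc_renT (ψ : K →+ K') (ξ : ℕ → ℕ) (S : TS K) : bc ψ (renT ξ S) = renT ξ (bc ψ S) :=
  bc_lin _ _ _

theorem renT_LAM (ξ : ℕ → ℕ) (S : TS K) : renT ξ (LAM S) = LAM (renT (upr ξ) S) :=
  lin_ext (F := (renT ξ).comp LAM) (G := LAM.comp (renT (upr ξ))) (by simp [ren_lamP]) S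
theorem renT_INL (ξ : ℕ → ℕ) (S : TS K) : renT ξ (INL S) = INL (renT ξ S) :=
  lin_ext (F := (renT ξ).comp INL) (G := INL.comp (renT ξ)) (by simp) S
theorem renT_INR (ξ : ℕ → ℕ) (S : TS K) : renT ξ (INR S) = INR (renT ξ S) :=
  lin_ext (F := (renT ξ).comp INR) (G := INR.comp (renT ξ)) (by simp) S
theorem renT_APP (ξ : ℕ → ℕ) (S : TS K) (T : BS K) :
    renT ξ (APP S T) = APP (renT ξ S) (renB ξ T) :=
  bil_ext (F := APP.compr₂ (renT ξ)) (G := APP.compl₁₂ (renT ξ) (renB ξ))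
    (by simp [ren_appP]) S T
theorem renB_CONS (ξ : ℕ → ℕ) (S : TS K) (T : BS K) :
    renB ξ (CONS S T) = CONS (renT ξ S) (renB ξ T) :=
  bil_ext (F := CONS.compr₂ (renB ξ)) (G := CONS.compl₁₂ (renT ξ) (renB ξ)) (by simp) S T
theorem renT_renT (ξ ζ : ℕ → ℕ) (S : TS K) : renT ξ (renT ζ S) = renT (ξ ∘ ζ) S :=
  lin_ext (F := (renT ξ).comp (renT ζ)) (G := renT (ξ ∘ ζ)) (by simp [ren_ren]) S

/-- Lift a substitution under a binder. -/
noncomputable def up (ρ : ℕ → TS K) : ℕ → TS K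
  | 0 => Finsupp.single (qVar 0) 1
  | n + 1 => renT Nat.succ (ρ n)

/-- Parallel substitution of sums for variables. -/
noncomputable def sub (ρ : ℕ → TS K) (s : ResTerm) : TS K :=
  ResAlg.fold (A := (ℕ → TS K) → TS K) ⟨fun n ρ => ρ n, fun _ r ρ => LAM (r (up ρ)),
    fun _ r ρ => INL (r ρ), fun _ r ρ => INR (r ρ),
    fun _ r t ρ => APP (r ρ) (bagP (t.map fun p => p.2 ρ))⟩ s ρ

/-- Parallel substitution in a monomial. -/
noncomputable def subM (ρ : ℕ → TS K) (t : Multiset ResTerm) : BS K := bagP (t.map (sub ρ))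

@[simp] theorem sub_var (ρ : ℕ → TS K) (n : ℕ) : sub ρ (qVar n) = ρ n :=
  congrFun (ResAlg.fold_var _ n) ρ
@[simp] theorem sub_lam (ρ : ℕ → TS K) (s : ResTerm) : sub ρ (qLam s) = LAM (sub (up ρ) s) :=
  congrFun (ResAlg.fold_lam _ s) ρ
@[simp] theorem sub_inl (ρ : ℕ → TS K) (s : ResTerm) : sub ρ (qInl s) = INL (sub ρ s) :=
  congrFun (ResAlg.fold_inl _ s) ρ
@[simp] theorem sub_inr (ρ : ℕ → TS K) (s : ResTerm) : sub ρ (qInr s) = INR (sub ρ s) :=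
  congrFun (ResAlg.fold_inr _ s) ρ
@[simp] theorem sub_app (ρ : ℕ → TS K) (s : ResTerm) (t : Multiset ResTerm) :
    sub ρ (qApp s t) = APP (sub ρ s) (subM ρ t) := by
  rw [sub, ResAlg.fold_app]
  simp only [Multiset.map_map, Function.comp_def]
  rfl
@[simp] theorem subM_zero (ρ : ℕ → TS K) : subM ρ 0 = Finsupp.single 0 1 := by simp [subM]
@[simp] theorem subM_cons (ρ : ℕ → TS K) (u : ResTerm) (t : Multiset ResTerm) :
    subM ρ (u ::ₘ t) = CONS (sub ρ u) (subM ρ t) := by simp [subM]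

theorem sub_lamP (ρ : ℕ → TS K) (s : ResTerm) : sub ρ (lamP s) = LAM (sub (up ρ) s) := by
  induction s using ResTerm.pushInd <;> simp_all [LAM_INL, LAM_INR]

theorem sub_appP (ρ : ℕ → TS K) (s : ResTerm) (t : Multiset ResTerm) :
    sub ρ (appP s t) = APP (sub ρ s) (subM ρ t) := by
  induction s using ResTerm.pushInd <;> simp_all [APP_INL, APP_INR]

/-- Linear extension of substitution. -/
noncomputable def subT (ρ : ℕ → TS K) : TS K →ₗ[K] TS K := Finsupp.linearCombination K (sub ρ)
/-- Linear extension of substitution to sums of monomials. -/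
noncomputable def subB (ρ : ℕ → TS K) : BS K →ₗ[K] BS K := Finsupp.linearCombination K (subM ρ)

@[simp] theorem subT_single (ρ : ℕ → TS K) (s : ResTerm) (a : K) :
    subT ρ (Finsupp.single s a) = a • sub ρ s := by simp [subT]
@[simp] theorem subB_single (ρ : ℕ → TS K) (t : Multiset ResTerm) (a : K) :
    subB ρ (Finsupp.single t a) = a • subM ρ t := by simp [subB]

theorem subT_LAM (ρ : ℕ → TS K) (S : TS K) : subT ρ (LAM S) = LAM (subT (up ρ) S) :=
  lin_ext (F := (subT ρ).comp LAM) (G := LAM.comp (subT (up ρ))) (by simp [sub_lamP]) S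
theorem subT_INL (ρ : ℕ → TS K) (S : TS K) : subT ρ (INL S) = INL (subT ρ S) :=
  lin_ext (F := (subT ρ).comp INL) (G := INL.comp (subT ρ)) (by simp) S
theorem subT_INR (ρ : ℕ → TS K) (S : TS K) : subT ρ (INR S) = INR (subT ρ S) :=
  lin_ext (F := (subT ρ).comp INR) (G := INR.comp (subT ρ)) (by simp) S
theorem subT_APP (ρ : ℕ → TS K) (S : TS K) (T : BS K) :
    subT ρ (APP S T) = APP (subT ρ S) (subB ρ T) :=
  bil_ext (F := APP.compr₂ (subT ρ)) (G := APP.compl₁₂ (subT ρ) (subB ρ))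
    (by simp [sub_appP]) S T
theorem subB_CONS (ρ : ℕ → TS K) (S : TS K) (T : BS K) :
    subB ρ (CONS S T) = CONS (subT ρ S) (subB ρ T) :=
  bil_ext (F := CONS.compr₂ (subB ρ)) (G := CONS.compl₁₂ (subT ρ) (subB ρ)) (by simp) S T

theorem up_comp_upr (ρ : ℕ → TS K) (ξ : ℕ → ℕ) : up ρ ∘ upr ξ = up (ρ ∘ ξ) := by
  funext n; cases n <;> rfl

theorem subM_congr {ρ τ : ℕ → TS K} {t t' : Multiset ResTerm} {f : ResTerm → ResTerm}
    (h : ∀ u ∈ t, sub ρ (f u) = sub τ u) (ht : t' = t.map f) : subM ρ t' = subM τ t := by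
  rw [subM, subM, ht, Multiset.map_map]
  exact congrArg _ (Multiset.map_congr rfl h)

theorem sub_ren (ρ : ℕ → TS K) (ξ : ℕ → ℕ) (s : ResTerm) :
    sub ρ (ren ξ s) = sub (ρ ∘ ξ) s := by
  induction s using ResTerm.ind generalizing ξ ρ with
  | var n => simp
  | lam s ih => rw [ren_lam, sub_lamP, ih, sub_lam, up_comp_upr]
  | inl s ih => simp [ih]
  | inr s ih => simp [ih]
  | app s t hs ht =>
    rw [ren_app, sub_appP, hs, sub_app, subM_congr (fun u hu => ht u hu ρ ξ) rfl]

theorem subT_renT (ρ : ℕ → TS K) (ξ : ℕ → ℕ) (S : TS K) :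
    subT ρ (renT ξ S) = subT (ρ ∘ ξ) S :=
  lin_ext (F := (subT ρ).comp (renT ξ)) (G := subT (ρ ∘ ξ)) (by simp [sub_ren]) S

theorem renT_up (ρ : ℕ → TS K) (ξ : ℕ → ℕ) :
    (fun n => renT (upr ξ) (up ρ n)) = up (fun n => renT ξ (ρ n)) := by
  funext n
  cases n with
  | zero => simp [up, upr]
  | succ n => simp only [up, renT_renT]; rfl

theorem renT_sub (ρ : ℕ → TS K) (ξ : ℕ → ℕ) (s : ResTerm) :
    renT ξ (sub ρ s) = sub (fun n => renT ξ (ρ n)) s := by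
  induction s using ResTerm.ind generalizing ξ ρ with
  | var n => simp
  | lam s ih => rw [sub_lam, renT_LAM, ih, sub_lam, renT_up]
  | inl s ih => simp [renT_INL, ih]
  | inr s ih => simp [renT_INR, ih]
  | app s t hs ht =>
    rw [sub_app, renT_APP, hs, sub_app]
    congr 1
    clear hs
    induction t using Multiset.induction with
    | empty => simp
    | cons u t ih =>
      rw [subM_cons, renB_CONS, ht u (by simp), ih fun v hv => ht v (by simp [hv]), subM_cons]

theorem renT_subT (ρ : ℕ → TS K) (ξ : ℕ → ℕ) (S : TS K) :
    renT ξ (subT ρ S) = subT (fun n => renT ξ (ρ n)) S :=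
  lin_ext (F := (renT ξ).comp (subT ρ)) (G := subT fun n => renT ξ (ρ n))
    (by simp [renT_sub]) S

theorem subT_up (ρ τ : ℕ → TS K) :
    (fun n => subT (up ρ) (up τ n)) = up (fun n => subT ρ (τ n)) := by
  funext n
  cases n with
  | zero => simp [up]
  | succ n => simp only [up]; rw [subT_renT, renT_subT]; rfl

theorem subT_sub (ρ τ : ℕ → TS K) (s : ResTerm) :
    subT ρ (sub τ s) = sub (fun n => subT ρ (τ n)) s := by
  induction s using ResTerm.ind generalizing ρ τ with
  | var n => simp
  | lam s ih => rw [sub_lam, subT_LAM, ih, sub_lam, subT_up]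
  | inl s ih => simp [subT_INL, ih]
  | inr s ih => simp [subT_INR, ih]
  | app s t hs ht =>
    rw [sub_app, subT_APP, hs, sub_app]
    congr 1
    clear hs
    induction t using Multiset.induction with
    | empty => simp
    | cons u t ih =>
      rw [subM_cons, subB_CONS, ht u (by simp), ih fun v hv => ht v (by simp [hv]), subM_cons]

theorem subT_subT (ρ τ : ℕ → TS K) (S : TS K) :
    subT ρ (subT τ S) = subT (fun n => subT ρ (τ n)) S :=
  lin_ext (F := (subT ρ).comp (subT τ)) (G := subT fun n => subT ρ (τ n))
    (by simp [subT_sub]) S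

theorem up_var (ξ : ℕ → ℕ) :
    up (fun n => (Finsupp.single (qVar (ξ n)) 1 : TS K)) =
      fun n => Finsupp.single (qVar (upr ξ n)) 1 := by
  funext n; cases n <;> simp [up, upr]

theorem sub_single_var (ξ : ℕ → ℕ) (s : ResTerm) :
    sub (fun n => (Finsupp.single (qVar (ξ n)) 1 : TS K)) s = Finsupp.single (ren ξ s) 1 := by
  induction s using ResTerm.ind generalizing ξ with
  | var n => simp
  | lam s ih => rw [sub_lam, up_var, ih]; simp
  | inl s ih => simp [ih]
  | inr s ih => simp [ih]
  | app s t hs ht =>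
    rw [sub_app, hs, ren_app, subM, Multiset.map_congr rfl fun u hu => ht u hu ξ, bagP_single]
    simp

theorem bc_up (φ : K →+* K') (ρ : ℕ → TS K) :
    (fun n => bc (φ : K →+ K') (up ρ n)) = up fun n => bc (φ : K →+ K') (ρ n) := by
  funext n
  cases n with
  | zero => simp [up]
  | succ n => simp [up, bc_renT]

theorem bc_sub (φ : K →+* K') (ρ : ℕ → TS K) (s : ResTerm) :
    bc (φ : K →+ K') (sub ρ s) = sub (fun n => bc (φ : K →+ K') (ρ n)) s := by
  induction s using ResTerm.ind generalizing ρ with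
  | var n => simp
  | lam s ih => rw [sub_lam, bc_LAM, ih, sub_lam, bc_up]
  | inl s ih => simp [bc_INL, ih]
  | inr s ih => simp [bc_INR, ih]
  | app s t hs ht =>
    rw [sub_app, bc_APP, hs, sub_app]
    congr 1
    clear hs
    induction t using Multiset.induction with
    | empty => simp
    | cons u t ih =>
      rw [subM_cons, bc_CONS, ht u (by simp), ih fun v hv => ht v (by simp [hv]), subM_cons]

theorem bc_subT (φ : K →+* K') (ρ : ℕ → TS K) (S : TS K) :
    bc (φ : K →+ K') (subT ρ S) =
      subT (fun n => bc (φ : K →+ K') (ρ n)) (bc (φ : K →+ K') S) := by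
  induction S using Finsupp.induction_linear with
  | zero => simp
  | add f g hf hg => simp only [map_add, hf, hg]
  | single s a => rw [subT_single, bc_smul, bc_sub, bc_single, subT_single]; rfl

end Subst

/-! ### Dual numbers and derivatives -/

section Dual

variable {K K' : Type} [CommSemiring K] [CommSemiring K']

/-- First component of a dual number. -/
def dfst (K : Type) [CommSemiring K] : DualNumber K →+* K :=
  (TrivSqZeroExt.fstHom K K K : DualNumber K →+* K)
/-- Second component of a dual number. -/
def dsnd (K : Type) [CommSemiring K] : DualNumber K →+ K :=
  (TrivSqZeroExt.sndHom K K).toAddMonoidHom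
/-- Inclusion of scalars in dual numbers. -/
def dinl (K : Type) [CommSemiring K] : K →+* DualNumber K := TrivSqZeroExt.inlHom K K
/-- Inclusion of infinitesimals in dual numbers. -/
def dinr (K : Type) [CommSemiring K] : K →+ DualNumber K :=
  (TrivSqZeroExt.inrHom K K).toAddMonoidHom

@[simp] theorem dfst_apply (x : DualNumber K) : dfst K x = x.fst := rfl
@[simp] theorem dsnd_apply (x : DualNumber K) : dsnd K x = x.snd := rfl
@[simp] theorem dinl_apply (x : K) : dinl K x = TrivSqZeroExt.inl x := rfl
@[simp] theorem dinr_apply (x : K) : dinr K x = TrivSqZeroExt.inr x := rfl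

section Parts
variable {Z : Type}

/-- Standard part of a sum over dual numbers. -/
noncomputable def pF (S : Z →₀ DualNumber K) : Z →₀ K := bc (dfst K : DualNumber K →+ K) S
/-- Infinitesimal part of a sum over dual numbers. -/
noncomputable def pS (S : Z →₀ DualNumber K) : Z →₀ K := bc (dsnd K) S
/-- A sum regarded as a sum over dual numbers. -/
noncomputable def iL (S : Z →₀ K) : Z →₀ DualNumber K := bc (dinl K : K →+ DualNumber K) S
/-- The sum over dual numbers with given standard and infinitesimal parts. -/
noncomputable def mkD (S H : Z →₀ K) : Z →₀ DualNumber K := iL S + bc (dinr K) H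

theorem pF_apply (S : Z →₀ DualNumber K) (z : Z) : pF S z = (S z).fst := rfl
theorem pS_apply (S : Z →₀ DualNumber K) (z : Z) : pS S z = (S z).snd := rfl
theorem iL_apply (S : Z →₀ K) (z : Z) : iL S z = TrivSqZeroExt.inl (S z) := rfl
theorem mkD_apply (S H : Z →₀ K) (z : Z) :
    mkD S H z = TrivSqZeroExt.inl (S z) + TrivSqZeroExt.inr (H z) := rfl

@[simp] theorem pF_add (S T : Z →₀ DualNumber K) : pF (S + T) = pF S + pF T := map_add _ _ _
@[simp] theorem pS_add (S T : Z →₀ DualNumber K) : pS (S + T) = pS S + pS T := map_add _ _ _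
@[simp] theorem iL_add (S T : Z →₀ K) : iL (S + T) = iL S + iL T := map_add _ _ _
@[simp] theorem pF_zero : pF (0 : Z →₀ DualNumber K) = 0 := map_zero _
@[simp] theorem pS_zero : pS (0 : Z →₀ DualNumber K) = 0 := map_zero _
@[simp] theorem iL_zero : iL (0 : Z →₀ K) = 0 := map_zero _
@[simp] theorem pF_iL (S : Z →₀ K) : pF (iL S) = S := by ext; simp [pF_apply, iL_apply]
@[simp] theorem pS_iL (S : Z →₀ K) : pS (iL S) = 0 := by ext; simp [pS_apply, iL_apply]
@[simp] theorem pF_mkD (S H : Z →₀ K) : pF (mkD S H) = S := by ext; simp [pF_apply, mkD_apply]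
@[simp] theorem pS_mkD (S H : Z →₀ K) : pS (mkD S H) = H := by ext; simp [pS_apply, mkD_apply]
@[simp] theorem mkD_zero (S : Z →₀ K) : mkD S 0 = iL S := by simp [mkD]

theorem pS_smul (a : DualNumber K) (S : Z →₀ DualNumber K) :
    pS (a • S) = a.fst • pS S + a.snd • pF S := by
  ext; simp [pS_apply, pF_apply]

theorem pF_smul (a : DualNumber K) (S : Z →₀ DualNumber K) : pF (a • S) = a.fst • pF S := by
  ext; simp [pF_apply]

theorem ext_dual {S T : Z →₀ DualNumber K} (h : pF S = pF T) (h' : pS S = pS T) : S = T := by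
  ext z
  · exact DFunLike.congr_fun h z
  · exact DFunLike.congr_fun h' z

@[simp] theorem pF_castF (F : Z →₀ ℕ) : pF (castF (DualNumber K) F) = castF K F :=
  bc_castF (dfst K) F

@[simp] theorem pS_castF (F : Z →₀ ℕ) : pS (castF (DualNumber K) F) = 0 := by
  ext; simp [pS_apply]

end Parts

theorem pS_bil {X Y Z : Type} (g : X → Y → Z →₀ ℕ) (S : X →₀ DualNumber K)
    (T : Y →₀ DualNumber K) :
    pS (bil g S T) = bil g (pF S) (pS T) + bil g (pS S) (pF T) := by
  induction S using Finsupp.induction_linear with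
  | zero => simp
  | add f g hf hg =>
    simp only [map_add, LinearMap.add_apply, hf, hg, pS_add, pF_add]
    exact add_add_add_comm _ _ _ _
  | single x a =>
    induction T using Finsupp.induction_linear with
    | zero => simp
    | add f g hf hg =>
      simp only [map_add, hf, hg, pS_add, pF_add]
      exact add_add_add_comm _ _ _ _
    | single y b =>
      simp only [pS, pF, bc_single, bil_single]
      rw [← pS, pS_smul]
      simp [add_smul, mul_comm]

theorem pS_APP (S : TS (DualNumber K)) (T : BS (DualNumber K)) :
    pS (APP S T) = APP (pF S) (pS T) + APP (pS S) (pF T) := pS_bil _ _ _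
theorem pS_CONS (S : TS (DualNumber K)) (T : BS (DualNumber K)) :
    pS (CONS S T) = CONS (pF S) (pS T) + CONS (pS S) (pF T) := pS_bil _ _ _
theorem pS_LAM (S : TS (DualNumber K)) : pS (LAM S) = LAM (pS S) := bc_lin _ _ _
theorem pS_INL (S : TS (DualNumber K)) : pS (INL S) = INL (pS S) := bc_lin _ _ _
theorem pS_INR (S : TS (DualNumber K)) : pS (INR S) = INR (pS S) := bc_lin _ _ _

theorem pF_sub (ρ : ℕ → TS (DualNumber K)) (s : ResTerm) :
    pF (sub ρ s) = sub (fun n => pF (ρ n)) s := bc_sub _ _ _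
theorem pF_subM (ρ : ℕ → TS (DualNumber K)) (t : Multiset ResTerm) :
    pF (subM ρ t) = subM (fun n => pF (ρ n)) t := by
  induction t using Multiset.induction with
  | empty => simp [pF]
  | cons u t ih =>
    rw [subM_cons, subM_cons, ← ih, ← pF_sub]
    exact bc_CONS _ _ _

/-- Lift a family of infinitesimal parts under a binder. -/
noncomputable def upz (η : ℕ → TS K) : ℕ → TS K
  | 0 => 0
  | n + 1 => renT Nat.succ (η n)

theorem mkD_single_zero (s : ResTerm) :
    mkD (Finsupp.single s (1 : K)) 0 = Finsupp.single s 1 := by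
  rw [mkD_zero, iL, bc_single]; simp

theorem renT_mkD (ξ : ℕ → ℕ) (S H : TS K) : renT ξ (mkD S H) = mkD (renT ξ S) (renT ξ H) := by
  rw [mkD, map_add, ← bc_renT, iL, ← bc_renT]
  rfl

theorem up_mkD (ρ η : ℕ → TS K) :
    up (fun n => mkD (ρ n) (η n)) = fun n => mkD (up ρ n) (upz η n) := by
  funext n
  cases n with
  | zero => exact (mkD_single_zero _).symm
  | succ n => exact renT_mkD _ _ _

/-- Directional derivative of a substitution. -/
noncomputable def dd (ρ η : ℕ → TS K) (s : ResTerm) : TS K :=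
  pS (sub (fun n => mkD (ρ n) (η n)) s)

/-- Directional derivative of a substitution in a monomial. -/
noncomputable def ddM (ρ η : ℕ → TS K) (t : Multiset ResTerm) : BS K :=
  pS (subM (fun n => mkD (ρ n) (η n)) t)

theorem dd_var (ρ η : ℕ → TS K) (n : ℕ) : dd ρ η (qVar n) = η n := by simp [dd]
theorem dd_lam (ρ η : ℕ → TS K) (s : ResTerm) :
    dd ρ η (qLam s) = LAM (dd (up ρ) (upz η) s) := by
  rw [dd, sub_lam, pS_LAM, up_mkD]; rfl
theorem dd_inl (ρ η : ℕ → TS K) (s : ResTerm) : dd ρ η (qInl s) = INL (dd ρ η s) := by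
  rw [dd, sub_inl, pS_INL]; rfl
theorem dd_inr (ρ η : ℕ → TS K) (s : ResTerm) : dd ρ η (qInr s) = INR (dd ρ η s) := by
  rw [dd, sub_inr, pS_INR]; rfl
theorem dd_app (ρ η : ℕ → TS K) (s : ResTerm) (t : Multiset ResTerm) :
    dd ρ η (qApp s t) = APP (sub ρ s) (ddM ρ η t) + APP (dd ρ η s) (subM ρ t) := by
  rw [dd, sub_app, pS_APP, pF_sub, pF_subM]
  simp only [pF_mkD]; rfl
theorem ddM_zero (ρ η : ℕ → TS K) : ddM ρ η 0 = 0 := by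
  rw [ddM, subM_zero, pS, bc_single]; simp
theorem ddM_cons (ρ η : ℕ → TS K) (u : ResTerm) (t : Multiset ResTerm) :
    ddM ρ η (u ::ₘ t) = CONS (sub ρ u) (ddM ρ η t) + CONS (dd ρ η u) (subM ρ t) := by
  rw [ddM, subM_cons, pS_CONS, pF_sub, pF_subM]
  simp only [pF_mkD]; rfl

theorem dd_add (ρ η η' : ℕ → TS K) (s : ResTerm) :
    dd ρ (fun n => η n + η' n) s = dd ρ η s + dd ρ η' s := by
  induction s using ResTerm.ind generalizing ρ η η' with
  | var n => simp [dd_var]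
  | lam s ih =>
    rw [dd_lam, dd_lam, dd_lam, ← map_add, ← ih]
    congr 2
    funext n; cases n <;> simp [upz]
  | inl s ih => simp [dd_inl, ih]
  | inr s ih => simp [dd_inr, ih]
  | app s t hs ht =>
    have key : ddM ρ (fun n => η n + η' n) t = ddM ρ η t + ddM ρ η' t := by
      clear hs
      induction t using Multiset.induction with
      | empty => simp [ddM_zero]
      | cons u t ih =>
        simp only [ddM_cons]
        rw [ht u (by simp), ih fun v hv => ht v (by simp [hv])]
        simp only [map_add, LinearMap.add_apply]
        exact add_add_add_comm _ _ _ _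
    rw [dd_app, dd_app, dd_app, hs, key]
    simp only [map_add, LinearMap.add_apply]
    exact add_add_add_comm _ _ _ _

theorem dd_smul (c : K) (ρ η : ℕ → TS K) (s : ResTerm) :
    dd ρ (fun n => c • η n) s = c • dd ρ η s := by
  induction s using ResTerm.ind generalizing ρ η with
  | var n => simp [dd_var]
  | lam s ih =>
    rw [dd_lam, dd_lam, ← map_smul, ← ih]
    congr 2
    funext n; cases n <;> simp [upz]
  | inl s ih => simp [dd_inl, ih]
  | inr s ih => simp [dd_inr, ih]
  | app s t hs ht =>
    have key : ddM ρ (fun n => c • η n) t = c • ddM ρ η t := by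
      clear hs
      induction t using Multiset.induction with
      | empty => simp [ddM_zero]
      | cons u t ih =>
        simp only [ddM_cons]
        rw [ht u (by simp), ih fun v hv => ht v (by simp [hv])]
        simp
    rw [dd_app, dd_app, hs, key]
    simp

theorem dd_zero (ρ : ℕ → TS K) (s : ResTerm) : dd ρ (fun _ => 0) s = 0 := by
  have := dd_smul 0 ρ (fun _ => 0) s
  simpa using this

/-- The substitution replacing one occurrence of the variable `0` by `U`, infinitesimally. -/
noncomputable def shiftD (U : TS K) : ℕ → TS (DualNumber K)
  | 0 => mkD (Finsupp.single (qVar 0) 1) (renT Nat.succ U)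
  | n + 1 => Finsupp.single (qVar (n + 1)) 1

/-- The identity substitution. -/
noncomputable def idS (K : Type) [CommSemiring K] (n : ℕ) : TS K := Finsupp.single (qVar n) 1

/-- The family equal to `U`, shifted, at `0` and to zero elsewhere. -/
noncomputable def at0 (U : TS K) : ℕ → TS K
  | 0 => renT Nat.succ U
  | _ + 1 => 0

theorem shiftD_eq (U : TS K) : shiftD U = fun n => mkD (idS K n) (at0 U n) := by
  funext n
  cases n with
  | zero => rfl
  | succ n => exact (mkD_single_zero _).symm

/-- The derivative of `s` at the variable `0` in the direction `u`, on basis elements. -/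
noncomputable def derN (u s : ResTerm) : TS ℕ := dd (idS ℕ) (at0 (Finsupp.single u 1)) s

/-- The derivative at the variable `0`. -/
noncomputable def der : TS K →ₗ[K] TS K →ₗ[K] TS K := bil derN

theorem map_dual_bc (φ : K →+* K') :
    ∃ ψ : DualNumber K →+* DualNumber K', (∀ x, (ψ x).fst = φ x.fst) ∧
      ∀ x, (ψ x).snd = φ x.snd :=
  ⟨{ toFun := fun x => (TrivSqZeroExt.inl (φ x.fst) + TrivSqZeroExt.inr (φ x.snd) :)
     map_one' := by ext <;> simp
     map_zero' := by ext <;> simp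
     map_mul' := fun x y => by ext <;> simp
     map_add' := fun x y => by ext <;> simp }, fun x => by simp, fun x => by simp⟩

theorem bc_dd (φ : K →+* K') (ρ η : ℕ → TS K) (s : ResTerm) :
    bc (φ : K →+ K') (dd ρ η s) =
      dd (fun n => bc (φ : K →+ K') (ρ n)) (fun n => bc (φ : K →+ K') (η n)) s := by
  obtain ⟨ψ, h₁, h₂⟩ := map_dual_bc φ
  have : bc (φ : K →+ K') (dd ρ η s) =
      pS (bc (ψ : DualNumber K →+ DualNumber K') (sub (fun n => mkD (ρ n) (η n)) s)) := by
    ext z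
    exact (h₂ _).symm
  rw [this, bc_sub, dd]
  congr 2
  funext n
  apply ext_dual
  · ext z; simp [pF_apply, mkD_apply, h₁]
  · ext z; simp [pS_apply, mkD_apply, h₂]

theorem castF_eq_bc {Z : Type} (F : Z →₀ ℕ) :
    castF K F = bc (Nat.castRingHom K : ℕ →+ K) F := rfl

theorem castF_derN (u s : ResTerm) :
    castF K (derN u s) = dd (idS K) (at0 (Finsupp.single u 1)) s := by
  rw [castF_eq_bc, derN, bc_dd]
  congr 1
  · funext n; simp [idS]
  · funext n; cases n <;> simp [at0]

theorem dd_at0 (u s : ResTerm) (a : K) :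
    dd (idS K) (at0 (Finsupp.single u a)) s = a • castF K (derN u s) := by
  rw [castF_derN, ← dd_smul]
  congr 1
  funext n; cases n <;> simp [at0]

theorem at0_add (U V : TS K) : at0 (U + V) = fun n => at0 U n + at0 V n := by
  funext n; cases n <;> simp [at0]

theorem der_single (U : TS K) (s : ResTerm) :
    der U (Finsupp.single s 1) = dd (idS K) (at0 U) s := by
  induction U using Finsupp.induction_linear with
  | zero =>
    have : (at0 0 : ℕ → TS K) = fun _ => 0 := by funext n; cases n <;> simp [at0]
    rw [this, dd_zero]; simp
  | add f g hf hg => rw [map_add, LinearMap.add_apply, hf, hg, at0_add, dd_add]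
  | single u a => rw [dd_at0, der, bil_single, mul_one]

theorem der_eq (U S : TS K) : der U S = pS (subT (shiftD U) (iL S)) := by
  induction S using Finsupp.induction_linear with
  | zero => simp
  | add f g hf hg => simp only [map_add, hf, hg, iL_add, pS_add]
  | single s a =>
    have : (Finsupp.single s a : TS K) = a • Finsupp.single s 1 := by simp
    rw [this, map_smul, der_single, ← this, iL, bc_single, subT_single, pS_smul, shiftD_eq]
    simp [dd]

theorem pS_subT_iL (ρ : ℕ → TS K) (S : TS (DualNumber K)) :
    pS (subT (fun n => iL (ρ n)) S) = subT ρ (pS S) := by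
  induction S using Finsupp.induction_linear with
  | zero => simp
  | add f g hf hg => simp only [map_add, hf, hg, pS_add]
  | single s a =>
    have h : sub (fun n => iL (ρ n)) s = iL (sub ρ s) := (bc_sub (dinl K) ρ s).symm
    rw [subT_single, pS_smul, h, pS_iL, pF_iL, pS, bc_single]
    simp

theorem subT_iL (ρ : ℕ → TS K) (S : TS K) :
    subT (fun n => iL (ρ n)) (iL S) = iL (subT ρ S) := (bc_subT (dinl K) ρ S).symm

theorem pF_subT_iL (ρ : ℕ → TS K) (S : TS (DualNumber K)) :
    pF (subT (fun n => iL (ρ n)) S) = subT ρ (pF S) := by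
  have := bc_subT (dfst K) (fun n => iL (ρ n)) S
  rw [pF, this]
  congr 2
  funext n
  exact pF_iL _

theorem subT_iL_mkD (ρ : ℕ → TS K) (S H : TS K) :
    subT (fun n => iL (ρ n)) (mkD S H) = mkD (subT ρ S) (subT ρ H) :=
  ext_dual (by simp [pF_subT_iL]) (by simp [pS_subT_iL])

theorem subT_var (ξ : ℕ → ℕ) (S : TS K) :
    subT (fun n => Finsupp.single (qVar (ξ n)) 1) S = renT ξ S :=
  lin_ext (F := subT _) (G := renT ξ) (by simp [sub_single_var]) S

theorem der_subT (ρ : ℕ → TS K) (U S : TS K) :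
    der (subT ρ U) (subT (up ρ) S) = subT (up ρ) (der U S) := by
  rw [der_eq, der_eq, ← pS_subT_iL, ← subT_iL, subT_subT, subT_subT]
  congr 3
  funext n
  cases n with
  | zero =>
    simp only [shiftD]
    have h : subT (up ρ) (renT Nat.succ U) = renT Nat.succ (subT ρ U) := by
      rw [subT_renT, renT_subT]; rfl
    rw [subT_iL_mkD, up, iL, bc_single, h]
    simp [shiftD, up]
  | succ n =>
    simp only [shiftD, up]
    rw [iL, bc_renT, subT_renT]
    have : shiftD (subT ρ U) ∘ Nat.succ = fun n => Finsupp.single (qVar (n.succ)) 1 := rfl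
    rw [this, subT_var, subT_single, sub_var, one_smul]
    simp only [iL, bc_renT]

theorem der_INL (U S : TS K) : der U (INL S) = INL (der U S) := by
  rw [der_eq, der_eq, ← pS_INL, ← subT_INL, iL, bc_INL]; rfl
theorem der_INR (U S : TS K) : der U (INR S) = INR (der U S) := by
  rw [der_eq, der_eq, ← pS_INR, ← subT_INR, iL, bc_INR]; rfl

/-! ### Symmetric multilinear substitution -/

/-- The substitution erasing the variable `0` and lowering the others, with value `U` at `0`. -/
noncomputable def at0' (U : TS K) : ℕ → TS K
  | 0 => U
  | n + 1 => Finsupp.single (qVar n) 1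

/-- Substitute zero for the variable `0`. -/
noncomputable def kill : TS K →ₗ[K] TS K := subT (at0' 0)

theorem bc_at0' (φ : K →+* K') (U : TS K) :
    (fun n => bc (φ : K →+ K') (at0' U n)) = at0' (bc (φ : K →+ K') U) := by
  funext n; cases n <;> simp [at0']

theorem bc_kill (φ : K →+* K') (S : TS K) :
    bc (φ : K →+ K') (kill S) = kill (bc (φ : K →+ K') S) := by
  rw [kill, bc_subT, bc_at0', map_zero, kill]

theorem kill_INL (S : TS K) : kill (INL S) = INL (kill S) := subT_INL _ _
theorem kill_INR (S : TS K) : kill (INR S) = INR (kill S) := subT_INR _ _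

theorem subT_kill {ρ : ℕ → TS K} (hρ : ∀ n, renT id (ρ n) = ρ n) (S : TS K) :
    subT ρ (kill S) = kill (subT (up ρ) S) := by
  rw [kill, subT_subT, subT_subT]
  congr 2
  funext n
  cases n with
  | zero => simp [at0', up]
  | succ n =>
    simp only [at0', up, subT_renT, subT_single, sub_var, one_smul]
    have : (at0' 0 : ℕ → TS K) ∘ Nat.succ = fun n => Finsupp.single (qVar (id n)) 1 := rfl
    rw [this, subT_var, hρ]

end Dual

section Partial

theorem castF_smul {Z K : Type} [CommSemiring K] (n : ℕ) (F : Z →₀ ℕ) :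
    castF K (n • F) = (n : K) • castF K F := by
  ext; simp

open MvPolynomial (pderiv)

variable {ι : Type}

/-- The product of the factorials of the multiplicities of the elements of a multiset. -/
noncomputable def facP (m : Multiset ι) : ℕ :=
  letI := Classical.decEq ι
  m.toFinset.prod fun x => Nat.factorial (m.count x)

theorem facP_cons [DecidableEq ι] (i : ι) (m : Multiset ι) :
    facP (i ::ₘ m) = (m.count i + 1) * facP m := by
  have e : Classical.decEq ι = ‹DecidableEq ι› := Subsingleton.elim _ _
  unfold facP
  rw [e]
  have h₁ : ∀ m' : Multiset ι, m' ≤ i ::ₘ m → m'.toFinset.prod (fun x => (m'.count x).factorial) =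
      (insert i m.toFinset).prod fun x => (m'.count x).factorial := by
    intro m' hm'
    refine Finset.prod_subset ?_ ?_
    · rw [← Multiset.toFinset_cons]
      exact Multiset.toFinset_subset.mpr (Multiset.subset_of_le hm')
    · intro x _ hx
      rw [Multiset.count_eq_zero.mpr (by simpa using hx)]; rfl
  rw [h₁ _ le_rfl, h₁ m (Multiset.le_cons_self _ _),
    ← Finset.mul_prod_erase _ _ (Finset.mem_insert_self i _),
    ← Finset.mul_prod_erase (insert i m.toFinset) (fun x => (m.count x).factorial)
      (Finset.mem_insert_self i _), Multiset.count_cons_self, Nat.factorial_succ, mul_assoc]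
  congr 2
  refine Finset.prod_congr rfl fun x hx => ?_
  rw [Multiset.count_cons_of_ne (Finset.ne_of_mem_erase hx)]

@[simp] theorem facP_zero : facP (0 : Multiset ι) = 1 := by simp [facP]

/-- Iterated derivative of a polynomial at the origin. -/
noncomputable def prL : List ι → MvPolynomial ι ℕ →+ ℕ
  | [] => (MvPolynomial.constantCoeff : MvPolynomial ι ℕ →+* ℕ)
  | i :: l => (prL l).comp (pderiv i : Derivation ℕ (MvPolynomial ι ℕ) _).toLinearMap.toAddMonoidHom

theorem prL_cons (i : ι) (l : List ι) (p : MvPolynomial ι ℕ) :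
    prL (i :: l) p = prL l (pderiv i p) := rfl

theorem prL_eq [DecidableEq ι] (l : List ι) (p : MvPolynomial ι ℕ) :
    prL l p = facP (l : Multiset ι) * p.coeff (Multiset.toFinsupp (l : Multiset ι)) := by
  induction l generalizing p with
  | nil => simp [prL, MvPolynomial.constantCoeff_eq]
  | cons i l ih =>
    rw [prL_cons, ih, ← Multiset.cons_coe, facP_cons, MvPolynomial.coeff_pderiv,
      ← Multiset.singleton_add, map_add, Multiset.toFinsupp_singleton, add_comm]
    simp only [Multiset.toFinsupp_apply]
    push_cast
    ring

/-- The ring homomorphism adding an infinitesimal derivative. -/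
noncomputable def taylor (i : ι) : MvPolynomial ι ℕ →+* DualNumber (MvPolynomial ι ℕ) where
  toFun p := (TrivSqZeroExt.inl p + TrivSqZeroExt.inr (pderiv i p) :)
  map_one' := by ext <;> simp
  map_zero' := by ext <;> simp
  map_mul' p q := TrivSqZeroExt.ext (by simp) (by simp [mul_comm])
  map_add' p q := by ext <;> simp

theorem taylor_fst (i : ι) (p : MvPolynomial ι ℕ) : (taylor i p).fst = p := by simp [taylor]
theorem taylor_snd (i : ι) (p : MvPolynomial ι ℕ) : (taylor i p).snd = pderiv i p := by
  simp [taylor]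

/-- The generic sum of the terms `b i`, for `i` in `U`. -/
noncomputable def gen (U : Finset ι) (b : ι → ResTerm) : TS (MvPolynomial ι ℕ) :=
  ∑ i ∈ U, Finsupp.single (ren id (b i)) (MvPolynomial.X i)

theorem bc_pderiv_gen (U : Finset ι) (b : ι → ResTerm) {i : ι} (hi : i ∈ U) :
    bc (pderiv i : Derivation ℕ (MvPolynomial ι ℕ) _).toLinearMap.toAddMonoidHom (gen U b) =
      Finsupp.single (ren id (b i)) 1 := by
  classical
  rw [gen, map_sum, Finset.sum_eq_single i]
  · simp
  · intro j _ hj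
    simp [MvPolynomial.pderiv_X_of_ne hj]
  · exact fun h => absurd hi h

theorem chain_rule (U : Finset ι) (b : ι → ResTerm) {i : ι} (hi : i ∈ U) (s : ResTerm) :
    bc (pderiv i : Derivation ℕ (MvPolynomial ι ℕ) _).toLinearMap.toAddMonoidHom
        (sub (at0' (gen U b)) s) =
      subT (at0' (gen U b)) (castF _ (derN (b i) s)) := by
  have h₁ : bc (pderiv i : Derivation ℕ (MvPolynomial ι ℕ) _).toLinearMap.toAddMonoidHom
        (sub (at0' (gen U b)) s) = pS (bc (taylor i : _ →+ _) (sub (at0' (gen U b)) s)) := by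
    ext z : 1
    exact (taylor_snd _ _).symm
  rw [h₁, bc_sub, castF_derN, dd, ← pS_subT_iL, subT_sub]
  congr 2
  rw [bc_at0']
  have h₂ : (fun n => mkD (idS (MvPolynomial ι ℕ) n) (at0 (Finsupp.single (b i) 1) n)) =
      shiftD (Finsupp.single (b i) 1) := (shiftD_eq _).symm
  funext n
  rw [congrFun h₂ n]
  cases n with
  | zero =>
    simp only [shiftD]
    rw [subT_iL_mkD, subT_renT]
    have h₃ : at0' (gen U b) ∘ Nat.succ = fun n => Finsupp.single (qVar (id n)) 1 := rfl
    rw [h₃, subT_var, subT_single, sub_var, one_smul, renT_single, ← bc_pderiv_gen U b hi]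
    apply ext_dual
    · ext z : 1
      simp [pF_apply, taylor_fst, at0']
    · ext z : 1
      simp [pS_apply, taylor_snd, at0']
  | succ n => simp [at0', shiftD, iL]

theorem chain_ruleT (U : Finset ι) (b : ι → ResTerm) {i : ι} (hi : i ∈ U) (S : TS ℕ) :
    bc (pderiv i : Derivation ℕ (MvPolynomial ι ℕ) _).toLinearMap.toAddMonoidHom
        (subT (at0' (gen U b)) (castF _ S)) =
      subT (at0' (gen U b)) (castF _ (der (Finsupp.single (b i) 1) S)) := by
  induction S using Finsupp.induction_linear with
  | zero => simp
  | add f g hf hg => simp only [map_add, castF_add, hf, hg]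
  | single s a =>
    rw [castF_single, subT_single, Nat.cast_smul_eq_nsmul, map_nsmul, chain_rule U b hi, der,
      bil_single, one_mul, castF_nat, castF_smul, map_smul, Nat.cast_smul_eq_nsmul]

/-- Iterated derivative along a list of terms, at zero. -/
noncomputable def derL : List ResTerm → TS ℕ →ₗ[ℕ] TS ℕ
  | [] => kill
  | u :: l => (derL l).comp (der (Finsupp.single u 1))

theorem derL_map (U : Finset ι) (b : ι → ResTerm) (l : List ι) (hl : ∀ i ∈ l, i ∈ U) (S : TS ℕ) :
    derL (l.map b) S = bc (prL l) (subT (at0' (gen U b)) (castF _ S)) := by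
  induction l generalizing S with
  | nil =>
    rw [prL, bc_subT, bc_at0', bc_castF, castF_nat]
    have h₁ : bc ((MvPolynomial.constantCoeff : MvPolynomial ι ℕ →+* ℕ) : _ →+ ℕ) (gen U b) = 0 := by
      simp [gen]
    rw [h₁]; rfl
  | cons i l ih =>
    have := ih (fun j hj => hl j (by simp [hj])) (der (Finsupp.single (b i) 1) S)
    rw [← chain_ruleT U b (hl i (by simp))] at this
    refine Eq.trans this ?_
    ext; rfl

theorem derL_perm {l l' : List ResTerm} (h : l.Perm l') (S : TS ℕ) : derL l S = derL l' S := by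
  classical
  have h₁ := derL_map l.toFinset id l (by simp) S
  have h₂ := derL_map l.toFinset id l' (by intro i hi; simpa using h.mem_iff.mpr hi) S
  rw [List.map_id] at h₁ h₂
  rw [h₁, h₂]
  congr 1
  congr 1
  refine AddMonoidHom.ext fun p => ?_
  rw [prL_eq, prL_eq, Multiset.coe_eq_coe.mpr h]

/-- Symmetric multilinear substitution for the variable `0`, on basis elements. -/
noncomputable def parN (s : ResTerm) (t : Multiset ResTerm) : TS ℕ :=
  derL t.toList (Finsupp.single s 1)

theorem parN_coe (s : ResTerm) (l : List ResTerm) :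
    parN s ↑l = derL l (Finsupp.single s 1) :=
  derL_perm (Multiset.coe_eq_coe.mp (Multiset.coe_toList _)) _

theorem parN_map (U : Finset ι) (b : ι → ResTerm) (l : List ι) (hl : ∀ i ∈ l, i ∈ U)
    (s : ResTerm) :
    parN s ↑(l.map b) = bc (prL l) (sub (at0' (gen U b)) s) := by
  rw [parN_coe, derL_map U b l hl]; simp

variable {K K' : Type} [CommSemiring K] [CommSemiring K']

/-- Symmetric multilinear substitution for the variable `0`. -/
noncomputable def par : TS K →ₗ[K] BS K →ₗ[K] TS K := bil parN

theorem par_castF (S : TS ℕ) (l : List ResTerm) :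
    par (castF K S) (Finsupp.single ↑l 1) = castF K (derL l S) := by
  induction S using Finsupp.induction_linear with
  | zero => simp
  | add f g hf hg => simp only [map_add, castF_add, LinearMap.add_apply, hf, hg]
  | single s a =>
    have : (Finsupp.single s a : TS ℕ) = a • Finsupp.single s 1 := by simp
    rw [castF_single, par, bil_single, mul_one, this, map_smul, parN_coe]
    ext; simp

theorem par_zero (S : TS K) : par S (Finsupp.single 0 1) = kill S :=
  lin_ext (F := par.flip (Finsupp.single 0 1)) (G := kill) (fun s => by
    have := par_castF (K := K) (Finsupp.single s 1) []
    rw [LinearMap.flip_apply, derL, castF_eq_bc, castF_eq_bc, bc_kill] at *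
    simpa using this) S

theorem par_CONS (S U : TS K) (T : BS K) : par S (CONS U T) = par (der U S) T := by
  induction S using Finsupp.induction_linear with
  | zero => simp
  | add f g hf hg => simp only [map_add, LinearMap.add_apply, hf, hg]
  | single s a =>
    induction U using Finsupp.induction_linear with
    | zero => simp
    | add f g hf hg => simp only [map_add, LinearMap.add_apply, hf, hg]
    | single u b =>
      induction T using Finsupp.induction_linear with
      | zero => simp
      | add f g hf hg => simp only [map_add, hf, hg]
      | single t c =>
        have e : (Finsupp.single t c : BS K) = c • Finsupp.single t 1 := by simp
        obtain ⟨l, rfl⟩ : ∃ l : List ResTerm, t = ↑l := ⟨_, (Multiset.coe_toList t).symm⟩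
        rw [CONS_single, par, bil_single, der, bil_single, map_smul, LinearMap.smul_apply,
          e, map_smul, ← par, par_castF, ← mul_smul, Multiset.cons_coe, parN_coe, derL,
          LinearMap.comp_apply, der, bil_single, castF_nat, one_mul, one_smul]
        congr 1
        ring

theorem par_INL (S : TS K) (T : BS K) : par (INL S) T = INL (par S T) := by
  refine bil_ext (F := par.comp INL) (G := par.compr₂ INL) (fun s t => ?_) S T
  simp only [LinearMap.comp_apply, LinearMap.compr₂_apply]
  generalize (Finsupp.single s 1 : TS K) = S
  induction t using Multiset.induction generalizing S with
  | empty => rw [par_zero, par_zero, kill_INL]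
  | cons u t ih =>
    have : (Finsupp.single (u ::ₘ t) 1 : BS K) = CONS (Finsupp.single u 1) (Finsupp.single t 1) := by
      simp
    rw [this, par_CONS, par_CONS, der_INL, ih]

theorem par_INR (S : TS K) (T : BS K) : par (INR S) T = INR (par S T) := by
  refine bil_ext (F := par.comp INR) (G := par.compr₂ INR) (fun s t => ?_) S T
  simp only [LinearMap.comp_apply, LinearMap.compr₂_apply]
  generalize (Finsupp.single s 1 : TS K) = S
  induction t using Multiset.induction generalizing S with
  | empty => rw [par_zero, par_zero, kill_INR]
  | cons u t ih =>
    have : (Finsupp.single (u ::ₘ t) 1 : BS K) = CONS (Finsupp.single u 1) (Finsupp.single t 1) := by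
      simp
    rw [this, par_CONS, par_CONS, der_INR, ih]

theorem subT_par {ρ : ℕ → TS K} (hρ : ∀ n, renT id (ρ n) = ρ n) (S : TS K) (T : BS K) :
    subT ρ (par S T) = par (subT (up ρ) S) (subB ρ T) := by
  refine bil_ext (F := par.compr₂ (subT ρ)) (G := par.compl₁₂ (subT (up ρ)) (subB ρ))
    (fun s t => ?_) S T
  simp only [LinearMap.compl₁₂_apply, LinearMap.compr₂_apply]
  generalize (Finsupp.single s 1 : TS K) = S
  induction t using Multiset.induction generalizing S with
  | empty => rw [par_zero, subB_single, one_smul, subM_zero, par_zero, subT_kill hρ]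
  | cons u t ih =>
    have : (Finsupp.single (u ::ₘ t) 1 : BS K) = CONS (Finsupp.single u 1) (Finsupp.single t 1) := by
      simp
    rw [this, par_CONS, ih, subB_CONS, par_CONS, der_subT]

theorem bc_par (φ : K →+* K') (S : TS K) (T : BS K) :
    bc (φ : K →+ K') (par S T) = par (bc (φ : K →+ K') S) (bc (φ : K →+ K') T) := bc_bil _ _ _ _

theorem pS_par (S : TS (DualNumber K)) (T : BS (DualNumber K)) :
    pS (par S T) = par (pF S) (pS T) + par (pS S) (pF T) := pS_bil _ _ _

theorem renT_par (ξ : ℕ → ℕ) (S : TS K) (T : BS K) :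
    renT ξ (par S T) = par (renT (upr ξ) S) (renB ξ T) := by
  have h₁ : ∀ (ξ : ℕ → ℕ) (T : BS K),
      subB (fun n => Finsupp.single (qVar (ξ n)) 1) T = renB ξ T := by
    intro ξ T
    refine lin_ext (F := subB _) (G := renB ξ) (fun t => ?_) T
    rw [subB_single, one_smul, renB_single, subM]
    simp only [sub_single_var]
    exact bagP_single _ _
  rw [← subT_var, subT_par (by simp), up_var, subT_var, h₁]

end Partial

section Parallel

mutual
  /-- Parallel reduction of sums of resource terms, pushing sum injections outwards. -/
  inductive PT {K : Type} [CommSemiring K] : TS K → TS K → Prop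
    | zero : PT 0 0
    | add {S S' T T'} : PT S S' → PT T T' → PT (S + T) (S' + T')
    | smul (a : K) {S S'} : PT S S' → PT (a • S) (a • S')
    | var (n : ℕ) : PT (Finsupp.single (qVar n) 1) (Finsupp.single (qVar n) 1)
    | lam {S S'} : PT S S' → PT (LAM S) (LAM S')
    | inl {S S'} : PT S S' → PT (INL S) (INL S')
    | inr {S S'} : PT S S' → PT (INR S) (INR S')
    | app {S S' T T'} : PT S S' → PB T T' → PT (APP S T) (APP S' T')
    | beta {S S' T T'} : PT S S' → PB T T' → PT (APP (LAM S) T) (par S' T')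
  /-- Parallel reduction of sums of resource monomials. -/
  inductive PB {K : Type} [CommSemiring K] : BS K → BS K → Prop
    | zero : PB 0 0
    | add {S S' T T'} : PB S S' → PB T T' → PB (S + T) (S' + T')
    | smul (a : K) {S S'} : PB S S' → PB (a • S) (a • S')
    | nil : PB (Finsupp.single 0 1) (Finsupp.single 0 1)
    | cons {S S' T T'} : PT S S' → PB T T' → PB (CONS S T) (CONS S' T')
end

variable {K K' : Type} [CommSemiring K] [CommSemiring K']

/-- Simultaneous induction on parallel reductions. -/
theorem PT.ind {p : TS K → TS K → Prop} {q : BS K → BS K → Prop}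
    (zero : p 0 0)
    (add : ∀ {S S' T T'}, p S S' → p T T' → p (S + T) (S' + T'))
    (smul : ∀ (a : K) {S S'}, p S S' → p (a • S) (a • S'))
    (var : ∀ n : ℕ, p (Finsupp.single (qVar n) 1) (Finsupp.single (qVar n) 1))
    (lam : ∀ {S S'}, PT S S' → p S S' → p (LAM S) (LAM S'))
    (inl : ∀ {S S'}, p S S' → p (INL S) (INL S'))
    (inr : ∀ {S S'}, p S S' → p (INR S) (INR S'))
    (app : ∀ {S S' T T'}, PT S S' → PB T T' → p S S' → q T T' → p (APP S T) (APP S' T'))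
    (beta : ∀ {S S' T T'}, PT S S' → PB T T' → p S S' → q T T' →
      p (APP (LAM S) T) (par S' T'))
    (zeroB : q 0 0)
    (addB : ∀ {S S' T T'}, q S S' → q T T' → q (S + T) (S' + T'))
    (smulB : ∀ (a : K) {S S'}, q S S' → q (a • S) (a • S'))
    (nil : q (Finsupp.single 0 1) (Finsupp.single 0 1))
    (cons : ∀ {S S' T T'}, p S S' → q T T' → q (CONS S T) (CONS S' T')) :
    (∀ {S S'}, PT S S' → p S S') ∧ ∀ {T T'}, PB T T' → q T T' := by
  constructor
  · intro S S' h
    exact PT.rec (motive_1 := fun S S' _ => p S S') (motive_2 := fun S S' _ => q S S')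
      zero (fun _ _ => add) (fun a _ _ _ => smul a) var (fun h => lam h) (fun _ => inl)
      (fun _ => inr) (fun h h' => app h h') (fun h h' => beta h h') zeroB (fun _ _ => addB)
      (fun a _ _ _ => smulB a) nil (fun _ _ => cons) h
  · intro S S' h
    exact PB.rec (motive_1 := fun S S' _ => p S S') (motive_2 := fun S S' _ => q S S')
      zero (fun _ _ => add) (fun a _ _ _ => smul a) var (fun h => lam h) (fun _ => inl)
      (fun _ => inr) (fun h h' => app h h') (fun h h' => beta h h') zeroB (fun _ _ => addB)
      (fun a _ _ _ => smulB a) nil (fun _ _ => cons) h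

theorem P_ren :
    (∀ {S S' : TS K}, PT S S' → ∀ ξ, PT (renT ξ S) (renT ξ S')) ∧
    ∀ {T T' : BS K}, PB T T' → ∀ ξ, PB (renB ξ T) (renB ξ T') := by
  apply PT.ind
  case zero => intro ξ; simpa using PT.zero
  case add => intro _ _ _ _ h h' ξ; simpa using PT.add (h ξ) (h' ξ)
  case smul => intro a _ _ h ξ; simpa using PT.smul a (h ξ)
  case var => intro n ξ; simpa using PT.var (ξ n)
  case lam => intro _ _ _ h ξ; simpa only [renT_LAM] using PT.lam (h (upr ξ))
  case inl => intro _ _ h ξ; simpa only [renT_INL] using PT.inl (h ξ)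
  case inr => intro _ _ h ξ; simpa only [renT_INR] using PT.inr (h ξ)
  case app => intro _ _ _ _ _ _ h h' ξ; simpa only [renT_APP] using PT.app (h ξ) (h' ξ)
  case beta =>
    intro _ _ _ _ _ _ h h' ξ
    simpa only [renT_APP, renT_LAM, renT_par] using PT.beta (h (upr ξ)) (h' ξ)
  case zeroB => intro ξ; simpa using PB.zero
  case addB => intro _ _ _ _ h h' ξ; simpa using PB.add (h ξ) (h' ξ)
  case smulB => intro a _ _ h ξ; simpa using PB.smul a (h ξ)
  case nil => intro ξ; simpa using PB.nil
  case cons => intro _ _ _ _ h h' ξ; simpa only [renB_CONS] using PB.cons (h ξ) (h' ξ)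

theorem P_id :
    (∀ {S S' : TS K}, PT S S' → renT id S = S ∧ renT id S' = S') ∧
    ∀ {T T' : BS K}, PB T T' → renB id T = T ∧ renB id T' = T' := by
  apply PT.ind
  case zero => simp
  case add => rintro _ _ _ _ ⟨h₁, h₂⟩ ⟨h₃, h₄⟩; simp [*]
  case smul => rintro _ _ _ ⟨h₁, h₂⟩; simp [*]
  case var => simp
  case lam => rintro _ _ _ ⟨h₁, h₂⟩; simp [renT_LAM, upr_id, *]
  case inl => rintro _ _ ⟨h₁, h₂⟩; simp [renT_INL, *]
  case inr => rintro _ _ ⟨h₁, h₂⟩; simp [renT_INR, *]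
  case app => rintro _ _ _ _ _ _ ⟨h₁, h₂⟩ ⟨h₃, h₄⟩; simp [renT_APP, *]
  case beta =>
    rintro _ _ _ _ _ _ ⟨h₁, h₂⟩ ⟨h₃, h₄⟩
    simp [renT_APP, renT_LAM, renT_par, upr_id, *]
  case zeroB => simp
  case addB => rintro _ _ _ _ ⟨h₁, h₂⟩ ⟨h₃, h₄⟩; simp [*]
  case smulB => rintro _ _ _ ⟨h₁, h₂⟩; simp [*]
  case nil => simp
  case cons => rintro _ _ _ _ ⟨h₁, h₂⟩ ⟨h₃, h₄⟩; simp [renB_CONS, *]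

theorem PT_up {ρ ρ' : ℕ → TS K} (h : ∀ n, PT (ρ n) (ρ' n)) (n : ℕ) : PT (up ρ n) (up ρ' n) := by
  cases n with
  | zero => exact .var 0
  | succ n => exact P_ren.1 (h n) _

theorem P_sub :
    (∀ {S S' : TS K}, PT S S' → ∀ ρ ρ' : ℕ → TS K, (∀ n, PT (ρ n) (ρ' n)) →
      PT (subT ρ S) (subT ρ' S')) ∧
    ∀ {T T' : BS K}, PB T T' → ∀ ρ ρ' : ℕ → TS K, (∀ n, PT (ρ n) (ρ' n)) →
      PB (subB ρ T) (subB ρ' T') := by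
  apply PT.ind
  case zero => intro ρ ρ' hρ; simpa using PT.zero
  case add => intro _ _ _ _ h h' ρ ρ' hρ; simpa using PT.add (h ρ ρ' hρ) (h' ρ ρ' hρ)
  case smul => intro a _ _ h ρ ρ' hρ; simpa using PT.smul a (h ρ ρ' hρ)
  case var => intro n ρ ρ' hρ; simpa using hρ n
  case lam =>
    intro _ _ _ h ρ ρ' hρ
    simpa only [subT_LAM] using PT.lam (h (up ρ) (up ρ') (PT_up hρ))
  case inl => intro _ _ h ρ ρ' hρ; simpa only [subT_INL] using PT.inl (h ρ ρ' hρ)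
  case inr => intro _ _ h ρ ρ' hρ; simpa only [subT_INR] using PT.inr (h ρ ρ' hρ)
  case app =>
    intro _ _ _ _ _ _ h h' ρ ρ' hρ
    simpa only [subT_APP] using PT.app (h ρ ρ' hρ) (h' ρ ρ' hρ)
  case beta =>
    intro _ _ _ _ _ _ h h' ρ ρ' hρ
    rw [subT_APP, subT_LAM, subT_par fun n => (P_id.1 (hρ n)).2]
    exact PT.beta (h (up ρ) (up ρ') (PT_up hρ)) (h' ρ ρ' hρ)
  case zeroB => intro ρ ρ' hρ; simpa using PB.zero
  case addB => intro _ _ _ _ h h' ρ ρ' hρ; simpa using PB.add (h ρ ρ' hρ) (h' ρ ρ' hρ)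
  case smulB => intro a _ _ h ρ ρ' hρ; simpa using PB.smul a (h ρ ρ' hρ)
  case nil => intro ρ ρ' hρ; simpa using PB.nil
  case cons =>
    intro _ _ _ _ h h' ρ ρ' hρ
    simpa only [subB_CONS] using PB.cons (h ρ ρ' hρ) (h' ρ ρ' hρ)

theorem P_bc (φ : K →+* K') :
    (∀ {S S' : TS K}, PT S S' → PT (bc (φ : K →+ K') S) (bc (φ : K →+ K') S')) ∧
    ∀ {T T' : BS K}, PB T T' → PB (bc (φ : K →+ K') T) (bc (φ : K →+ K') T') := by
  apply PT.ind
  case zero => simpa using PT.zero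
  case add => intro _ _ _ _ h h'; simpa only [map_add] using PT.add h h'
  case smul => intro a _ _ h; simpa only [bc_smul] using PT.smul _ h
  case var => intro n; simpa using PT.var n
  case lam => intro _ _ _ h; simpa only [bc_LAM] using PT.lam h
  case inl => intro _ _ h; simpa only [bc_INL] using PT.inl h
  case inr => intro _ _ h; simpa only [bc_INR] using PT.inr h
  case app => intro _ _ _ _ _ _ h h'; simpa only [bc_APP] using PT.app h h'
  case beta =>
    intro _ _ _ _ _ _ h h'
    simpa only [bc_APP, bc_LAM, bc_par] using PT.beta h h'
  case zeroB => simpa using PB.zero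
  case addB => intro _ _ _ _ h h'; simpa only [map_add] using PB.add h h'
  case smulB => intro a _ _ h; simpa only [bc_smul] using PB.smul _ h
  case nil => simpa using PB.nil
  case cons => intro _ _ _ _ h h'; simpa only [bc_CONS] using PB.cons h h'

theorem pF_LAM (S : TS (DualNumber K)) : pF (LAM S) = LAM (pF S) := bc_LAM _ _
theorem pF_APP (S : TS (DualNumber K)) (T : BS (DualNumber K)) :
    pF (APP S T) = APP (pF S) (pF T) := bc_APP _ _ _
theorem pF_CONS (S : TS (DualNumber K)) (T : BS (DualNumber K)) :
    pF (CONS S T) = CONS (pF S) (pF T) := bc_CONS _ _ _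
theorem pF_par (S : TS (DualNumber K)) (T : BS (DualNumber K)) :
    pF (par S T) = par (pF S) (pF T) := bc_par _ _ _

theorem P_pS :
    (∀ {S S' : TS (DualNumber K)}, PT S S' → PT (pF S) (pF S') ∧ PT (pS S) (pS S')) ∧
    ∀ {T T' : BS (DualNumber K)}, PB T T' → PB (pF T) (pF T') ∧ PB (pS T) (pS T') := by
  have key : (∀ {S S' : TS (DualNumber K)}, PT S S' → PT (pS S) (pS S') ∧ PT (pF S) (pF S')) ∧
    ∀ {T T' : BS (DualNumber K)}, PB T T' → PB (pS T) (pS T') ∧ PB (pF T) (pF T') := by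
    apply PT.ind
    case zero => simpa using PT.zero
    case add => intro _ _ _ _ h h'; simpa using ⟨PT.add h.1 h'.1, PT.add h.2 h'.2⟩
    case smul =>
      intro a _ _ h
      rw [pS_smul, pS_smul, pF_smul, pF_smul]
      exact ⟨.add (.smul _ h.1) (.smul _ h.2), .smul _ h.2⟩
    case var =>
      intro n
      constructor
      · simpa [pS] using PT.zero
      · simpa [pF] using PT.var n
    case lam =>
      intro _ _ _ h
      rw [pS_LAM, pS_LAM, pF_LAM, pF_LAM]
      exact ⟨.lam h.1, .lam h.2⟩
    case inl =>
      intro _ _ h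
      rw [pS_INL, pS_INL, pF, bc_INL, pF, bc_INL]
      exact ⟨.inl h.1, .inl h.2⟩
    case inr =>
      intro _ _ h
      rw [pS_INR, pS_INR, pF, bc_INR, pF, bc_INR]
      exact ⟨.inr h.1, .inr h.2⟩
    case app =>
      intro _ _ _ _ _ _ h h'
      rw [pS_APP, pS_APP, pF_APP, pF_APP]
      exact ⟨.add (.app h.2 h'.1) (.app h.1 h'.2), .app h.2 h'.2⟩
    case beta =>
      intro _ _ _ _ _ _ h h'
      rw [pS_APP, pS_par, pF_APP, pF_par, pS_LAM, pF_LAM]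
      exact ⟨.add (.beta h.2 h'.1) (.beta h.1 h'.2), .beta h.2 h'.2⟩
    case zeroB => simpa using PB.zero
    case addB => intro _ _ _ _ h h'; simpa using ⟨PB.add h.1 h'.1, PB.add h.2 h'.2⟩
    case smulB =>
      intro a _ _ h
      rw [pS_smul, pS_smul, pF_smul, pF_smul]
      exact ⟨.add (.smul _ h.1) (.smul _ h.2), .smul _ h.2⟩
    case nil =>
      constructor
      · simpa [pS] using PB.zero
      · simpa [pF] using PB.nil
    case cons =>
      intro _ _ _ _ h h'
      rw [pS_CONS, pS_CONS, pF_CONS, pF_CONS]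
      exact ⟨.add (.cons h.2 h'.1) (.cons h.1 h'.2), .cons h.2 h'.2⟩
  exact ⟨fun h => (key.1 h).symm, fun h => (key.2 h).symm⟩

theorem bc_dinr (H : TS K) :
    bc (dinr K) H = (TrivSqZeroExt.inr 1 : DualNumber K) • iL H := by
  ext z : 1
  simp only [bc_apply, dinr_apply, Finsupp.smul_apply, iL_apply, smul_eq_mul]
  ext <;> simp

theorem PT_mkD {S S' H H' : TS K} (h : PT S S') (h' : PT H H') : PT (mkD S H) (mkD S' H') := by
  rw [mkD, mkD, bc_dinr, bc_dinr]
  exact .add ((P_bc _).1 h) (.smul _ ((P_bc _).1 h'))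

theorem PT_der {U U' S S' : TS K} (h : PT U U') (h' : PT S S') : PT (der U S) (der U' S') := by
  rw [der_eq, der_eq]
  refine (P_pS.1 (P_sub.1 ((P_bc _).1 h') _ _ fun n => ?_)).2
  cases n with
  | zero => exact PT_mkD (.var 0) (P_ren.1 h _)
  | succ n => exact .var _

theorem PT_kill {S S' : TS K} (h : PT S S') : PT (kill S) (kill S') := by
  refine P_sub.1 h _ _ fun n => ?_
  cases n with
  | zero => exact .zero
  | succ n => exact .var _

theorem PT_par {S S' : TS K} {T T' : BS K} (h : PT S S') (h' : PB T T') :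
    PT (par S T) (par S' T') := by
  have key := PT.ind (K := K) (p := PT) (q := fun T T' => ∀ S S', PT S S' →
    PT (par S T) (par S' T')) .zero .add .smul .var (fun _ => .lam) .inl .inr
    (fun h h' _ _ => .app h h') (fun h h' _ _ => .beta h h')
    (by intro S S' h; simpa using PT.zero)
    (by intro _ _ _ _ h h' S S' hS; simpa using PT.add (h S S' hS) (h' S S' hS))
    (by intro a _ _ h S S' hS; simpa using PT.smul a (h S S' hS))
    (by intro S S' hS; simpa only [par_zero] using PT_kill hS)
    (by intro _ _ _ _ h h' S S' hS; simpa only [par_CONS] using h' _ _ (PT_der h hS))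
  exact key.2 h' _ _ h

theorem PT_ren_self (s : ResTerm) :
    PT (Finsupp.single (ren id s) 1 : TS K) (Finsupp.single (ren id s) 1) := by
  induction s using ResTerm.ind with
  | var n => simpa using PT.var n
  | lam s ih => simpa [upr_id] using PT.lam ih
  | inl s ih => simpa using PT.inl ih
  | inr s ih => simpa using PT.inr ih
  | app s t ihs iht =>
    have : PB (Finsupp.single (t.map (ren id)) 1 : BS K) (Finsupp.single (t.map (ren id)) 1) := by
      clear ihs
      induction t using Multiset.induction with
      | empty => exact PB.nil
      | cons u t ih =>
        simpa using PB.cons (iht u (by simp)) (ih fun v hv => iht v (by simp [hv]))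
    simpa using PT.app ihs this

theorem PB_ren_self (t : Multiset ResTerm) :
    PB (Finsupp.single (t.map (ren id)) 1 : BS K) (Finsupp.single (t.map (ren id)) 1) := by
  induction t using Multiset.induction with
  | empty => exact PB.nil
  | cons u t ih => simpa using PB.cons (PT_ren_self u) ih

/-- Full development on resource terms, and development of the argument of an abstraction
together with a given development of a monomial it is applied to. -/
noncomputable def dev2 (s : ResTerm) : TS ℕ × (BS ℕ → TS ℕ) :=
  ResAlg.fold (A := TS ℕ × (BS ℕ → TS ℕ))
    ⟨fun n => (Finsupp.single (qVar n) 1, APP (Finsupp.single (qVar n) 1)),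
     fun _ x => (LAM x.1, par x.1),
     fun _ x => (INL x.1, fun T => INL (x.2 T)),
     fun _ x => (INR x.1, fun T => INR (x.2 T)),
     fun _ x t => let y := x.2 (bagP (t.map fun u => u.2.1)); (y, APP y)⟩ s

/-- Full development of a resource term. -/
noncomputable def devN (s : ResTerm) : TS ℕ := (dev2 s).1
/-- Development of an application to a developed monomial. -/
noncomputable def devA (s : ResTerm) (T : BS ℕ) : TS ℕ := (dev2 s).2 T
/-- Full development of a resource monomial. -/
noncomputable def devM (t : Multiset ResTerm) : BS ℕ := bagP (t.map devN)

@[simp] theorem devN_var (n : ℕ) : devN (qVar n) = Finsupp.single (qVar n) 1 := by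
  rw [devN, dev2, ResAlg.fold_var]
@[simp] theorem devN_lam (s : ResTerm) : devN (qLam s) = LAM (devN s) := by
  rw [devN, dev2, ResAlg.fold_lam]; rfl
@[simp] theorem devN_inl (s : ResTerm) : devN (qInl s) = INL (devN s) := by
  rw [devN, dev2, ResAlg.fold_inl]; rfl
@[simp] theorem devN_inr (s : ResTerm) : devN (qInr s) = INR (devN s) := by
  rw [devN, dev2, ResAlg.fold_inr]; rfl
@[simp] theorem devN_app (s : ResTerm) (t : Multiset ResTerm) :
    devN (qApp s t) = devA s (devM t) := by
  rw [devN, dev2, ResAlg.fold_app]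
  simp only [Multiset.map_map, Function.comp_def]; rfl
@[simp] theorem devA_var (n : ℕ) (T : BS ℕ) :
    devA (qVar n) T = APP (Finsupp.single (qVar n) 1) T := by
  rw [devA, dev2, ResAlg.fold_var]
@[simp] theorem devA_lam (s : ResTerm) (T : BS ℕ) : devA (qLam s) T = par (devN s) T := by
  rw [devA, dev2, ResAlg.fold_lam]; rfl
@[simp] theorem devA_inl (s : ResTerm) (T : BS ℕ) : devA (qInl s) T = INL (devA s T) := by
  rw [devA, dev2, ResAlg.fold_inl]; rfl
@[simp] theorem devA_inr (s : ResTerm) (T : BS ℕ) : devA (qInr s) T = INR (devA s T) := by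
  rw [devA, dev2, ResAlg.fold_inr]; rfl
@[simp] theorem devA_app (s : ResTerm) (t : Multiset ResTerm) (T : BS ℕ) :
    devA (qApp s t) T = APP (devA s (devM t)) T := by
  rw [devA, dev2, ResAlg.fold_app]
  simp only [Multiset.map_map, Function.comp_def]; rfl
@[simp] theorem devM_zero : devM 0 = Finsupp.single 0 1 := by simp [devM]
@[simp] theorem devM_cons (u : ResTerm) (t : Multiset ResTerm) :
    devM (u ::ₘ t) = CONS (devN u) (devM t) := by simp [devM]

theorem devN_lamP (s : ResTerm) : devN (lamP s) = LAM (devN s) := by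
  induction s using ResTerm.pushInd <;> simp [LAM_INL, LAM_INR, *]
theorem devN_appP (s : ResTerm) (t : Multiset ResTerm) : devN (appP s t) = devA s (devM t) := by
  induction s using ResTerm.pushInd <;> simp [*]
theorem devA_appP (s : ResTerm) (t : Multiset ResTerm) (T : BS ℕ) :
    devA (appP s t) T = APP (devA s (devM t)) T := by
  induction s using ResTerm.pushInd <;> simp [APP_INL, APP_INR, *]
theorem devA_lamP (s : ResTerm) (T : BS ℕ) : devA (lamP s) T = par (devN s) T := by
  induction s using ResTerm.pushInd <;> simp [par_INL, par_INR, *]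

/-- Full development of a sum of resource terms. -/
noncomputable def devT : TS ℕ →ₗ[ℕ] TS ℕ := Finsupp.linearCombination ℕ devN
/-- Full development of a sum of resource monomials. -/
noncomputable def devB : BS ℕ →ₗ[ℕ] BS ℕ := Finsupp.linearCombination ℕ devM

theorem devA_linear : ∀ s, IsLinearMap ℕ (devA s) := by
  have key : ∀ s, ∃ L : BS ℕ →ₗ[ℕ] TS ℕ, devA s = L := by
    intro s
    induction s using ResTerm.ind with
    | var n => exact ⟨APP (Finsupp.single (qVar n) 1), by funext T; simp⟩
    | lam s ih => exact ⟨par (devN s), by funext T; simp⟩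
    | inl s ih => obtain ⟨L, h⟩ := ih; exact ⟨INL.comp L, by funext T; simp [h]⟩
    | inr s ih => obtain ⟨L, h⟩ := ih; exact ⟨INR.comp L, by funext T; simp [h]⟩
    | app s t => exact ⟨APP (devA s (devM t)), by funext T; simp⟩
  intro s
  obtain ⟨L, h⟩ := key s
  rw [h]
  exact L.isLinear

/-- Development of applications, as a bilinear map. -/
noncomputable def devAT : TS ℕ →ₗ[ℕ] BS ℕ →ₗ[ℕ] TS ℕ :=
  Finsupp.linearCombination ℕ fun s => (devA_linear s).mk' _

@[simp] theorem devT_single (s : ResTerm) (a : ℕ) : devT (Finsupp.single s a) = a • devN s := by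
  simp [devT]
@[simp] theorem devB_single (t : Multiset ResTerm) (a : ℕ) :
    devB (Finsupp.single t a) = a • devM t := by simp [devB]
@[simp] theorem devAT_single (s : ResTerm) (a : ℕ) (T : BS ℕ) :
    devAT (Finsupp.single s a) T = a • devA s T := by simp [devAT]

theorem devT_LAM (S : TS ℕ) : devT (LAM S) = LAM (devT S) :=
  lin_ext (F := devT.comp LAM) (G := LAM.comp devT) (by simp [devN_lamP]) S
theorem devT_INL (S : TS ℕ) : devT (INL S) = INL (devT S) :=
  lin_ext (F := devT.comp INL) (G := INL.comp devT) (by simp) S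
theorem devT_INR (S : TS ℕ) : devT (INR S) = INR (devT S) :=
  lin_ext (F := devT.comp INR) (G := INR.comp devT) (by simp) S
theorem devT_APP (S : TS ℕ) (T : BS ℕ) : devT (APP S T) = devAT S (devB T) :=
  bil_ext (F := APP.compr₂ devT) (G := devAT.compl₁₂ LinearMap.id devB) (by simp [devN_appP]) S T
theorem devB_CONS (S : TS ℕ) (T : BS ℕ) : devB (CONS S T) = CONS (devT S) (devB T) :=
  bil_ext (F := CONS.compr₂ devB) (G := CONS.compl₁₂ devT devB) (by simp) S T
theorem devAT_LAM (S : TS ℕ) (T : BS ℕ) : devAT (LAM S) T = par (devT S) T :=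
  lin_ext (F := (devAT.comp LAM).flip T) (G := (par.comp devT).flip T)
    (by simp [devA_lamP]) S
theorem devAT_INL (S : TS ℕ) (T : BS ℕ) : devAT (INL S) T = INL (devAT S T) :=
  lin_ext (F := (devAT.comp INL).flip T) (G := INL.comp (devAT.flip T)) (by simp) S
theorem devAT_INR (S : TS ℕ) (T : BS ℕ) : devAT (INR S) T = INR (devAT S T) :=
  lin_ext (F := (devAT.comp INR).flip T) (G := INR.comp (devAT.flip T)) (by simp) S
theorem devAT_APP (S : TS ℕ) (T T' : BS ℕ) :
    devAT (APP S T) T' = APP (devAT S (devB T)) T' :=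
  bil_ext (F := (APP.compr₂ (devAT.flip T')))
    (G := (devAT.compl₁₂ LinearMap.id devB).compr₂ (APP.flip T')) (by simp [devA_appP]) S T

/-- The triangle property of full developments. -/
theorem triangle :
    (∀ {S S' : TS ℕ}, PT S S' → PT S' (devT S) ∧
      ∀ T' T, PB T' T → PT (APP S' T') (devAT S T)) ∧
    ∀ {T T' : BS ℕ}, PB T T' → PB T' (devB T) := by
  apply PT.ind
  case zero => exact ⟨by simpa using PT.zero, fun _ _ _ => by simpa using PT.zero⟩
  case add =>
    intro _ _ _ _ h h'
    exact ⟨by simpa using PT.add h.1 h'.1,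
      fun T' T hT => by simpa using PT.add (h.2 T' T hT) (h'.2 T' T hT)⟩
  case smul =>
    intro a _ _ h
    exact ⟨by simpa using PT.smul a h.1, fun T' T hT => by simpa using PT.smul a (h.2 T' T hT)⟩
  case var =>
    intro n
    exact ⟨by simpa using PT.var n, fun T' T hT => by simpa using PT.app (PT.var n) hT⟩
  case lam =>
    intro _ _ _ h
    rw [devT_LAM]
    refine ⟨.lam h.1, fun T' T hT => ?_⟩
    rw [devAT_LAM]
    exact .beta h.1 hT
  case inl =>
    intro _ _ h
    rw [devT_INL]
    refine ⟨.inl h.1, fun T' T hT => ?_⟩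
    rw [devAT_INL, APP_INL]
    exact .inl (h.2 _ _ hT)
  case inr =>
    intro _ _ h
    rw [devT_INR]
    refine ⟨.inr h.1, fun T' T hT => ?_⟩
    rw [devAT_INR, APP_INR]
    exact .inr (h.2 _ _ hT)
  case app =>
    intro _ _ _ _ _ _ h h'
    rw [devT_APP]
    refine ⟨h.2 _ _ h', fun T' T hT => ?_⟩
    rw [devAT_APP]
    exact .app (h.2 _ _ h') hT
  case beta =>
    intro _ _ _ _ _ _ h h'
    rw [devT_APP, devAT_LAM]
    refine ⟨PT_par h.1 h', fun T' T hT => ?_⟩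
    rw [devAT_APP, devAT_LAM]
    exact .app (PT_par h.1 h') hT
  case zeroB => simpa using PB.zero
  case addB => intro _ _ _ _ h h'; simpa using PB.add h h'
  case smulB => intro a _ _ h; simpa using PB.smul a h
  case nil => simpa using PB.nil
  case cons =>
    intro _ _ _ _ h h'
    rw [devB_CONS]
    exact .cons h.1 h'

end Parallel

section Normal

variable {X Y Z : Type} {K : Type} [CommSemiring K]

theorem exists_of_mem_lin {g : X → Z →₀ ℕ} {S : X →₀ K} {z : Z} (h : lin g S z ≠ 0) :
    ∃ x, S x ≠ 0 ∧ g x z ≠ 0 := by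
  induction S using Finsupp.induction_linear with
  | zero => simp at h
  | add F G hF hG =>
    classical
    by_contra! hn
    refine h ?_
    rw [lin, Finsupp.linearCombination_apply, Finsupp.sum, Finsupp.finsetSum_apply]
    refine Finset.sum_eq_zero fun x hx => ?_
    rw [Finsupp.smul_apply, castF_apply, hn x (Finsupp.mem_support_iff.mp hx)]
    simp
  | single x a =>
    rw [lin_single] at h
    refine ⟨x, ?_, ?_⟩
    · rintro h'; simp_all
    · rintro h'; simp_all

theorem exists_of_mem_bil {g : X → Y → Z →₀ ℕ} {S : X →₀ K} {T : Y →₀ K} {z : Z}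
    (h : bil g S T z ≠ 0) : ∃ x y, S x ≠ 0 ∧ T y ≠ 0 ∧ g x y z ≠ 0 := by
  rw [bil, Finsupp.linearCombination_apply, Finsupp.sum, LinearMap.sum_apply,
    Finsupp.finsetSum_apply] at h
  obtain ⟨x, hx, hx'⟩ := Finset.exists_ne_zero_of_sum_ne_zero h
  have h' : lin (g x) T z ≠ 0 := by
    rintro h'
    refine hx' ?_
    rw [LinearMap.smul_apply, Finsupp.smul_apply]
    exact (congrArg _ h').trans (smul_zero _)
  obtain ⟨y, hy, hy'⟩ := exists_of_mem_lin h'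
  exact ⟨x, y, Finsupp.mem_support_iff.mp hx, hy, hy'⟩

theorem mem_lin {g : X → Z →₀ ℕ} {S : X →₀ ℕ} {x : X} {z : Z} (hx : S x ≠ 0) (hz : g x z ≠ 0) :
    lin g S z ≠ 0 := by
  rw [lin, Finsupp.linearCombination_apply, Finsupp.sum, Finsupp.finsetSum_apply]
  have hx' := Finsupp.mem_support_iff.mpr hx
  intro h
  have := Finset.sum_eq_zero_iff.mp h x hx'
  simp_all

theorem mem_bil {g : X → Y → Z →₀ ℕ} {S : X →₀ ℕ} {T : Y →₀ ℕ} {x : X} {y : Y} {z : Z}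
    (hx : S x ≠ 0) (hy : T y ≠ 0) (hz : g x y z ≠ 0) : bil g S T z ≠ 0 := by
  rw [bil, Finsupp.linearCombination_apply, Finsupp.sum, LinearMap.sum_apply,
    Finsupp.finsetSum_apply]
  have hx' := Finsupp.mem_support_iff.mpr hx
  intro h
  have := Finset.sum_eq_zero_iff.mp h x hx'
  have h₁ := mem_lin hy hz (g := g x)
  rw [LinearMap.smul_apply, Finsupp.smul_apply, smul_eq_mul] at this
  exact (mul_ne_zero hx h₁) this

/-- Normal resource terms. -/
inductive Nrm : ResTerm → Prop
  | var (n : ℕ) : Nrm (qVar n)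
  | lam {s} : Nrm s → (∀ s', s ≠ qInl s') → (∀ s', s ≠ qInr s') → Nrm (qLam s)
  | inl {s} : Nrm s → Nrm (qInl s)
  | inr {s} : Nrm s → Nrm (qInr s)
  | app {s t} : Nrm s → (∀ s', s ≠ qLam s') → (∀ s', s ≠ qInl s') → (∀ s', s ≠ qInr s') →
      (∀ u ∈ t, Nrm u) → Nrm (qApp s t)

@[simp] theorem nrm_inl {s : ResTerm} : Nrm (qInl s) ↔ Nrm s := by
  refine ⟨fun h => ?_, .inl⟩
  generalize e : qInl s = s' at h
  cases h with
  | inl h => rwa [qInl_inj.mp e]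
  | _ => exact absurd (congrArg shape e) (by simp)

@[simp] theorem nrm_inr {s : ResTerm} : Nrm (qInr s) ↔ Nrm s := by
  refine ⟨fun h => ?_, .inr⟩
  generalize e : qInr s = s' at h
  cases h with
  | inr h => rwa [qInr_inj.mp e]
  | _ => exact absurd (congrArg shape e) (by simp)

theorem nrm_of_lam {s : ResTerm} (h : Nrm (qLam s)) : Nrm s := by
  generalize e : qLam s = s' at h
  cases h with
  | lam h => rwa [qLam_inj.mp e]
  | _ => exact absurd (congrArg shape e) (by simp)

theorem nrm_of_app {s : ResTerm} {t : Multiset ResTerm} (h : Nrm (qApp s t)) :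
    Nrm s ∧ (∀ u ∈ t, Nrm u) ∧ ∀ s', s ≠ qLam s' := by
  generalize e : qApp s t = s' at h
  cases h with
  | app h h' _ _ ht => rw [(qApp_inj.mp e).1, (qApp_inj.mp e).2]; exact ⟨h, ht, h'⟩
  | _ => exact absurd (congrArg shape e) (by simp)

theorem nrm_of_lamP {s : ResTerm} (h : Nrm (lamP s)) : Nrm s := by
  induction s using ResTerm.pushInd with
  | inl s ih => simpa using ih (by simpa using h)
  | inr s ih => simpa using ih (by simpa using h)
  | _ => exact nrm_of_lam (by simpa using h)

theorem nrm_of_appP {s : ResTerm} {t : Multiset ResTerm} (h : Nrm (appP s t)) :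
    Nrm s ∧ ∀ u ∈ t, Nrm u := by
  induction s using ResTerm.pushInd with
  | inl s ih => simpa using ih (by simpa using h)
  | inr s ih => simpa using ih (by simpa using h)
  | _ =>
    have := nrm_of_app (by simpa using h)
    exact ⟨this.1, this.2.1⟩

theorem not_nrm_appP_lamP (s : ResTerm) (t : Multiset ResTerm) : ¬ Nrm (appP (lamP s) t) := by
  induction s using ResTerm.pushInd with
  | inl s ih => simpa using ih
  | inr s ih => simpa using ih
  | _ => simpa using fun h => (nrm_of_app h).2.2 _ rfl

theorem Nrm.ren_id {s : ResTerm} (h : Nrm s) : ren id s = s := by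
  induction h with
  | var n => simp
  | @lam s h h₁ h₂ ih =>
    rw [ren_lam, upr_id, ih]
    induction s using ResTerm.pushInd with
    | inl s => exact absurd rfl (h₁ s)
    | inr s => exact absurd rfl (h₂ s)
    | _ => simp
  | inl _ ih => simp [ih]
  | inr _ ih => simp [ih]
  | @app s t h h₁ h₂ h₃ _ ih iht =>
    rw [ren_app, ih, Multiset.map_congr rfl iht, Multiset.map_id']
    induction s using ResTerm.pushInd with
    | inl s => exact absurd rfl (h₂ s)
    | inr s => exact absurd rfl (h₃ s)
    | _ => simp

/-- Sums of normal terms only reduce to themselves. -/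
theorem normal_stable :
    (∀ {S S' : TS ℕ}, PT S S' → (∀ s, S s ≠ 0 → Nrm s) → S' = S) ∧
    ∀ {T T' : BS ℕ}, PB T T' → (∀ t, T t ≠ 0 → ∀ u ∈ t, Nrm u) → T' = T := by
  have ne : ∀ {Z : Type} {S : Z →₀ ℕ}, S ≠ 0 → ∃ z, S z ≠ 0 := fun h => Finsupp.ne_iff.mp h
  apply PT.ind
  case zero => simp
  case add =>
    intro S S' T T' h h' hN
    rw [h fun s hs => hN s (by simp [hs]), h' fun s hs => hN s (by simp [hs])]
  case smul =>
    intro a S S' h hN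
    rcases eq_or_ne a 0 with rfl | ha
    · simp
    · rw [h fun s hs => hN s (by simp [hs, ha])]
  case var => intros; rfl
  case lam =>
    intro S S' _ h hN
    rw [h fun s hs => nrm_of_lamP (hN _ (mem_lin hs (by simp)))]
  case inl =>
    intro S S' h hN
    rw [h fun s hs => nrm_inl.mp (hN _ (mem_lin hs (by simp)))]
  case inr =>
    intro S S' h hN
    rw [h fun s hs => nrm_inr.mp (hN _ (mem_lin hs (by simp)))]
  case app =>
    intro S S' T T' _ _ h h' hN
    rcases eq_or_ne S 0 with rfl | hS
    · rw [h (by simp)]; simp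
    rcases eq_or_ne T 0 with rfl | hT
    · rw [h' (by simp)]; simp
    obtain ⟨s₀, hs₀⟩ := ne hS
    obtain ⟨t₀, ht₀⟩ := ne hT
    rw [h fun s hs => (nrm_of_appP (hN (appP s t₀) (mem_bil hs ht₀ (by simp)))).1,
      h' fun t ht => (nrm_of_appP (hN (appP s₀ t) (mem_bil hs₀ ht (by simp)))).2]
  case beta =>
    intro S S' T T' _ _ h h' hN
    rcases eq_or_ne S 0 with rfl | hS
    · rw [h (by simp)]; simp
    rcases eq_or_ne T 0 with rfl | hT
    · rw [h' (by simp)]; simp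
    obtain ⟨s₀, hs₀⟩ := ne hS
    obtain ⟨t₀, ht₀⟩ := ne hT
    have hl : LAM S (lamP s₀) ≠ 0 := mem_lin hs₀ (by simp)
    exact absurd (hN (appP (lamP s₀) t₀) (mem_bil hl ht₀ (by simp))) (not_nrm_appP_lamP _ _)
  case zeroB => simp
  case addB =>
    intro S S' T T' h h' hN
    rw [h fun s hs => hN s (by simp [hs]), h' fun s hs => hN s (by simp [hs])]
  case smulB =>
    intro a S S' h hN
    rcases eq_or_ne a 0 with rfl | ha
    · simp
    · rw [h fun s hs => hN s (by simp [hs, ha])]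
  case nil => intros; rfl
  case cons =>
    intro S S' T T' h h' hN
    rcases eq_or_ne S 0 with rfl | hS
    · rw [h (by simp)]; simp
    rcases eq_or_ne T 0 with rfl | hT
    · rw [h' (by simp)]; simp
    obtain ⟨s₀, hs₀⟩ := ne hS
    obtain ⟨t₀, ht₀⟩ := ne hT
    rw [h fun s hs => hN (s ::ₘ t₀) (mem_bil hs ht₀ (by simp)) s (by simp),
      h' fun t ht u hu => hN (s₀ ::ₘ t) (mem_bil hs₀ ht (by simp)) u (by simp [hu])]

theorem rtg_dev {A : Type} {R : A → A → Prop} {D : A → A} (tri : ∀ {x y}, R x y → R y (D x))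
    {x y : A} (h : Relation.ReflTransGen R x y) :
    ∃ n, Relation.ReflTransGen R y (D^[n] x) := by
  have mono : ∀ n {x y}, R x y → R (D^[n] x) (D^[n] y) := by
    intro n
    induction n with
    | zero => exact fun h => h
    | succ n ih => exact fun h => ih (tri (tri h))
  induction h using Relation.ReflTransGen.head_induction_on with
  | refl => exact ⟨0, .refl⟩
  | @head x z hxz _ ih =>
    obtain ⟨n, hn⟩ := ih
    exact ⟨n + 1, hn.tail (mono n (tri hxz))⟩

/-- A sum of normal terms reached by parallel reduction is an iterated full development. -/
theorem eq_iterate_devT {S N : TS ℕ} (h : Relation.ReflTransGen PT S N)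
    (hN : ∀ s, N s ≠ 0 → Nrm s) : ∃ n, N = devT^[n] S := by
  obtain ⟨n, hn⟩ := rtg_dev (R := PT) (D := devT) (fun h => (triangle.1 h).1) h
  refine ⟨n, ?_⟩
  generalize devT^[n] S = S' at hn
  induction hn with
  | refl => rfl
  | tail _ h ih => rw [← ih] at h; exact (normal_stable.1 h hN).symm

theorem eq_iterate_devB {S N : BS ℕ} (h : Relation.ReflTransGen PB S N)
    (hN : ∀ t, N t ≠ 0 → ∀ u ∈ t, Nrm u) : ∃ n, N = devB^[n] S := by
  obtain ⟨n, hn⟩ := rtg_dev (R := PB) (D := devB) (fun h => triangle.2 h) h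
  refine ⟨n, ?_⟩
  generalize devB^[n] S = S' at hn
  induction hn with
  | refl => rfl
  | tail _ h ih => rw [← ih] at h; exact (normal_stable.2 h hN).symm

end Normal

section Rigid

/-- The renaming skipping the variable `c`. -/
def skip (c n : ℕ) : ℕ := if n < c then n else n + 1

theorem upr_skip (c : ℕ) : upr (skip c) = skip (c + 1) := by
  funext n
  cases n with
  | zero => simp [upr, skip]
  | succ n => simp only [upr, skip]; split_ifs <;> omega

theorem shiftR_app (c : ℕ) (d : Rt) (es : List Rt) :
    (Rt.app d es).shiftR c = .app (d.shiftR c) (es.map (Rt.shiftR c)) := by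
  rw [Rt.shiftR, List.attach_map_val (f := Rt.shiftR c)]

theorem nx_app (x : ℕ) (d : Rt) (es : List Rt) :
    nx x (.app d es) = nx x d + nxL x es := by
  rw [nx, List.attach_map_val (f := nx x), nxL]

theorem ren_id_rmk_shiftR (a : Rt) : ∀ c, ren id (rmk (a.shiftR c)) = ren (skip c) (rmk a) := by
  induction a using Rt.ind with
  | var n => intro c; rw [Rt.shiftR]; exact (ren_var id _).trans (ren_var (skip c) n).symm
  | lam a ih =>
    intro c
    rw [Rt.shiftR, rmk_lam, rmk_lam, ren_lam, ren_lam, upr_id, ih, upr_skip]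
  | inl a ih => intro c; rw [Rt.shiftR, rmk_inl, rmk_inl, ren_inl, ren_inl, ih]
  | inr a ih => intro c; rw [Rt.shiftR, rmk_inr, rmk_inr, ren_inr, ren_inr, ih]
  | app d es ihd ihe =>
    intro c
    rw [shiftR_app, rmk_app, rmk_app, ren_app, ren_app, ihd]
    congr 1
    simp only [toMul, Multiset.map_coe, List.map_map]
    congr 1
    exact List.map_congr_left fun e he => ihe e he c

theorem length_of_rsubst (a : Rt) : ∀ x bs u, rsubst a x bs = some u → bs.length = nx x a := by
  have aux : ∀ {n : ℕ} {l : List Rt} {m : ℕ}, (l.take n).length = n → (l.drop n).length = m →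
      l.length = n + m := by
    intro n l m h h'
    simp only [List.length_take, List.length_drop] at h h'
    omega
  induction a using Rt.ind with
  | var n =>
    intro x bs u h
    rw [nx]
    rcases bs with _ | ⟨b, _ | ⟨b', bs⟩⟩ <;> simp only [rsubst] at h <;>
      split_ifs at h ⊢ <;> simp_all
  | lam a ih =>
    intro x bs u h
    rw [rsubst] at h
    obtain ⟨v, hv, _⟩ := Option.map_eq_some_iff.mp h
    rw [nx, ← ih _ _ _ hv, List.length_map]
  | inl a ih =>
    intro x bs u h
    rw [rsubst] at h
    obtain ⟨v, hv, _⟩ := Option.map_eq_some_iff.mp h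
    rw [nx, ← ih _ _ _ hv]
  | inr a ih =>
    intro x bs u h
    rw [rsubst] at h
    obtain ⟨v, hv, _⟩ := Option.map_eq_some_iff.mp h
    rw [nx, ← ih _ _ _ hv]
  | app c ds ihc ihd =>
    intro x bs u h
    have key : ∀ bs us, rsubstL ds x bs = some us → bs.length = nxL x ds := by
      clear h ihc
      induction ds with
      | nil => intro bs us h; cases bs <;> simp_all [rsubstL, nxL]
      | cons d ds ih =>
        intro bs us h
        rw [rsubstL] at h
        split at h
        · rename_i a' as' h₁ h₂
          exact aux (ihd d (by simp) _ _ _ h₁) (ih (fun e he => ihd e (by simp [he])) _ _ h₂)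
        · simp at h
    rw [rsubst] at h
    split at h
    · rename_i a' as' h₁ h₂
      rw [nx_app]
      exact aux (ihc _ _ _ h₁) (key _ _ h₂)
    · simp at h

variable {ι : Type}

/-- Sum over the words of a given length. -/
def wsum [Fintype ι] {M : Type} [AddCommMonoid M] : ℕ → (List ι → M) → M
  | 0, F => F []
  | n + 1, F => ∑ i, wsum n fun l => F (i :: l)

variable {M N : Type} [AddCommMonoid M] [AddCommMonoid N]

theorem wsum_append [Fintype ι] (m n : ℕ) (F : List ι → M) :
    wsum (m + n) F = wsum m fun l => wsum n fun l' => F (l ++ l') := by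
  induction m generalizing F with
  | zero => simp [wsum]
  | succ m ih => rw [Nat.succ_add, wsum, wsum]; simp [ih]

theorem wsum_congr [Fintype ι] {n : ℕ} {F G : List ι → M} (h : ∀ l, l.length = n → F l = G l) :
    wsum n F = wsum n G := by
  induction n generalizing F G with
  | zero => exact h _ rfl
  | succ n ih => exact Finset.sum_congr rfl fun i _ => ih fun l hl => h _ (by simp [hl])

theorem map_wsum [Fintype ι] (φ : M →+ N) (n : ℕ) (F : List ι → M) :
    φ (wsum n F) = wsum n fun l => φ (F l) := by
  induction n generalizing F with
  | zero => rfl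
  | succ n ih => simp [wsum, ih]

theorem wsum_eq_sum [Fintype ι] (n : ℕ) (F : List ι → M) :
    wsum n F = ∑ f : Fin n → ι, F (List.ofFn f) := by
  induction n generalizing F with
  | zero => simp [wsum]
  | succ n ih =>
    rw [wsum, ← (Fin.consEquiv fun _ => ι).sum_comp, Fintype.sum_prod_type]
    refine Finset.sum_congr rfl fun i _ => ?_
    rw [ih]
    refine Finset.sum_congr rfl fun f _ => ?_
    simp [Fin.consEquiv]

theorem wsum_zero_fun [Fintype ι] (n : ℕ) : wsum n (fun _ : List ι => (0 : M)) = 0 := by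
  induction n with
  | zero => rfl
  | succ n ih => simp [wsum, ih]

open MvPolynomial (X)

/-- The substitution of the generic sum of the `b i` for the variable `x`. -/
noncomputable def gsub [Fintype ι] (x : ℕ) (b : ι → Rt) (k : ℕ) : TS (MvPolynomial ι ℕ) :=
  if k = x then ∑ i, Finsupp.single (ren id (rmk (b i))) (X i)
  else Finsupp.single (qVar (if x < k then k - 1 else k)) 1

theorem up_gsub [Fintype ι] (x : ℕ) (b : ι → Rt) : up (gsub x b) = gsub (x + 1) fun i => (b i).shiftR 0 := by
  funext k
  cases k with
  | zero => simp [up, gsub]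
  | succ k =>
    simp only [up, gsub, add_left_inj, add_lt_add_iff_right]
    split_ifs with h h'
    · rw [map_sum]
      refine Finset.sum_congr rfl fun i _ => ?_
      rw [renT_single, ren_id_rmk_shiftR, ren_ren]
      congr 2
    · simp only [renT_single, ren_var]; congr 2; omega
    · simp

/-- Sum represented by a partial rigid term. -/
noncomputable def optT {K : Type} [CommSemiring K] (o : Option Rt) : TS K :=
  o.elim 0 fun u => Finsupp.single (ren id (rmk u)) 1
/-- Sum represented by a partial rigid monomial. -/
noncomputable def optB {K : Type} [CommSemiring K] (o : Option (List Rt)) : BS K :=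
  o.elim 0 fun u => Finsupp.single ((toMul u).map (ren id)) 1

/-- The monomial of a word. -/
noncomputable def wX (l : List ι) : MvPolynomial ι ℕ := (l.map X).prod

theorem wX_append (l l' : List ι) : wX (l ++ l') = wX l * wX l' := by simp [wX]

theorem sub_gsub_rmk [Fintype ι] (a : Rt) : ∀ (x : ℕ) (b : ι → Rt),
    sub (gsub x b) (rmk a) = wsum (nx x a) fun l => wX l • optT (rsubst a x (l.map b)) := by
  induction a using Rt.ind with
  | var n =>
    intro x b
    refine (sub_var _ n).trans ?_
    rw [nx, gsub]
    split_ifs with h h'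
    · simp [wsum, wX, rsubst, h, optT]
    · simp only [wsum, wX, rsubst, h, optT, h', List.map_nil, List.prod_nil, one_smul, if_true,
        if_false, Option.elim]
      exact congrArg (Finsupp.single · 1) (ren_var id _).symm
    · simp only [wsum, wX, rsubst, h, optT, h', List.map_nil, List.prod_nil, one_smul,
        if_false, Option.elim]
      exact congrArg (Finsupp.single · 1) (ren_var id _).symm
  | lam a ih =>
    intro x b
    rw [rmk_lam, sub_lam, up_gsub, ih, nx]
    refine (map_wsum (LAM : TS (MvPolynomial ι ℕ) →ₗ[_] _).toAddMonoidHom _ _).trans ?_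
    refine wsum_congr fun l _ => ?_
    rw [rsubst, List.map_map]
    refine (map_smul LAM _ _).trans ?_
    congr 1
    change _ = optT (Option.map Rt.lam (rsubst a (x + 1) (List.map (fun i => (b i).shiftR 0) l)))
    cases rsubst a (x + 1) (List.map (fun i => (b i).shiftR 0) l) with
    | none => simp [optT]
    | some u => simp [optT, rmk_lam, upr_id]
  | inl a ih =>
    intro x b
    rw [rmk_inl, sub_inl, ih, nx]
    refine (map_wsum (INL : TS (MvPolynomial ι ℕ) →ₗ[_] _).toAddMonoidHom _ _).trans ?_
    refine wsum_congr fun l _ => ?_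
    rw [rsubst]
    refine (map_smul INL _ _).trans ?_
    congr 1
    cases rsubst a x (l.map b) with
    | none => simp [optT]
    | some u => simp [optT, rmk_inl]
  | inr a ih =>
    intro x b
    rw [rmk_inr, sub_inr, ih, nx]
    refine (map_wsum (INR : TS (MvPolynomial ι ℕ) →ₗ[_] _).toAddMonoidHom _ _).trans ?_
    refine wsum_congr fun l _ => ?_
    rw [rsubst]
    refine (map_smul INR _ _).trans ?_
    congr 1
    cases rsubst a x (l.map b) with
    | none => simp [optT]
    | some u => simp [optT, rmk_inr]
  | app c ds ihc ihd =>
    intro x b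
    have key : subM (gsub x b) (toMul ds) =
        wsum (nxL x ds) fun l => wX l • optB (rsubstL ds x (l.map b)) := by
      clear ihc
      induction ds with
      | nil => simp [toMul, nxL, wsum, wX, rsubstL, optB]
      | cons d ds ih =>
        have e : toMul (d :: ds) = rmk d ::ₘ toMul ds := by simp [toMul]
        rw [e, subM_cons, ihd d (by simp), ih fun e he => ihd e (by simp [he])]
        have hn : nxL x (d :: ds) = nx x d + nxL x ds := by simp [nxL]
        rw [hn, wsum_append]
        refine (map_wsum ((CONS : TS (MvPolynomial ι ℕ) →ₗ[_] _).flip _).toAddMonoidHom _ _).trans ?_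
        refine wsum_congr fun l hl => ?_
        refine (map_wsum ((CONS : TS (MvPolynomial ι ℕ) →ₗ[_] _) _).toAddMonoidHom _ _).trans ?_
        refine wsum_congr fun l' _ => ?_
        rw [LinearMap.toAddMonoidHom_coe, map_smul, LinearMap.map_smul₂, smul_smul, wX_append,
          mul_comm, rsubstL, List.map_append, List.take_left' (by simp [hl]),
          List.drop_left' (by simp [hl])]
        congr 1
        cases rsubst d x (l.map b) <;> cases rsubstL ds x (l'.map b) <;> simp [optT, optB, toMul]
    rw [rmk_app, sub_app, ihc, key, nx_app, wsum_append]
    refine (map_wsum ((APP : TS (MvPolynomial ι ℕ) →ₗ[_] _).flip _).toAddMonoidHom _ _).trans ?_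
    refine wsum_congr fun l hl => ?_
    refine (map_wsum ((APP : TS (MvPolynomial ι ℕ) →ₗ[_] _) _).toAddMonoidHom _ _).trans ?_
    refine wsum_congr fun l' _ => ?_
    rw [LinearMap.toAddMonoidHom_coe, map_smul, LinearMap.map_smul₂, smul_smul, wX_append,
      mul_comm, rsubst, List.map_append, List.take_left' (by simp [hl]),
      List.drop_left' (by simp [hl])]
    congr 1
    cases rsubst c x (l.map b) <;> cases rsubstL ds x (l'.map b) <;>
      simp [optT, optB, rmk_app]

theorem gsub_zero [Fintype ι] (b : ι → Rt) : gsub 0 b = at0' (gen Finset.univ fun i => rmk (b i)) := by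
  funext k
  cases k with
  | zero => simp [gsub, at0', gen]
  | succ k => simp [gsub, at0']

theorem wX_eq [DecidableEq ι] (l : List ι) :
    (wX l : MvPolynomial ι ℕ) = MvPolynomial.monomial (Multiset.toFinsupp (l : Multiset ι)) 1 := by
  induction l with
  | nil => simp [wX]
  | cons i l ih =>
    rw [wX, List.map_cons, List.prod_cons, ← wX, ih, ← Multiset.cons_coe,
      ← Multiset.singleton_add, map_add, Multiset.toFinsupp_singleton, X,
      MvPolynomial.monomial_mul, one_mul]

theorem prL_wX [DecidableEq ι] {l : List ι} (hl : l.Nodup) (l' : List ι) :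
    prL l (wX l') = if l'.Perm l then 1 else 0 := by
  rw [prL_eq, wX_eq, MvPolynomial.coeff_monomial]
  have : facP (l : Multiset ι) = 1 := by
    unfold facP
    refine Finset.prod_eq_one fun i _ => ?_
    have := @Multiset.nodup_iff_count_le_one _ (Classical.decEq ι) (l : Multiset ι)
    have := this.mp (Multiset.coe_nodup.mpr hl) i
    interval_cases @Multiset.count _ (Classical.decEq ι) i (l : Multiset ι) <;> rfl
  rw [this, one_mul]
  congr 1
  rw [EmbeddingLike.apply_eq_iff_eq, Multiset.coe_eq_coe]

theorem optT_bc {K K' : Type} [CommSemiring K] [CommSemiring K'] (ψ : K →+ K') (a : K)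
    (o : Option Rt) : bc ψ (a • optT o) = ψ a • optT o := by
  cases o <;> simp [optT]

theorem parN_eq_sum (a : Rt) (bs : List Rt) :
    parN (rmk a) (toMul bs) =
      ∑ σ : Equiv.Perm (Fin bs.length), optT (rsubst a 0 (permList σ bs)) := by
  classical
  have h₁ : toMul bs = ↑((List.finRange bs.length).map fun i => rmk (bs.get i)) := by
    rw [toMul]
    conv_lhs => rw [← List.ofFn_get bs, List.map_ofFn, List.ofFn_eq_map]
    rfl
  rw [h₁, parN_map Finset.univ _ _ (by simp), ← gsub_zero, sub_gsub_rmk, map_wsum]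
  simp only [optT_bc, prL_wX (List.nodup_finRange bs.length)]
  have h₂ : ∀ σ : Equiv.Perm (Fin bs.length),
      permList σ bs = (List.ofFn σ.symm).map fun i => bs.get i := by
    intro σ
    rw [permList, dif_pos rfl, List.map_ofFn]
    rfl
  by_cases hn : nx 0 a = bs.length
  · rw [hn, wsum_eq_sum, ← Equiv.sum_comp (Equiv.inv (Equiv.Perm (Fin bs.length)))]
    symm
    refine Fintype.sum_of_injective (fun σ : Equiv.Perm (Fin bs.length) => (σ : _ → _))
      DFunLike.coe_injective _ _ ?_ ?_
    · intro f hf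
      rw [if_neg, zero_smul]
      intro hp
      refine hf ?_
      have hinj : Function.Injective f :=
        List.nodup_ofFn.mp (hp.nodup_iff.mpr (List.nodup_finRange _))
      exact ⟨Equiv.ofBijective f (Finite.injective_iff_bijective.mp hinj), rfl⟩
    · intro σ
      rw [if_pos, one_smul, h₂]
      · rfl
      · rw [List.perm_ext_iff_of_nodup (List.nodup_ofFn.mpr σ.injective) (List.nodup_finRange _)]
        intro i
        simp only [List.mem_ofFn, List.mem_finRange, iff_true]
        exact σ.surjective i
  · rw [Finset.sum_eq_zero, wsum_congr, wsum_zero_fun (nx 0 a)]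
    · intro l hl
      rw [if_neg, zero_smul]
      intro hp
      have := hp.length_eq
      rw [List.length_finRange] at this
      omega
    · intro σ _
      cases h : rsubst a 0 (permList σ bs) with
      | none => rfl
      | some u =>
        have := length_of_rsubst _ _ _ _ h
        rw [h₂, List.length_map, List.length_ofFn] at this
        omega

theorem dsub_inl (s : ResTerm) (t : Multiset ResTerm) :
    ∃ S : TS ℕ, dsub 0 (.inl s) t = S.mapDomain Sum.inl ∧ renT id S = parN s t := by
  obtain ⟨a, ha⟩ : ∃ a, rout s = a := ⟨_, rfl⟩
  obtain ⟨bs, hb⟩ : ∃ bs, t.toList.map rout = bs := ⟨_, rfl⟩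
  refine ⟨∑ σ : Equiv.Perm (Fin bs.length),
    (rsubst a 0 (permList σ bs)).elim 0 fun u => Finsupp.single (rmk u) 1, ?_, ?_⟩
  · rw [dsub, outE, Sum.map_inl, ha, hb, dsubRig, Finsupp.mapDomain_finsetSum]
    refine Finset.sum_congr rfl fun σ _ => ?_
    rw [rsubstE]
    cases rsubst a 0 (permList σ bs) with
    | none => simp
    | some u => simp [toQ, Finsupp.mapDomain_single]
  · have ht : t = toMul bs := by rw [← hb, toMul_map_rout, Multiset.coe_toList]
    rw [map_sum, ← rmk_rout s, ha, ht, parN_eq_sum]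
    refine Finset.sum_congr rfl fun σ _ => ?_
    cases rsubst a 0 (permList σ bs) with
    | none => simp [optT]
    | some u => simp [optT]

theorem gen_ren_id (U : Finset ι) (b : ι → ResTerm) : gen U (fun i => ren id (b i)) = gen U b := by
  simp only [gen, ren_ren]; rfl

theorem parN_ren_id (s : ResTerm) (t : Multiset ResTerm) :
    parN (ren id s) (t.map (ren id)) = parN s t := by
  classical
  obtain ⟨l, rfl⟩ : ∃ l : List ResTerm, t = ↑l := ⟨_, (Multiset.coe_toList t).symm⟩
  have h₁ : (l : Multiset ResTerm) =
      ↑((List.finRange l.length).map fun i => l.get i) := by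
    conv_lhs => rw [← List.ofFn_get l, List.ofFn_eq_map]
  rw [h₁, Multiset.map_coe, List.map_map, parN_map Finset.univ _ _ (by simp),
    parN_map Finset.univ _ _ (by simp), sub_ren]
  congr 1
  simp only [Function.comp_def, gen_ren_id, id]

end Rigid

section Simulation

theorem lin_mapDomain {X Y Z K : Type} [CommSemiring K] (g : Y → Z →₀ ℕ) (f : X → Y)
    (S : X →₀ K) : lin g (S.mapDomain f) = lin (g ∘ f) S := by
  rw [lin, lin, Finsupp.linearCombination_mapDomain]
  rfl

theorem renT_mapDomain {f : ResTerm → ResTerm} {L : TS ℕ →ₗ[ℕ] TS ℕ}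
    (h : ∀ s, Finsupp.single (ren id (f s)) 1 = L (Finsupp.single (ren id s) 1)) (S : TS ℕ) :
    renT id (S.mapDomain f) = L (renT id S) := by
  rw [renT, lin_mapDomain]
  exact lin_ext (F := lin _) (G := L.comp (renT id)) (fun s => by simp [lin_single, h]) S

theorem renT_mapDomain' {f : Multiset ResTerm → ResTerm} {L : BS ℕ →ₗ[ℕ] TS ℕ}
    (h : ∀ s, Finsupp.single (ren id (f s)) 1 = L (Finsupp.single (s.map (ren id)) 1))
    (S : BS ℕ) : renT id (S.mapDomain f) = L (renB id S) := by
  rw [renT, lin_mapDomain]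
  exact lin_ext (F := lin _) (G := L.comp (renB id)) (fun s => by simp [lin_single, h]) S

theorem renB_mapDomain {f : ResTerm → Multiset ResTerm} {L : TS ℕ →ₗ[ℕ] BS ℕ}
    (h : ∀ s, Finsupp.single ((f s).map (ren id)) 1 = L (Finsupp.single (ren id s) 1))
    (S : TS ℕ) : renB id (S.mapDomain f) = L (renT id S) := by
  rw [renB, lin_mapDomain]
  exact lin_ext (F := lin _) (G := L.comp (renT id)) (fun s => by simp [lin_single, h]) S

/-- What a one-step reduction says about sums with injections pushed outwards. -/
def Sim : ResExpr → (ResExpr →₀ ℕ) → Prop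
  | .inl s, E => ∃ S : TS ℕ, E = S.mapDomain Sum.inl ∧
      PT (Finsupp.single (ren id s) 1) (renT id S)
  | .inr t, E => ∃ T : BS ℕ, E = T.mapDomain Sum.inr ∧
      PB (Finsupp.single (t.map (ren id)) 1) (renB id T)

theorem Red.sim {e : ResExpr} {E : ResExpr →₀ ℕ} (h : Red e E) : Sim e E := by
  have self : ∀ s s' : ResTerm, ren id s = ren id s' →
      Sim (.inl s) (Finsupp.single (.inl s') 1) := fun s s' h =>
    ⟨Finsupp.single s' 1, by simp, by rw [h, renT_single]; exact PT_ren_self s'⟩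
  induction h with
  | beta s t =>
    obtain ⟨S, hS, hS'⟩ := dsub_inl s t
    refine ⟨S, hS, ?_⟩
    have := PT.beta (PT_ren_self (K := ℕ) s) (PB_ren_self t)
    rw [par, bil_single, castF_nat, parN_ren_id, one_mul, one_smul, LAM_single, APP_single,
      one_mul] at this
    rw [hS', ren_app, ren_lam, upr_id]
    exact this
  | appInl s t => exact self _ _ (by simp)
  | appInr s t => exact self _ _ (by simp)
  | lamInl s => exact self _ _ (by simp)
  | lamInr s => exact self _ _ (by simp)
  | lamCtx _ ih =>
    obtain ⟨S, rfl, h⟩ := ih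
    refine ⟨S.mapDomain qLam, by simp only [← Finsupp.mapDomain_comp]; rfl, ?_⟩
    rw [renT_mapDomain (L := LAM) (by simp [upr_id])]
    simpa [upr_id] using PT.lam h
  | appLCtx t _ ih =>
    obtain ⟨S, rfl, h⟩ := ih
    refine ⟨S.mapDomain fun s => qApp s t, by simp only [← Finsupp.mapDomain_comp]; rfl, ?_⟩
    rw [renT_mapDomain (L := APP.flip (Finsupp.single (t.map (ren id)) 1)) (by simp)]
    simpa using PT.app h (PB_ren_self t)
  | appRCtx s _ ih =>
    obtain ⟨S, rfl, h⟩ := ih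
    refine ⟨S.mapDomain fun t => qApp s t, by simp only [← Finsupp.mapDomain_comp]; rfl, ?_⟩
    rw [renT_mapDomain' (L := APP (Finsupp.single (ren id s) 1)) (by simp)]
    simpa using PT.app (PT_ren_self s) h
  | inlCtx _ ih =>
    obtain ⟨S, rfl, h⟩ := ih
    refine ⟨S.mapDomain qInl, by simp only [← Finsupp.mapDomain_comp]; rfl, ?_⟩
    rw [renT_mapDomain (L := INL) (by simp)]
    simpa using PT.inl h
  | inrCtx _ ih =>
    obtain ⟨S, rfl, h⟩ := ih
    refine ⟨S.mapDomain qInr, by simp only [← Finsupp.mapDomain_comp]; rfl, ?_⟩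
    rw [renT_mapDomain (L := INR) (by simp)]
    simpa using PT.inr h
  | monCtx t _ ih =>
    obtain ⟨S, rfl, h⟩ := ih
    refine ⟨S.mapDomain fun s => s ::ₘ t, by simp only [← Finsupp.mapDomain_comp]; rfl, ?_⟩
    rw [renB_mapDomain (L := CONS.flip (Finsupp.single (t.map (ren id)) 1)) (by simp)]
    simpa using PB.cons h (PB_ren_self t)

/-- The terms of a sum of expressions. -/
noncomputable def prT : (ResExpr →₀ ℕ) →ₗ[ℕ] TS ℕ :=
  lin (Sum.elim (fun s => Finsupp.single (ren id s) 1) 0)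
/-- The monomials of a sum of expressions. -/
noncomputable def prB : (ResExpr →₀ ℕ) →ₗ[ℕ] BS ℕ :=
  lin (Sum.elim 0 fun t => Finsupp.single (t.map (ren id)) 1)

theorem prT_self (E : ResExpr →₀ ℕ) : PT (prT E) (prT E) := by
  induction E using Finsupp.induction_linear with
  | zero => simpa using PT.zero
  | add f g hf hg => simpa only [map_add] using hf.add hg
  | single e n =>
    rcases e with s | t
    · simpa [prT, lin_single] using (PT_ren_self s).smul n
    · simpa [prT, lin_single] using PT.zero

theorem prB_self (E : ResExpr →₀ ℕ) : PB (prB E) (prB E) := by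
  induction E using Finsupp.induction_linear with
  | zero => simpa using PB.zero
  | add f g hf hg => simpa only [map_add] using hf.add hg
  | single e n =>
    rcases e with s | t
    · simpa [prB, lin_single] using PB.zero
    · simpa [prB, lin_single] using (PB_ren_self t).smul n

theorem prT_mapDomain_inl (S : TS ℕ) : prT (S.mapDomain Sum.inl) = renT id S := by
  rw [prT, lin_mapDomain]; rfl
theorem prT_mapDomain_inr (T : BS ℕ) : prT (T.mapDomain Sum.inr) = 0 := by
  rw [prT, lin_mapDomain]
  exact lin_ext (F := lin _) (G := 0) (fun s => by simp [lin_single]) T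
theorem prB_mapDomain_inl (S : TS ℕ) : prB (S.mapDomain Sum.inl) = 0 := by
  rw [prB, lin_mapDomain]
  exact lin_ext (F := lin _) (G := 0) (fun s => by simp [lin_single]) S
theorem prB_mapDomain_inr (T : BS ℕ) : prB (T.mapDomain Sum.inr) = renB id T := by
  rw [prB, lin_mapDomain]; rfl

theorem RedS.prT {E E' : ResExpr →₀ ℕ} (h : RedS E E') : PT (prT E) (prT E') := by
  obtain ⟨e, E₀, F, h, rfl, rfl⟩ := h
  rw [map_add, map_add]
  refine PT.add ?_ (prT_self F)
  rcases e with s | t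
  · obtain ⟨S, rfl, h'⟩ := h.sim
    rw [prT_mapDomain_inl]
    simpa [_root_.prT, lin_single] using h'
  · obtain ⟨T, rfl, h'⟩ := h.sim
    rw [prT_mapDomain_inr]
    simpa [_root_.prT, lin_single] using PT.zero

theorem RedS.prB {E E' : ResExpr →₀ ℕ} (h : RedS E E') : PB (prB E) (prB E') := by
  obtain ⟨e, E₀, F, h, rfl, rfl⟩ := h
  rw [map_add, map_add]
  refine PB.add ?_ (prB_self F)
  rcases e with s | t
  · obtain ⟨S, rfl, h'⟩ := h.sim
    rw [prB_mapDomain_inl]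
    simpa [_root_.prB, lin_single] using PB.zero
  · obtain ⟨T, rfl, h'⟩ := h.sim
    rw [prB_mapDomain_inr]
    simpa [_root_.prB, lin_single] using h'

/-- Normal resource expressions. -/
def NrmE : ResExpr → Prop
  | .inl s => Nrm s
  | .inr t => ∀ u ∈ t, Nrm u

theorem map_ren_id {t : Multiset ResTerm} (h : ∀ u ∈ t, Nrm u) : t.map (ren id) = t := by
  conv_rhs => rw [← Multiset.map_id t]
  exact Multiset.map_congr rfl fun u hu => (h u hu).ren_id

theorem prT_apply {E : ResExpr →₀ ℕ} (hE : ∀ e, E e ≠ 0 → NrmE e) (s : ResTerm) :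
    prT E s = E (.inl s) := by
  classical
  have h : prT E = E.sum fun e n => n • Sum.elim (fun s => Finsupp.single (ren id s) 1) 0 e := by
    simp [prT, lin, Finsupp.linearCombination_apply]
  rw [h, Finsupp.sum_apply, Finsupp.sum, Finset.sum_eq_single (.inl s)]
  · by_cases h : E (.inl s) = 0
    · simp [h]
    · have : Nrm s := hE _ h
      simp [this.ren_id]
  · rintro (s' | t) hs hne
    · have : Nrm s' := hE _ (Finsupp.mem_support_iff.mp hs)
      have : s' ≠ s := fun h => hne (h ▸ rfl)
      simp [Nrm.ren_id ‹_›, this]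
    · simp
  · intro h
    simp [Finsupp.notMem_support_iff.mp h]

theorem prB_apply {E : ResExpr →₀ ℕ} (hE : ∀ e, E e ≠ 0 → NrmE e) (t : Multiset ResTerm) :
    prB E t = E (.inr t) := by
  classical
  have h : prB E = E.sum fun e n =>
      n • Sum.elim (0 : ResTerm → BS ℕ) (fun t => Finsupp.single (t.map (ren id)) 1) e := by
    simp [prB, lin, Finsupp.linearCombination_apply]
  rw [h, Finsupp.sum_apply, Finsupp.sum, Finset.sum_eq_single (.inr t)]
  · by_cases h : E (.inr t) = 0
    · simp [h]
    · have : ∀ u ∈ t, Nrm u := hE _ h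
      simp [map_ren_id this]
  · rintro (s | t') hs hne
    · simp
    · have h : ∀ u ∈ t', Nrm u := hE _ (Finsupp.mem_support_iff.mp hs)
      have : t' ≠ t := fun h => hne (h ▸ rfl)
      simp [map_ren_id h, this]
  · intro h
    simp [Finsupp.notMem_support_iff.mp h]

/-- A sum of normal expressions reached by reduction is computed by full developments. -/
theorem eq_iterate_dev {e : ResExpr} {E : ResExpr →₀ ℕ}
    (h : Relation.ReflTransGen RedS (Finsupp.single e 1) E) (hE : ∀ e, E e ≠ 0 → NrmE e) :
    ∃ n n', (∀ s, E (.inl s) = (devT^[n] (prT (Finsupp.single e 1))) s) ∧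
      ∀ t, E (.inr t) = (devB^[n'] (prB (Finsupp.single e 1))) t := by
  obtain ⟨n, hn⟩ := eq_iterate_devT (h.lift prT fun _ _ => RedS.prT) (by
    intro s hs
    rw [prT_apply hE] at hs
    exact hE _ hs)
  obtain ⟨n', hn'⟩ := eq_iterate_devB (h.lift prB fun _ _ => RedS.prB) (by
    intro s hs
    rw [prB_apply hE] at hs
    exact hE _ hs)
  exact ⟨n, n', fun s => by rw [← hn, prT_apply hE], fun t => by rw [← hn', prB_apply hE]⟩

end Simulation

section Normalization

/-- Size of a resource term. -/
noncomputable def sz : ResTerm → ℕ :=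
  ResAlg.fold ⟨fun _ => 1, fun _ n => n + 1, fun _ n => n + 1, fun _ n => n + 1,
    fun _ n t => n + (t.map Prod.snd).sum + 1⟩
/-- Number of injections of a resource term. -/
noncomputable def pc : ResTerm → ℕ :=
  ResAlg.fold ⟨fun _ => 0, fun _ n => n, fun _ n => n + 1, fun _ n => n + 1,
    fun _ n t => n + (t.map Prod.snd).sum⟩
/-- Number of pairs formed by an injection and a constructor it has to cross. -/
noncomputable def dep : ResTerm → ℕ :=
  ResAlg.fold ⟨fun _ => 0, fun s n => n + pc s, fun _ n => n, fun _ n => n,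
    fun s n t => n + pc s + (t.map Prod.snd).sum⟩

@[simp] theorem sz_var (n : ℕ) : sz (qVar n) = 1 := ResAlg.fold_var _ n
@[simp] theorem sz_lam (s : ResTerm) : sz (qLam s) = sz s + 1 := ResAlg.fold_lam _ s
@[simp] theorem sz_inl (s : ResTerm) : sz (qInl s) = sz s + 1 := ResAlg.fold_inl _ s
@[simp] theorem sz_inr (s : ResTerm) : sz (qInr s) = sz s + 1 := ResAlg.fold_inr _ s
@[simp] theorem sz_app (s : ResTerm) (t : Multiset ResTerm) :
    sz (qApp s t) = sz s + (t.map sz).sum + 1 := by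
  rw [sz, ResAlg.fold_app]; simp
@[simp] theorem pc_lam (s : ResTerm) : pc (qLam s) = pc s := ResAlg.fold_lam _ s
@[simp] theorem pc_inl (s : ResTerm) : pc (qInl s) = pc s + 1 := ResAlg.fold_inl _ s
@[simp] theorem pc_inr (s : ResTerm) : pc (qInr s) = pc s + 1 := ResAlg.fold_inr _ s
@[simp] theorem pc_app (s : ResTerm) (t : Multiset ResTerm) :
    pc (qApp s t) = pc s + (t.map pc).sum := by
  rw [pc, ResAlg.fold_app]; simp
@[simp] theorem dep_lam (s : ResTerm) : dep (qLam s) = dep s + pc s := ResAlg.fold_lam _ s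
@[simp] theorem dep_inl (s : ResTerm) : dep (qInl s) = dep s := ResAlg.fold_inl _ s
@[simp] theorem dep_inr (s : ResTerm) : dep (qInr s) = dep s := ResAlg.fold_inr _ s
@[simp] theorem dep_app (s : ResTerm) (t : Multiset ResTerm) :
    dep (qApp s t) = dep s + pc s + (t.map dep).sum := by
  rw [dep, ResAlg.fold_app]; simp

theorem sz_rmk_app (c : Rt) (ds : List Rt) :
    sz (rmk (.app c ds)) = sz (rmk c) + (ds.map fun d => sz (rmk d)).sum + 1 := by
  rw [rmk_app, sz_app]
  simp [toMul, Function.comp_def]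

theorem sz_shiftR (a : Rt) : ∀ c, sz (rmk (a.shiftR c)) = sz (rmk a) := by
  induction a using Rt.ind with
  | var n => intro c; rw [Rt.shiftR]; exact (sz_var _).trans (sz_var n).symm
  | lam a ih => intro c; rw [Rt.shiftR, rmk_lam, rmk_lam, sz_lam, sz_lam, ih]
  | inl a ih => intro c; rw [Rt.shiftR, rmk_inl, rmk_inl, sz_inl, sz_inl, ih]
  | inr a ih => intro c; rw [Rt.shiftR, rmk_inr, rmk_inr, sz_inr, sz_inr, ih]
  | app d es ihd ihe =>
    intro c
    rw [shiftR_app, sz_rmk_app, sz_rmk_app, ihd, List.map_map]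
    congr 3
    exact List.map_congr_left fun e he => ihe e he c

/-- Total size of a rigid monomial. -/
noncomputable def szL (l : List Rt) : ℕ := (l.map fun d => sz (rmk d)).sum

theorem szL_take_drop (n : ℕ) (l : List Rt) : szL (l.take n) + szL (l.drop n) = szL l := by
  conv_rhs => rw [← List.take_append_drop n l]
  simp only [szL, List.map_append, List.sum_append]

theorem sz_rsubst (a : Rt) : ∀ x bs u, rsubst a x bs = some u →
    sz (rmk u) ≤ sz (rmk a) + szL bs := by
  induction a using Rt.ind with
  | var n =>
    intro x bs u h
    have h₁ : ∀ m, sz (rmk (.var m)) = 1 := sz_var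
    rcases bs with _ | ⟨b, _ | ⟨b', bs⟩⟩ <;> simp only [rsubst] at h <;>
      split_ifs at h ⊢ <;> simp_all [szL]
    · rw [← h, h₁]
  | lam a ih =>
    intro x bs u h
    rw [rsubst] at h
    obtain ⟨v, hv, rfl⟩ := Option.map_eq_some_iff.mp h
    have := ih _ _ _ hv
    have e : szL (bs.map (Rt.shiftR 0)) = szL bs := by simp [szL, Function.comp_def, sz_shiftR]
    rw [rmk_lam, rmk_lam, sz_lam, sz_lam]
    omega
  | inl a ih =>
    intro x bs u h
    rw [rsubst] at h
    obtain ⟨v, hv, rfl⟩ := Option.map_eq_some_iff.mp h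
    have := ih _ _ _ hv
    rw [rmk_inl, rmk_inl, sz_inl, sz_inl]
    omega
  | inr a ih =>
    intro x bs u h
    rw [rsubst] at h
    obtain ⟨v, hv, rfl⟩ := Option.map_eq_some_iff.mp h
    have := ih _ _ _ hv
    rw [rmk_inr, rmk_inr, sz_inr, sz_inr]
    omega
  | app c ds ihc ihd =>
    intro x bs u h
    have key : ∀ bs us, rsubstL ds x bs = some us → szL us ≤ szL ds + szL bs := by
      clear h ihc
      induction ds with
      | nil => intro bs us h; cases bs <;> simp_all [rsubstL, szL]
      | cons d ds ih =>
        intro bs us h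
        rw [rsubstL] at h
        split at h
        · rename_i a' as' h₁ h₂
          obtain rfl : a' :: as' = us := by simpa using h
          have h₁ := ihd d (by simp) _ _ _ h₁
          have h₂ := ih (fun e he => ihd e (by simp [he])) _ _ h₂
          have h₃ := szL_take_drop (nx x d) bs
          have e : ∀ a l, szL (a :: l) = sz (rmk a) + szL l := by simp [szL]
          rw [e, e]
          omega
        · simp at h
    rw [rsubst] at h
    split at h
    · rename_i a' as' h₁ h₂
      obtain rfl : Rt.app a' as' = u := by simpa using h
      have h₁ := ihc _ _ _ h₁
      have h₂ := key _ _ h₂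
      have h₃ := szL_take_drop (nx x c) bs
      rw [sz_rmk_app, sz_rmk_app]
      unfold szL at *
      omega
    · simp at h

theorem szL_permList {n : ℕ} (σ : Equiv.Perm (Fin n)) (l : List Rt) :
    szL (permList σ l) = szL l := by
  rw [permList]
  split_ifs with h
  · subst h
    simp only [szL, List.map_ofFn, List.sum_ofFn]
    refine (Equiv.sum_comp σ.symm fun j => sz (rmk (l.get j))).trans ?_
    conv_rhs => rw [← List.ofFn_get l, List.map_ofFn, List.sum_ofFn]
    rfl
  · rfl

theorem sz_of_mem_dsub {s : ResTerm} {t : Multiset ResTerm} {e : ResExpr}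
    (h : dsub 0 (.inl s) t e ≠ 0) : ∃ s', e = .inl s' ∧ sz s' ≤ sz s + (t.map sz).sum := by
  rw [dsub, dsubRig, Finsupp.finsetSum_apply] at h
  obtain ⟨σ, _, h⟩ := Finset.exists_ne_zero_of_sum_ne_zero h
  rw [outE, Sum.map_inl, rsubstE] at h
  cases hr : rsubst (rout s) 0 (permList σ (t.toList.map rout)) with
  | none => simp [hr] at h
  | some u =>
    refine ⟨rmk u, ?_, ?_⟩
    · by_contra hne
      exact h (by simp [hr, toQ, Ne.symm hne])
    have := sz_rsubst _ _ _ _ hr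
    rw [szL_permList, rmk_rout] at this
    convert this using 2
    conv_lhs => rw [← Multiset.coe_toList t]
    simp [szL, Function.comp_def, rmk_rout]

/-- Decrease of the measure used for normalization. -/
def Dec : ResExpr → ResExpr → Prop
  | .inl s, .inl s' => sz s' < sz s ∨ sz s' = sz s ∧ pc s' = pc s ∧ dep s' < dep s
  | .inr t, .inr t' => (t'.map sz).sum < (t.map sz).sum ∨ (t'.map sz).sum = (t.map sz).sum ∧
      (t'.map pc).sum = (t.map pc).sum ∧ (t'.map dep).sum < (t.map dep).sum
  | _, _ => False

theorem exists_of_mapDomain {X Y : Type} {f : X → Y} {S : X →₀ ℕ} {y : Y}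
    (h : S.mapDomain f y ≠ 0) : ∃ x, S x ≠ 0 ∧ f x = y := by
  classical
  have := Finsupp.mapDomain_support (Finsupp.mem_support_iff.mpr h)
  obtain ⟨x, hx, hy⟩ := Finset.mem_image.mp this
  exact ⟨x, Finsupp.mem_support_iff.mp hx, hy⟩

theorem Red.dec {e : ResExpr} {E : ResExpr →₀ ℕ} (h : Red e E) :
    ∀ e', E e' ≠ 0 → Dec e e' := by
  have sing : ∀ {e e' : ResExpr}, (Finsupp.single e 1 : ResExpr →₀ ℕ) e' ≠ 0 → e' = e := by
    intro e e' h
    by_contra hne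
    exact h (by simp [Ne.symm hne])
  induction h with
  | beta s t =>
    intro e' he'
    obtain ⟨s', rfl, h⟩ := sz_of_mem_dsub he'
    left
    rw [sz_app, sz_lam]
    omega
  | appInl s t =>
    intro e' he'
    rw [sing he']
    right
    simp only [sz_app, sz_inl, pc_app, pc_inl, dep_app, dep_inl]
    omega
  | appInr s t =>
    intro e' he'
    rw [sing he']
    right
    simp only [sz_app, sz_inr, pc_app, pc_inr, dep_app, dep_inr]
    omega
  | lamInl s =>
    intro e' he'
    rw [sing he']
    right
    simp
  | lamInr s =>
    intro e' he'
    rw [sing he']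
    right
    simp
  | lamCtx _ ih =>
    intro e' he'
    obtain ⟨e, he, rfl⟩ := exists_of_mapDomain he'
    have := ih e he
    rcases e with s' | t'
    · simp only [Dec, cLam, sz_lam, pc_lam, dep_lam] at this ⊢; omega
    · exact this.elim
  | appLCtx t _ ih =>
    intro e' he'
    obtain ⟨e, he, rfl⟩ := exists_of_mapDomain he'
    have := ih e he
    rcases e with s' | t'
    · simp only [Dec, cAppL, sz_app, pc_app, dep_app] at this ⊢; omega
    · exact this.elim
  | appRCtx s _ ih =>
    intro e' he'
    obtain ⟨e, he, rfl⟩ := exists_of_mapDomain he'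
    have := ih e he
    rcases e with s' | t'
    · exact this.elim
    · simp only [Dec, cAppR, sz_app, pc_app, dep_app] at this ⊢; omega
  | inlCtx _ ih =>
    intro e' he'
    obtain ⟨e, he, rfl⟩ := exists_of_mapDomain he'
    have := ih e he
    rcases e with s' | t'
    · simp only [Dec, cInl, sz_inl, pc_inl, dep_inl] at this ⊢; omega
    · exact this.elim
  | inrCtx _ ih =>
    intro e' he'
    obtain ⟨e, he, rfl⟩ := exists_of_mapDomain he'
    have := ih e he
    rcases e with s' | t'
    · simp only [Dec, cInr, sz_inr, pc_inr, dep_inr] at this ⊢; omega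
    · exact this.elim
  | monCtx t _ ih =>
    intro e' he'
    obtain ⟨e, he, rfl⟩ := exists_of_mapDomain he'
    have := ih e he
    rcases e with s' | t'
    · simp only [Dec, cMon, Multiset.map_cons, Multiset.sum_cons] at this ⊢; omega
    · exact this.elim

theorem wf_dec : WellFounded fun e' e => Dec e e' := by
  let M : ResExpr → ℕ ×ₗ ℕ := Sum.elim (fun s => toLex (sz s, dep s))
    fun t => toLex ((t.map sz).sum, (t.map dep).sum)
  refine Subrelation.wf (r := InvImage (· < ·) M) ?_ (InvImage.wf M wellFounded_lt)
  intro e' e h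
  rcases e with s | t <;> rcases e' with s' | t'
  · refine Prod.Lex.toLex_lt_toLex.mpr ?_
    simp only [Dec] at h
    tauto
  · exact h.elim
  · exact h.elim
  · refine Prod.Lex.toLex_lt_toLex.mpr ?_
    simp only [Dec] at h
    tauto

theorem RedS.add_right {E E' : ResExpr →₀ ℕ} (h : RedS E E') (F : ResExpr →₀ ℕ) :
    RedS (E + F) (E' + F) := by
  obtain ⟨e, E₀, G, h, rfl, rfl⟩ := h
  exact ⟨e, E₀, G + F, h, add_assoc _ _ _, add_assoc _ _ _⟩

/-- A sum that reduces to a sum of irreducible expressions. -/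
def Normalizes (S : ResExpr →₀ ℕ) : Prop :=
  ∃ E, Relation.ReflTransGen RedS S E ∧ ∀ e, E e ≠ 0 → ∀ E', ¬ Red e E'

theorem Normalizes.zero : Normalizes 0 := ⟨0, .refl, by simp⟩

theorem Normalizes.add {S T : ResExpr →₀ ℕ} (hS : Normalizes S) (hT : Normalizes T) :
    Normalizes (S + T) := by
  obtain ⟨E, h, hE⟩ := hS
  obtain ⟨F, h', hF⟩ := hT
  refine ⟨E + F, (h.lift (· + T) fun _ _ h => h.add_right T).trans
    (h'.lift (E + ·) fun x y h => ?_), fun e he => ?_⟩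
  · simpa only [add_comm E] using h.add_right E
  · by_cases h : E e = 0
    · exact hF e (by simpa [h] using he)
    · exact hE e h

theorem normalizes_of_support {S : ResExpr →₀ ℕ}
    (h : ∀ e, S e ≠ 0 → Normalizes (Finsupp.single e 1)) : Normalizes S := by
  have hn : ∀ e n, Normalizes (Finsupp.single e 1) → Normalizes (Finsupp.single e n) := by
    intro e n he
    induction n with
    | zero => simpa using Normalizes.zero
    | succ n ih => rw [Finsupp.single_add]; exact ih.add he
  rw [← Finsupp.sum_single S]
  refine Finset.sum_induction _ Normalizes (fun _ _ => .add) .zero fun e he => hn _ _ ?_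
  exact h e (Finsupp.mem_support_iff.mp he)

theorem normalizes_single (e : ResExpr) : Normalizes (Finsupp.single e 1) := by
  induction e using wf_dec.induction with
  | _ e ih =>
    by_cases h : ∃ E, Red e E
    · obtain ⟨E, h⟩ := h
      obtain ⟨F, hF, hF'⟩ := normalizes_of_support fun e' he' => ih e' (h.dec e' he')
      exact ⟨F, .head ⟨e, E, 0, h, by simp, by simp⟩ hF, hF'⟩
    · push Not at h
      refine ⟨_, .refl, fun e' he' => ?_⟩
      rcases eq_or_ne e e' with rfl | hne
      · exact h
      · simp [hne] at he'

theorem nrm_of_irreducible {s : ResTerm} (h : ∀ E, ¬ Red (.inl s) E) : Nrm s := by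
  induction s using ResTerm.ind with
  | var n => exact .var n
  | lam s ih =>
    refine .lam (ih fun E hE => h _ hE.lamCtx) ?_ ?_
    · rintro s' rfl; exact h _ (.lamInl s')
    · rintro s' rfl; exact h _ (.lamInr s')
  | inl s ih => exact .inl (ih fun E hE => h _ hE.inlCtx)
  | inr s ih => exact .inr (ih fun E hE => h _ hE.inrCtx)
  | app s t hs ht =>
    refine .app (hs fun E hE => h _ (hE.appLCtx t)) ?_ ?_ ?_ ?_
    · rintro s' rfl; exact h _ (.beta s' t)
    · rintro s' rfl; exact h _ (.appInl s' t)
    · rintro s' rfl; exact h _ (.appInr s' t)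
    · intro u hu
      obtain ⟨t', rfl⟩ := Multiset.exists_cons_of_mem hu
      exact ht u hu fun E hE => h _ (.appRCtx s (.monCtx t' hE))

theorem nrmE_of_irreducible {e : ResExpr} (h : ∀ E, ¬ Red e E) : NrmE e := by
  rcases e with s | t
  · exact nrm_of_irreducible h
  · intro u hu
    obtain ⟨t', rfl⟩ := Multiset.exists_cons_of_mem hu
    exact nrm_of_irreducible fun E hE => h _ (.monCtx t' hE)

theorem NF_spec (e : ResExpr) :
    Relation.ReflTransGen RedS (Finsupp.single e 1) (NF e) ∧ ∀ e', NF e e' ≠ 0 → NrmE e' := by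
  obtain ⟨E, h, hE⟩ := normalizes_single e
  have hE' : ∀ E', ¬ RedS E E' := by
    rintro _ ⟨e', E₀, F, hr, rfl, rfl⟩
    exact hE e' (by simp) _ hr
  have := Classical.epsilon_spec (p := fun E =>
    Relation.ReflTransGen RedS (Finsupp.single e 1) E ∧ ∀ E', ¬ RedS E E') ⟨E, h, hE'⟩
  refine ⟨this.1, fun e' he' => nrmE_of_irreducible fun E₀ hr => ?_⟩
  refine this.2 (E₀ + (NF e - Finsupp.single e' 1)) ⟨e', E₀, NF e - Finsupp.single e' 1, hr, ?_, rfl⟩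
  change NF e = _
  rw [add_tsub_cancel_of_le]
  rw [Finsupp.single_le_iff]
  omega

end Normalization

/-! ### Multiplicities -/

/-- Multiplicity, by structural recursion on resource terms. -/
noncomputable def mF (s : ResTerm) : ℕ :=
  ResAlg.fold ⟨fun _ => 1, fun _ n => n, fun _ n => n, fun _ n => n,
    fun _ n t => n * (facP (t.map Prod.fst) * (t.map Prod.snd).prod)⟩ s

theorem mF_var (n : ℕ) : mF (qVar n) = 1 := ResAlg.fold_var _ n
theorem mF_lam (s : ResTerm) : mF (qLam s) = mF s := ResAlg.fold_lam _ s
theorem mF_inl (s : ResTerm) : mF (qInl s) = mF s := ResAlg.fold_inl _ s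
theorem mF_inr (s : ResTerm) : mF (qInr s) = mF s := ResAlg.fold_inr _ s
theorem mF_app (s : ResTerm) (t : Multiset ResTerm) :
    mF (qApp s t) = mF s * (facP t * (t.map mF).prod) := by
  rw [mF, ResAlg.fold_app]
  simp only [Multiset.map_map, Function.comp_def, Multiset.map_id']
  rfl

theorem mRig_eq (a : Rt) : mRig a = mF (rmk a) := by
  induction a using Rt.ind with
  | var n => rw [mRig]; exact (mF_var n).symm
  | lam a ih => rw [mRig, rmk_lam, ih, mF_lam]
  | inl a ih => rw [mRig, rmk_inl, ih, mF_inl]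
  | inr a ih => rw [mRig, rmk_inr, ih, mF_inr]
  | app c ds hc hd =>
    rw [mRig, rmk_app, mF_app, hc, List.attach_map_val (f := fun e => mRig e)]
    congr 2
    rw [List.map_congr_left hd, toMul, Multiset.map_coe, Multiset.prod_coe, List.map_map]
    rfl

theorem mT_eq (s : ResTerm) : mT s = mF s := by rw [mT, mRig_eq, rmk_rout]

theorem mMon_eq (t : Multiset ResTerm) : mMon t = facP t * (t.map mT).prod := by
  classical
  rw [mMon, Finset.prod_mul_distrib, facP, Finset.prod_multiset_map_count]

@[simp] theorem mT_var (n : ℕ) : mT (qVar n) = 1 := by rw [mT_eq, mF_var]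
@[simp] theorem mT_lam (s : ResTerm) : mT (qLam s) = mT s := by
  rw [mT_eq, mT_eq, mF_lam]
@[simp] theorem mT_inl (s : ResTerm) : mT (qInl s) = mT s := by
  rw [mT_eq, mT_eq, mF_inl]
@[simp] theorem mT_inr (s : ResTerm) : mT (qInr s) = mT s := by
  rw [mT_eq, mT_eq, mF_inr]
@[simp] theorem mT_app (s : ResTerm) (t : Multiset ResTerm) :
    mT (qApp s t) = mT s * mMon t := by
  rw [mT_eq, mF_app, mMon_eq, mT_eq, funext mT_eq]

@[simp] theorem mMon_zero : mMon 0 = 1 := by simp [mMon_eq]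
theorem mMon_cons [DecidableEq ResTerm] (w : ResTerm) (t : Multiset ResTerm) :
    mMon (w ::ₘ t) = (t.count w + 1) * mT w * mMon t := by
  rw [mMon_eq, mMon_eq, facP_cons, Multiset.map_cons, Multiset.prod_cons]
  ring

theorem facP_ne_zero {ι : Type} (t : Multiset ι) : facP t ≠ 0 :=
  Finset.prod_ne_zero_iff.mpr fun _ _ => Nat.factorial_ne_zero _

theorem mMon_ne_zero_of {t : Multiset ResTerm} (h : ∀ u ∈ t, mT u ≠ 0) : mMon t ≠ 0 := by
  rw [mMon_eq]
  refine mul_ne_zero (facP_ne_zero _) fun h0 => ?_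
  obtain ⟨u, hu, h1⟩ := Multiset.mem_map.mp (Multiset.prod_eq_zero_iff.mp h0)
  exact h u hu h1

theorem mT_ne_zero (s : ResTerm) : mT s ≠ 0 := by
  induction s using ResTerm.ind with
  | var n => simp
  | lam s ih => simpa
  | inl s ih => simpa
  | inr s ih => simpa
  | app s t hs ht => rw [mT_app]; exact mul_ne_zero hs (mMon_ne_zero_of ht)

theorem mMon_ne_zero (t : Multiset ResTerm) : mMon t ≠ 0 :=
  mMon_ne_zero_of fun u _ => mT_ne_zero u

@[simp] theorem mT_lamP (s : ResTerm) : mT (lamP s) = mT s := by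
  induction s using ResTerm.pushInd <;> simp_all

@[simp] theorem mT_appP (s : ResTerm) (t : Multiset ResTerm) :
    mT (appP s t) = mT s * mMon t := by
  induction s using ResTerm.pushInd <;> simp_all

/-! ### Injectivity of the constructors commuting with injections -/

theorem lamP_injective : Function.Injective lamP := by
  let f : ResTerm → ResTerm := push
    (fun w => match shape w with | .lam s => s | _ => w) qInl qInr
  have hf : ∀ s, f (lamP s) = s := by
    intro s
    induction s using ResTerm.pushInd <;> simp_all [f]
  exact Function.LeftInverse.injective hf

theorem appP_inj {s s' : ResTerm} {t t' : Multiset ResTerm} (h : appP s t = appP s' t') :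
    s = s' ∧ t = t' := by
  let f : ResTerm → ResTerm × Multiset ResTerm := push
    (fun w => match shape w with | .app s t => (s, t) | _ => (w, 0))
    (Prod.map qInl id) (Prod.map qInr id)
  have hf : ∀ s t, f (appP s t) = (s, t) := by
    intro s t
    induction s using ResTerm.pushInd <;> simp_all [f]
  have := congrArg f h
  rw [hf, hf] at this
  exact Prod.mk.inj this

/-! ### Coherence on resource terms, inductively -/

/-- Coherence of resource terms. -/
inductive QC : ResTerm → ResTerm → Prop
  | var (n : ℕ) : QC (qVar n) (qVar n)
  | lam {s s' : ResTerm} : QC s s' → QC (qLam s) (qLam s')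
  | inl {s s' : ResTerm} : QC s s' → QC (qInl s) (qInl s')
  | inr {s s' : ResTerm} : QC s s' → QC (qInr s) (qInr s')
  | mix (s s' : ResTerm) : QC (qInl s) (qInr s')
  | mix' (s s' : ResTerm) : QC (qInr s) (qInl s')
  | app {s s' : ResTerm} {t t' : Multiset ResTerm} : QC s s' →
      (∀ u v, u ∈ t + t' → v ∈ t + t' → QC u v) → QC (qApp s t) (qApp s' t')

/-- Coherence of monomials. -/
def QCM (t t' : Multiset ResTerm) : Prop := ∀ u v, u ∈ t + t' → v ∈ t + t' → QC u v

theorem QC.of_CohT {a a' : Rt} (h : CohT a a') : QC (rmk a) (rmk a') := by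
  refine CohT.rec (motive_1 := fun a a' _ => QC (rmk a) (rmk a'))
    (motive_2 := fun ds ds' _ => QCM (toMul ds) (toMul ds'))
    ?_ ?_ ?_ ?_ ?_ ?_ ?_ h
  · exact fun x => .var x
  · intro a a' _ ih; rw [rmk_lam, rmk_lam]; exact .lam ih
  · intro c c' ds ds' _ _ ih ih'; rw [rmk_app, rmk_app]; exact .app ih ih'
  · intro a a' _ ih; rw [rmk_inl, rmk_inl]; exact .inl ih
  · intro a a' _ ih; rw [rmk_inr, rmk_inr]; exact .inr ih
  · intro a a'; rw [rmk_inl, rmk_inr]; exact .mix _ _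
  · intro ds ds' _ ih u v hu hv
    rw [toMul, toMul, Multiset.coe_add, ← List.map_append, Multiset.mem_coe, List.mem_map] at hu hv
    obtain ⟨b, hb, rfl⟩ := hu
    obtain ⟨b', hb', rfl⟩ := hv
    exact ih b hb b' hb'

theorem QCM.of_CohM {ds ds' : List Rt} (h : CohM ds ds') : QCM (toMul ds) (toMul ds') := by
  obtain ⟨H⟩ := h
  intro u v hu hv
  rw [toMul, toMul, Multiset.coe_add, ← List.map_append, Multiset.mem_coe, List.mem_map] at hu hv
  obtain ⟨b, hb, rfl⟩ := hu
  obtain ⟨b', hb', rfl⟩ := hv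
  exact .of_CohT (H b hb b' hb')

theorem QC.lamP {s s' : ResTerm} (h : QC s s') : QC (lamP s) (lamP s') := by
  induction h with
  | var n => simpa using (QC.var n).lam
  | lam h => simpa using h.lam.lam
  | inl _ ih => simpa using ih.inl
  | inr _ ih => simpa using ih.inr
  | mix s s' => simpa using QC.mix _ _
  | mix' s s' => simpa using QC.mix' _ _
  | app h h' => simpa using (h.app h').lam

theorem QC.appP {s s' : ResTerm} {t t' : Multiset ResTerm} (h : QC s s') (ht : QCM t t') :
    QC (appP s t) (appP s' t') := by
  induction h with
  | var n => simpa using (QC.var n).app ht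
  | lam h => simpa using h.lam.app ht
  | inl _ ih => simpa using ih.inl
  | inr _ ih => simpa using ih.inr
  | mix s s' => simpa using QC.mix _ _
  | mix' s s' => simpa using QC.mix' _ _
  | app h h' => simpa using (h.app h').app ht

/-! ### Sums with coefficients determined by multiplicities -/

section Good

variable {K : Type} [CommSemiring K] {W X Y Z : Type}

/-- Two sums `S` and `S'` with coherent supports, which are disjoint unless `P` holds, and are
equal when `P` holds, the coefficient of `w` being then `c * μ / m w` for some `μ` in `M`. -/
structure Good (R : W → W → Prop) (m : W → ℕ) (M : Submonoid K) (P : Prop) (c : ℕ)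
    (S S' : W →₀ K) : Prop where
  coh : ∀ w w', S w ≠ 0 → S' w' ≠ 0 → R w w'
  disj : ¬ P → ∀ w, S w ≠ 0 → S' w ≠ 0 → False
  eq : P → S = S'
  coeff : P → ∀ w, S w ≠ 0 → ∃ μ ∈ M, S w * (m w : K) = c * μ

theorem Good.congr {R : W → W → Prop} {m : W → ℕ} {M : Submonoid K} {P P' : Prop} {c c' : ℕ}
    {S S' : W →₀ K} (h : Good R m M P c S S') (hP : P ↔ P') (hc : c = c') :
    Good R m M P' c' S S' := by
  rw [← hP, ← hc]; exact h

theorem bil_apply_of_unique {g : X → Y → Z →₀ ℕ} {S : X →₀ K} {T : Y →₀ K} {x : X} {y : Y} {z : Z}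
    (h : ∀ x' y', S x' ≠ 0 → T y' ≠ 0 → g x' y' z ≠ 0 → x' = x ∧ y' = y) :
    bil g S T z = S x * T y * (g x y z : K) := by
  classical
  have e : bil g S T z = ∑ x' ∈ S.support, ∑ y' ∈ T.support, S x' * (T y' * (g x' y' z : K)) := by
    simp only [bil, Finsupp.linearCombination_apply, Finsupp.sum, LinearMap.coe_sum,
      Finset.sum_apply, LinearMap.smul_apply, Finsupp.coe_finsetSum, Finsupp.smul_apply,
      castF_apply, smul_eq_mul, Finset.mul_sum]
  have h' : ∀ x' y', ¬ (x' = x ∧ y' = y) → S x' * (T y' * (g x' y' z : K)) = 0 := by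
    intro x' y' hn
    by_contra hc
    refine hn (h x' y' (left_ne_zero_of_mul hc) (left_ne_zero_of_mul (right_ne_zero_of_mul hc))
      fun h0 => hc ?_)
    simp [h0]
  rw [e, Finset.sum_eq_single x, Finset.sum_eq_single y, mul_assoc]
  · exact fun y' _ hy => h' _ _ fun hh => hy hh.2
  · intro hy
    rw [Finsupp.notMem_support_iff.mp hy]; simp
  · exact fun x' _ hx => Finset.sum_eq_zero fun y' _ => h' _ _ fun hh => hx hh.1
  · intro hx
    rw [Finsupp.notMem_support_iff.mp hx]; simp

theorem Good.bil {R : X → X → Prop} {m : X → ℕ} {R' : Y → Y → Prop} {m' : Y → ℕ}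
    {R'' : Z → Z → Prop} {m'' : Z → ℕ} {M : Submonoid K} {g : X → Y → Z →₀ ℕ}
    (hg : ∀ x x' y y' z z', R x x' → R' y y' → g x y z ≠ 0 → g x' y' z' ≠ 0 →
      R'' z z' ∧ (z = z' → x = x' ∧ y = y'))
    (hm : ∀ x y z, R x x → R' y y → g x y z ≠ 0 → g x y z * m'' z = m x * m' y)
    {P Q : Prop} {c d : ℕ} {S S' : X →₀ K} {T T' : Y →₀ K}
    (hS : Good R m M P c S S') (hT : Good R' m' M Q d T T') :
    Good R'' m'' M (P ∧ Q) (c * d) (bil g S T) (bil g S' T') where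
  coh z z' hz hz' := by
    obtain ⟨x, y, hx, hy, hxy⟩ := exists_of_mem_bil hz
    obtain ⟨x', y', hx', hy', hxy'⟩ := exists_of_mem_bil hz'
    exact (hg _ _ _ _ _ _ (hS.coh _ _ hx hx') (hT.coh _ _ hy hy') hxy hxy').1
  disj hn z hz hz' := by
    obtain ⟨x, y, hx, hy, hxy⟩ := exists_of_mem_bil hz
    obtain ⟨x', y', hx', hy', hxy'⟩ := exists_of_mem_bil hz'
    obtain ⟨rfl, rfl⟩ := (hg _ _ _ _ _ _ (hS.coh _ _ hx hx') (hT.coh _ _ hy hy') hxy hxy').2 rfl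
    by_cases hP : P
    · exact hT.disj (fun hQ => hn ⟨hP, hQ⟩) _ hy hy'
    · exact hS.disj hP _ hx hx'
  eq h := by rw [hS.eq h.1, hT.eq h.2]
  coeff h z hz := by
    have hSS := hS.eq h.1
    have hTT := hT.eq h.2
    subst hSS hTT
    obtain ⟨x, y, hx, hy, hxy⟩ := exists_of_mem_bil hz
    rw [bil_apply_of_unique (x := x) (y := y) fun x' y' hx' hy' hxy' =>
      (hg _ _ _ _ _ _ (hS.coh _ _ hx' hx) (hT.coh _ _ hy' hy) hxy' hxy).2 rfl]
    obtain ⟨μ, hμ, e⟩ := hS.coeff h.1 x hx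
    obtain ⟨ν, hν, e'⟩ := hT.coeff h.2 y hy
    refine ⟨μ * ν, M.mul_mem hμ hν, ?_⟩
    have := congrArg (Nat.cast : ℕ → K) (hm x y z (hS.coh _ _ hx hx) (hT.coh _ _ hy hy) hxy)
    push_cast at this ⊢
    rw [mul_assoc, this]
    calc S x * T y * (m x * m' y) = (S x * m x) * (T y * m' y) := by ring
      _ = _ := by rw [e, e']; ring

theorem Good.lin {R : X → X → Prop} {m : X → ℕ} {R'' : Z → Z → Prop} {m'' : Z → ℕ}
    {M : Submonoid K} {g : X → Z →₀ ℕ}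
    (hg : ∀ x x' z z', R x x' → g x z ≠ 0 → g x' z' ≠ 0 → R'' z z' ∧ (z = z' → x = x'))
    (hm : ∀ x z, R x x → g x z ≠ 0 → g x z * m'' z = m x)
    {P : Prop} {c : ℕ} {S S' : X →₀ K} (hS : Good R m M P c S S') :
    Good R'' m'' M P c (lin g S) (lin g S') := by
  have e : ∀ S : X →₀ K,
      _root_.lin g S = _root_.bil (fun x (_ : Unit) => g x) S (Finsupp.single () 1) := by
    intro S
    refine lin_ext (F := _root_.lin g)
      (G := (_root_.bil fun x (_ : Unit) => g x).flip (Finsupp.single () 1)) (fun x => ?_) S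
    simp [lin_single, bil_single]
  rw [e, e]
  have hu : Good (fun _ _ : Unit => True) (fun _ => 1) M True 1
      (Finsupp.single () (1 : K)) (Finsupp.single () 1) :=
    ⟨fun _ _ _ _ => trivial, fun h => (h trivial).elim, fun _ => rfl,
      fun _ _ _ => ⟨1, M.one_mem, by simp⟩⟩
  refine (Good.bil (m'' := m'') (R'' := R'') ?_ ?_ hS hu).congr (by simp) (by simp)
  · intro x x' _ _ z z' h _ hz hz'
    exact ⟨(hg _ _ _ _ h hz hz').1, fun e => ⟨(hg _ _ _ _ h hz hz').2 e, rfl⟩⟩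
  · intro x _ z h _ hz
    rw [hm x z h hz, mul_one]

theorem Good.lin_single {R : X → X → Prop} {m : X → ℕ} {R'' : Z → Z → Prop} {m'' : Z → ℕ}
    {M : Submonoid K} {f : X → Z} (hf : ∀ x x', R x x' → R'' (f x) (f x') ∧ (f x = f x' → x = x'))
    (hm : ∀ x, R x x → m'' (f x) = m x)
    {P : Prop} {c : ℕ} {S S' : X →₀ K} (hS : Good R m M P c S S') :
    Good R'' m'' M P c (_root_.lin (fun x => Finsupp.single (f x) 1) S)
      (_root_.lin (fun x => Finsupp.single (f x) 1) S') := by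
  classical
  refine Good.lin (m := m) (R := R) ?_ ?_ hS
  · intro x x' z z' h hz hz'
    rw [Finsupp.single_apply_ne_zero] at hz hz'
    rw [hz.1, hz'.1]
    exact hf _ _ h
  · intro x z h hz
    rw [Finsupp.single_apply_ne_zero] at hz
    rw [hz.1, hm x h, Finsupp.single_eq_same, one_mul]

theorem Good.bil_single {R : X → X → Prop} {m : X → ℕ} {R' : Y → Y → Prop} {m' : Y → ℕ}
    {R'' : Z → Z → Prop} {m'' : Z → ℕ} {M : Submonoid K} {f : X → Y → Z}
    (hf : ∀ x x' y y', R x x' → R' y y' →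
      R'' (f x y) (f x' y') ∧ (f x y = f x' y' → x = x' ∧ y = y'))
    (hm : ∀ x y, R x x → R' y y → m'' (f x y) = m x * m' y)
    {P Q : Prop} {c d : ℕ} {S S' : X →₀ K} {T T' : Y →₀ K}
    (hS : Good R m M P c S S') (hT : Good R' m' M Q d T T') :
    Good R'' m'' M (P ∧ Q) (c * d) (_root_.bil (fun x y => Finsupp.single (f x y) 1) S T)
      (_root_.bil (fun x y => Finsupp.single (f x y) 1) S' T') := by
  classical
  refine Good.bil (m := m) (R := R) (m' := m') (R' := R') ?_ ?_ hS hT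
  · intro x x' y y' z z' h h' hz hz'
    rw [Finsupp.single_apply_ne_zero] at hz hz'
    rw [hz.1, hz'.1]
    exact hf _ _ _ _ h h'
  · intro x y z h h' hz
    rw [Finsupp.single_apply_ne_zero] at hz
    rw [hz.1, hm x y h h', Finsupp.single_eq_same, one_mul]

/-- Well-behaved pairs of sums of terms. -/
abbrev GT (M : Submonoid K) : Prop → ℕ → TS K → TS K → Prop := Good QC mT M

/-- Well-behaved pairs of sums of monomials. -/
abbrev GB (M : Submonoid K) : Prop → ℕ → BS K → BS K → Prop := Good QCM mMon M

variable {M : Submonoid K} {P Q : Prop} {c d : ℕ} {S S' : TS K} {T T' : BS K}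

theorem GT.LAM (h : GT M P c S S') : GT M P c (LAM S) (LAM S') :=
  h.lin_single (fun _ _ h => ⟨h.lamP, fun e => lamP_injective e⟩) fun s _ => mT_lamP s

theorem GT.INL (h : GT M P c S S') : GT M P c (INL S) (INL S') :=
  h.lin_single (fun _ _ h => ⟨h.inl, qInl_inj.mp⟩) fun s _ => mT_inl s

theorem GT.INR (h : GT M P c S S') : GT M P c (INR S) (INR S') :=
  h.lin_single (fun _ _ h => ⟨h.inr, qInr_inj.mp⟩) fun s _ => mT_inr s

theorem GT.APP (h : GT M P c S S') (h' : GB M Q d T T') :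
    GT M (P ∧ Q) (c * d) (APP S T) (APP S' T') :=
  h.bil_single (fun _ _ _ _ h h' => ⟨h.appP h', appP_inj⟩) (fun s t _ _ => mT_appP s t) h'

theorem GT.mix (S S' : TS K) (c : ℕ) : GT M False c (_root_.INL S) (_root_.INR S') := by
  have key : ∀ w w', _root_.INL S w ≠ 0 → _root_.INR S' w' ≠ 0 → ∃ s s', w = qInl s ∧ w' = qInr s' := by
    intro w w' hw hw'
    obtain ⟨s, _, hs⟩ := exists_of_mem_lin hw
    obtain ⟨s', _, hs'⟩ := exists_of_mem_lin hw'
    rw [Finsupp.single_apply_ne_zero] at hs hs'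
    exact ⟨s, s', hs.1, hs'.1⟩
  refine ⟨fun w w' hw hw' => ?_, fun _ w hw hw' => ?_, False.elim, False.elim⟩
  · obtain ⟨s, s', rfl, rfl⟩ := key w w' hw hw'
    exact .mix _ _
  · obtain ⟨s, s', rfl, e⟩ := key w w hw hw'
    exact absurd (congrArg shape e) (by simp)

theorem GT.mix' (S S' : TS K) (c : ℕ) : GT M False c (_root_.INR S) (_root_.INL S') :=
  have h := GT.mix (M := M) S' S c
  ⟨fun w w' hw hw' => by
    obtain ⟨s, _, hs⟩ := exists_of_mem_lin hw
    obtain ⟨s', _, hs'⟩ := exists_of_mem_lin hw'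
    rw [Finsupp.single_apply_ne_zero] at hs hs'
    rw [hs.1, hs'.1]
    exact .mix' _ _, fun hF w hw hw' => h.disj hF w hw' hw, False.elim, False.elim⟩

end Good

/-! ### Products of well-behaved families -/

section Bag

variable {K : Type} [CommSemiring K]

/-- Derivative of a sum of monomials with respect to a term. -/
noncomputable def pd [DecidableEq ResTerm] (w : ResTerm) : BS K →ₗ[K] BS K :=
  lin fun t => Finsupp.single (t.erase w) (t.count w)

theorem pd_single [DecidableEq ResTerm] (w : ResTerm) (t : Multiset ResTerm) (a : K) :
    pd w (Finsupp.single t a) = Finsupp.single (t.erase w) (a * t.count w) := by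
  simp [pd, lin_single]

theorem pd_apply [DecidableEq ResTerm] (w : ResTerm) (F : BS K) (t : Multiset ResTerm) :
    pd w F t = (t.count w + 1) * F (w ::ₘ t) := by
  induction F using Finsupp.induction_linear with
  | zero => simp
  | add F G hF hG => rw [map_add, Finsupp.add_apply, hF, hG, Finsupp.add_apply, mul_add]
  | single t' a =>
    rw [pd_single]
    by_cases h : t' = w ::ₘ t
    · subst h
      simp [mul_comm]
    · rw [Finsupp.single_apply, Finsupp.single_apply, if_neg h, mul_zero]
      split_ifs with h'
      · by_cases hw : w ∈ t'
        · exact (h (by rw [← h', Multiset.cons_erase hw])).elim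
        · rw [Multiset.count_eq_zero.mpr hw]; simp
      · rfl

theorem pd_CONS [DecidableEq ResTerm] (w : ResTerm) (S : TS K) (F : BS K) :
    pd w (CONS S F) = S w • F + CONS S (pd w F) := by
  induction S using Finsupp.induction_linear with
  | zero => simp
  | add S S' h h' =>
    simp only [map_add, LinearMap.add_apply, h, h', Finsupp.add_apply, add_smul]
    abel
  | single x a =>
    induction F using Finsupp.induction_linear with
    | zero => simp
    | add F G h h' =>
      simp only [map_add, h, h', smul_add]
      abel
    | single t b =>
      rw [CONS_single, pd_single, pd_single, CONS_single]
      by_cases hx : x = w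
      · subst hx
        rw [Multiset.erase_cons_head, Multiset.count_cons_self, Finsupp.single_eq_same,
          Finsupp.smul_single, smul_eq_mul]
        by_cases hw : x ∈ t
        · rw [Multiset.cons_erase hw, ← Finsupp.single_add]
          push_cast
          ring_nf
        · rw [Multiset.count_eq_zero.mpr hw]; simp
      · rw [Multiset.erase_cons_tail _ (by simpa using hx), Multiset.count_cons_of_ne (Ne.symm hx),
          Finsupp.single_eq_of_ne (Ne.symm hx), zero_smul, zero_add, mul_assoc]

theorem pd_bagP [DecidableEq ResTerm] {w u₀ : ResTerm} {X : ResTerm → TS K}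
    {t : Multiset ResTerm} (h : ∀ u ∈ t, u ≠ u₀ → X u w = 0) :
    pd w (bagP (t.map X)) = (t.count u₀ * X u₀ w) • bagP ((t.erase u₀).map X) := by
  induction t using Multiset.induction with
  | empty => simp [pd_single]
  | cons u t ih =>
    rw [Multiset.map_cons, bagP_cons, pd_CONS, ih fun v hv => h v (Multiset.mem_cons_of_mem hv)]
    by_cases hu : u = u₀
    · subst hu
      rw [Multiset.erase_cons_head, Multiset.count_cons_self]
      by_cases hm : u ∈ t
      · rw [map_smul, ← bagP_cons, ← Multiset.map_cons, Multiset.cons_erase hm, ← add_smul]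
        push_cast
        ring_nf
      · rw [Multiset.count_eq_zero.mpr hm]; simp
    · rw [h u (Multiset.mem_cons_self u t) hu, zero_smul, zero_add, map_smul, ← bagP_cons,
        ← Multiset.map_cons, Multiset.erase_cons_tail _ (by simpa using hu),
        Multiset.count_cons_of_ne (Ne.symm hu)]

theorem rel_of_bagP {X : ResTerm → TS K} {t w : Multiset ResTerm}
    (h : bagP (t.map X) w ≠ 0) : Multiset.Rel (fun u w => X u w ≠ 0) t w := by
  induction t using Multiset.induction generalizing w with
  | empty =>
    rw [Multiset.map_zero, bagP_zero, Finsupp.single_apply_ne_zero] at h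
    rw [h.1]; exact .zero
  | cons u t ih =>
    rw [Multiset.map_cons, bagP_cons] at h
    obtain ⟨x, y, hx, hy, hxy⟩ := exists_of_mem_bil h
    rw [Finsupp.single_apply_ne_zero] at hxy
    rw [hxy.1]
    exact .cons hx (ih hy)

theorem rel_left_unique {α β : Type} {r : α → β → Prop} {t t' : Multiset α} {w : Multiset β}
    (hr : ∀ u ∈ t, ∀ v ∈ t', ∀ x, r u x → r v x → u = v) (h : Multiset.Rel r t w)
    (h' : Multiset.Rel r t' w) : t = t' := by
  induction w using Multiset.induction generalizing t t' with
  | empty => rw [Multiset.rel_zero_right.mp h, Multiset.rel_zero_right.mp h']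
  | cons x w ih =>
    obtain ⟨u, t₀, hu, ht, rfl⟩ := Multiset.rel_cons_right.mp h
    obtain ⟨v, t₀', hv, ht', rfl⟩ := Multiset.rel_cons_right.mp h'
    rw [hr u (Multiset.mem_cons_self _ _) v (Multiset.mem_cons_self _ _) x hu hv,
      ih (fun u hu v hv => hr u (Multiset.mem_cons_of_mem hu) v (Multiset.mem_cons_of_mem hv))
        ht ht']

theorem coeff_bagP {M : Submonoid K} {X : ResTerm → TS K} {t w : Multiset ResTerm}
    (hX : ∀ u ∈ t, ∀ v ∈ t, GT M (u = v) (mT u) (X u) (X v))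
    (h : Multiset.Rel (fun u w => X u w ≠ 0) t w) :
    ∃ μ ∈ M, bagP (t.map X) w * (mMon w : K) = mMon t * μ := by
  classical
  induction w using Multiset.induction generalizing t with
  | empty =>
    rw [Multiset.rel_zero_right.mp h]
    exact ⟨1, M.one_mem, by simp⟩
  | cons x w ih =>
    obtain ⟨u, t₀, hu, ht, rfl⟩ := Multiset.rel_cons_right.mp h
    obtain ⟨μ, hμ, e⟩ := ih (fun a ha b hb => hX a (Multiset.mem_cons_of_mem ha) b
      (Multiset.mem_cons_of_mem hb)) ht
    have hu' := Multiset.mem_cons_self u t₀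
    obtain ⟨ν, hν, e'⟩ := (hX u hu' u hu').coeff rfl x hu
    refine ⟨ν * μ, M.mul_mem hν hμ, ?_⟩
    have h1 := pd_bagP (w := x) (u₀ := u) (X := X) (t := u ::ₘ t₀) fun v hv hvu => by
      by_contra hne
      exact (hX v hv u hu').disj hvu x hne hu
    have h2 := DFunLike.congr_fun h1 w
    rw [pd_apply, Finsupp.smul_apply, smul_eq_mul, Multiset.erase_cons_head,
      Multiset.count_cons_self] at h2
    rw [mMon_cons, mMon_cons]
    push_cast at h2 ⊢
    calc _ = ((w.count x + 1) * bagP ((u ::ₘ t₀).map X) (x ::ₘ w)) * mT x * mMon w := by ring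
      _ = (t₀.count u + 1) * (X u x * mT x) * (bagP (t₀.map X) w * mMon w) := by rw [h2]; ring
      _ = _ := by rw [e, e']; ring

theorem GT.bagP {M : Submonoid K} {X : ResTerm → TS K} {t t' : Multiset ResTerm}
    (hX : ∀ u v, u ∈ t + t' → v ∈ t + t' → GT M (u = v) (mT u) (X u) (X v)) :
    GB M (t = t') (mMon t) (bagP (t.map X)) (bagP (t'.map X)) where
  coh w w' hw hw' a b ha hb := by
    have key : ∀ a ∈ w + w', ∃ u ∈ t + t', X u a ≠ 0 := by
      intro a ha
      rcases Multiset.mem_add.mp ha with ha | ha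
      · obtain ⟨u, hu, h⟩ := Multiset.exists_mem_of_rel_of_mem
          (Multiset.rel_flip.mpr (rel_of_bagP hw)) ha
        exact ⟨u, Multiset.mem_add.mpr (.inl hu), h⟩
      · obtain ⟨u, hu, h⟩ := Multiset.exists_mem_of_rel_of_mem
          (Multiset.rel_flip.mpr (rel_of_bagP hw')) ha
        exact ⟨u, Multiset.mem_add.mpr (.inr hu), h⟩
    obtain ⟨u, hu, h⟩ := key a ha
    obtain ⟨v, hv, h'⟩ := key b hb
    exact (hX u v hu hv).coh _ _ h h'
  disj hn w hw hw' := hn <| rel_left_unique (fun u hu v hv x hx hx' => by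
    by_contra hne
    exact (hX u v (Multiset.mem_add.mpr (.inl hu)) (Multiset.mem_add.mpr (.inr hv))).disj
      hne x hx hx') (rel_of_bagP hw) (rel_of_bagP hw')
  eq h := by rw [h]
  coeff _ w hw := coeff_bagP (fun u hu v hv => hX u v (Multiset.mem_add.mpr (.inl hu))
    (Multiset.mem_add.mpr (.inl hv))) (rel_of_bagP hw)

end Bag

/-! ### Substitution of well-behaved sums -/

section Sub

variable {K : Type} [CommSemiring K] {M : Submonoid K}

theorem GT.sub {C : (ℕ → TS K) → Prop} (hup : ∀ ρ, C ρ → C (up ρ))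
    (hC : ∀ ρ, C ρ → ∀ n, GT M True 1 (ρ n) (ρ n)) {s s' : ResTerm} (h : QC s s') :
    ∀ ρ, C ρ → GT M (s = s') (mT s) (sub ρ s) (sub ρ s') := by
  induction h with
  | var n =>
    intro ρ hρ
    rw [sub_var]
    exact (hC ρ hρ n).congr (by simp) (by simp)
  | lam h ih =>
    intro ρ hρ
    rw [sub_lam, sub_lam]
    exact (ih _ (hup ρ hρ)).LAM.congr (by simp) (by simp)
  | inl h ih =>
    intro ρ hρ
    rw [sub_inl, sub_inl]
    exact (ih _ hρ).INL.congr (by simp) (by simp)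
  | inr h ih =>
    intro ρ hρ
    rw [sub_inr, sub_inr]
    exact (ih _ hρ).INR.congr (by simp) (by simp)
  | mix s s' =>
    intro ρ hρ
    rw [sub_inl, sub_inr]
    exact (GT.mix _ _ _).congr (iff_of_false id (ne_of_shape_ne (by simp))) rfl
  | mix' s s' =>
    intro ρ hρ
    rw [sub_inl, sub_inr]
    exact (GT.mix' _ _ _).congr (iff_of_false id (ne_of_shape_ne (by simp))) rfl
  | app h h' ih ih' =>
    intro ρ hρ
    rw [sub_app, sub_app]
    exact ((ih ρ hρ).APP (GT.bagP fun u v hu hv => ih' u v hu hv ρ hρ)).congr (by simp) (by simp)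

theorem GT.single {s s' : ResTerm} (h : QC s s') :
    GT M (s = s') (mT s) (Finsupp.single s 1) (Finsupp.single s' 1) where
  coh w w' hw hw' := by
    rw [Finsupp.single_apply_ne_zero] at hw hw'
    rwa [hw.1, hw'.1]
  disj hn w hw hw' := by
    rw [Finsupp.single_apply_ne_zero] at hw hw'
    exact hn (hw.1.symm.trans hw'.1)
  eq h := by rw [h]
  coeff _ w hw := by
    rw [Finsupp.single_apply_ne_zero] at hw
    rw [hw.1]
    exact ⟨1, M.one_mem, by simp⟩

theorem GT.ren {s s' : ResTerm} (h : QC s s') (ξ : ℕ → ℕ) :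
    GT (⊥ : Submonoid ℕ) (s = s') (mT s) (Finsupp.single (ren ξ s) 1)
      (Finsupp.single (ren ξ s') 1) := by
  rw [← sub_single_var, ← sub_single_var]
  refine GT.sub (C := fun ρ => ∃ ξ : ℕ → ℕ, ρ = fun n => Finsupp.single (qVar (ξ n)) 1) ?_ ?_ h _
    ⟨ξ, rfl⟩
  · rintro _ ⟨ξ, rfl⟩
    exact ⟨upr ξ, up_var ξ⟩
  · rintro _ ⟨ξ, rfl⟩ n
    exact (GT.single (.var _)).congr (by simp) (by simp)

theorem QC.ren {s s' : ResTerm} (h : QC s s') (ξ : ℕ → ℕ) : QC (ren ξ s) (ren ξ s') :=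
  (GT.ren h ξ).coh _ _ (by simp) (by simp)

theorem QC.ren_inj {s s' : ResTerm} (h : QC s s') {ξ : ℕ → ℕ} (e : _root_.ren ξ s = _root_.ren ξ s') :
    s = s' := by
  by_contra hn
  exact (GT.ren h ξ).disj hn (_root_.ren ξ s) (by simp) (by simp [e])

theorem mT_ren {s : ResTerm} (h : QC s s) (ξ : ℕ → ℕ) : mT (ren ξ s) = mT s := by
  obtain ⟨μ, hμ, e⟩ := (GT.ren h ξ).coeff rfl (ren ξ s) (by simp)
  rw [Submonoid.mem_bot.mp hμ] at e
  simpa using e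

theorem GT.renT {P : Prop} {c : ℕ} {S S' : TS K} (h : GT M P c S S') (ξ : ℕ → ℕ) :
    GT M P c (renT ξ S) (renT ξ S') :=
  h.lin_single (fun _ _ h => ⟨h.ren ξ, h.ren_inj⟩) fun _ h => mT_ren h ξ

theorem GT.sub' {ρ : ℕ → TS K} (hρ : ∀ n, GT M True 1 (ρ n) (ρ n)) {s s' : ResTerm}
    (h : QC s s') : GT M (s = s') (mT s) (_root_.sub ρ s) (_root_.sub ρ s') := by
  refine GT.sub (C := fun ρ => ∀ n, GT M True 1 (ρ n) (ρ n)) (fun ρ hρ n => ?_)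
    (fun _ => id) h ρ hρ
  cases n with
  | zero => exact (GT.single (.var _)).congr (by simp) (by simp)
  | succ n => exact (hρ n).renT _

end Sub

/-! ### Coefficients of the symmetric multilinear substitution -/

section Par

open MvPolynomial

/-- The monomial associated with a multiset of terms, weighted by multiplicities. -/
noncomputable def wmon (k : Multiset ResTerm) : MvPolynomial ResTerm ℕ :=
  (k.map fun u => X u * (mT u : MvPolynomial ResTerm ℕ)).prod

theorem wmon_eq [DecidableEq ResTerm] (k : Multiset ResTerm) :
    wmon k = monomial (Multiset.toFinsupp k) (k.map mT).prod := by
  induction k using Multiset.induction with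
  | empty => simp [wmon]
  | cons u k ih =>
    have e : wmon (u ::ₘ k) = X u * (mT u : MvPolynomial ResTerm ℕ) * wmon k := by simp [wmon]
    rw [e, ih, ← Multiset.singleton_add, map_add, Multiset.toFinsupp_singleton,
      Multiset.map_add, Multiset.prod_add, X, ← map_natCast (C : ℕ →+* MvPolynomial ResTerm ℕ),
      mul_comm (monomial _ _), C_mul_monomial, monomial_mul]
    simp

/-- The submonoid of weighted monomials. -/
noncomputable def wM : Submonoid (MvPolynomial ResTerm ℕ) where
  carrier := Set.range wmon
  one_mem' := ⟨0, by simp [wmon]⟩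
  mul_mem' := by
    rintro _ _ ⟨k, rfl⟩ ⟨k', rfl⟩
    exact ⟨k + k', by simp [wmon]⟩

theorem prL_wmon {l : List ResTerm} {k : Multiset ResTerm} {p : MvPolynomial ResTerm ℕ} {c n : ℕ}
    (hn : n ≠ 0) (e : p * (n : MvPolynomial ResTerm ℕ) = c * wmon k) (hp : prL l p ≠ 0) :
    k = ↑l ∧ prL l p * n = c * mMon ↑l := by
  classical
  have h := congrArg (prL l) e
  rw [mul_comm p, ← nsmul_eq_mul, ← nsmul_eq_mul, map_nsmul, map_nsmul, smul_eq_mul, smul_eq_mul,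
    prL_eq l (wmon k), wmon_eq, coeff_monomial] at h
  by_cases hk : k = ↑l
  · subst hk
    rw [if_pos rfl, ← mMon_eq, mul_comm n] at h
    exact ⟨rfl, h⟩
  · rw [if_neg fun h => hk (Multiset.toFinsupp.injective h), mul_zero, mul_zero] at h
    exact absurd h (mul_ne_zero hn hp)

theorem GT.gen {U : Finset ResTerm} (hU : ∀ u ∈ U, ∀ v ∈ U, QC u v) :
    GT wM True 1 (gen U id) (gen U id) := by
  classical
  have key : ∀ w, _root_.gen U id w ≠ 0 → ∃ u ∈ U, w = _root_.ren id u ∧ _root_.gen U id w = X u := by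
    intro w hw
    rw [_root_.gen, Finsupp.finsetSum_apply] at hw
    obtain ⟨u, hu, hne⟩ := Finset.exists_ne_zero_of_sum_ne_zero hw
    rw [Finsupp.single_apply_ne_zero] at hne
    refine ⟨u, hu, hne.1, ?_⟩
    rw [hne.1, _root_.gen, Finsupp.finsetSum_apply, Finset.sum_eq_single u]
    · simp
    · intro v hv hvu
      exact Finsupp.single_eq_of_ne fun e => hvu ((hU u hu v hv).ren_inj e).symm
    · exact fun h => (h hu).elim
  refine ⟨fun w w' hw hw' => ?_, fun h => (h trivial).elim, fun _ => rfl, fun _ w hw => ?_⟩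
  · obtain ⟨u, hu, rfl, _⟩ := key w hw
    obtain ⟨v, hv, rfl, _⟩ := key w' hw'
    exact (hU u hu v hv).ren id
  · obtain ⟨u, hu, rfl, e⟩ := key w hw
    refine ⟨wmon {u}, ⟨_, rfl⟩, ?_⟩
    rw [e, mT_ren (hU u hu u hu)]
    simp [wmon]

theorem GT.at0' {U : Finset ResTerm} (hU : ∀ u ∈ U, ∀ v ∈ U, QC u v) (n : ℕ) :
    GT wM True 1 (at0' (_root_.gen U id) n) (at0' (_root_.gen U id) n) := by
  cases n with
  | zero => exact GT.gen hU
  | succ n => exact (GT.single (.var _)).congr (by simp) (by simp)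

theorem parN_eq {U : Finset ResTerm} {t : Multiset ResTerm} (h : ∀ u ∈ t, u ∈ U) (s : ResTerm) :
    parN s t = bc (prL t.toList) (sub (at0' (gen U id)) s) := by
  rw [← parN_map U id t.toList (fun i hi => h i (Multiset.mem_toList.mp hi)) s, List.map_id,
    Multiset.coe_toList]

theorem parN_coherent {s s' w w' : ResTerm} {t t' : Multiset ResTerm} (hs : QC s s')
    (ht : QCM t t') (hw : parN s t w ≠ 0) (hw' : parN s' t' w' ≠ 0) :
    QC w w' ∧ (w = w' → s = s' ∧ t = t') := by
  classical
  set U := (t + t').toFinset with hU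
  have hUt : ∀ u ∈ t, u ∈ U := fun u hu => by simp [hU, hu]
  have hUt' : ∀ u ∈ t', u ∈ U := fun u hu => by simp [hU, hu]
  have hG := GT.sub' (GT.at0' (U := U) fun u hu v hv =>
    ht u v (Multiset.mem_toFinset.mp hu) (Multiset.mem_toFinset.mp hv)) hs
  rw [parN_eq hUt, bc_apply] at hw
  rw [parN_eq hUt', bc_apply] at hw'
  have h := ne_zero_of_map hw
  have h' := ne_zero_of_map hw'
  refine ⟨hG.coh _ _ h h', ?_⟩
  rintro rfl
  have e : s = s' := by
    by_contra hn
    exact hG.disj hn _ h h'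
  obtain ⟨_, ⟨k, rfl⟩, hk⟩ := hG.coeff e w h
  refine ⟨e, ?_⟩
  subst e
  rw [← Multiset.coe_toList t, ← (prL_wmon (mT_ne_zero w) hk hw).1,
    (prL_wmon (mT_ne_zero w) hk hw').1, Multiset.coe_toList]

theorem parN_coeff {s w : ResTerm} {t : Multiset ResTerm} (hs : QC s s) (ht : QCM t t)
    (hw : parN s t w ≠ 0) : parN s t w * mT w = mT s * mMon t := by
  classical
  have hUt : ∀ u ∈ t, u ∈ t.toFinset := fun u hu => by simp [hu]
  have hG := GT.sub' (GT.at0' (U := t.toFinset) fun u hu v hv =>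
    ht u v (Multiset.mem_add.mpr (.inl (Multiset.mem_toFinset.mp hu)))
      (Multiset.mem_add.mpr (.inl (Multiset.mem_toFinset.mp hv)))) hs
  rw [parN_eq hUt, bc_apply] at hw ⊢
  obtain ⟨_, ⟨k, rfl⟩, hk⟩ := hG.coeff rfl w (ne_zero_of_map hw)
  rw [(prL_wmon (mT_ne_zero w) hk hw).2, Multiset.coe_toList]

variable {K : Type} [CommSemiring K] {M : Submonoid K} {P Q : Prop} {c d : ℕ}

theorem GT.par {S S' : TS K} {T T' : BS K} (h : GT M P c S S') (h' : GB M Q d T T') :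
    GT M (P ∧ Q) (c * d) (par S T) (par S' T') :=
  Good.bil (fun _ _ _ _ _ _ hs ht hw hw' => parN_coherent hs ht hw hw')
    (fun _ _ _ hs ht hw => parN_coeff hs ht hw) h h'

end Par

/-! ### Coefficients of complete developments -/

section Dev

variable {M : Submonoid ℕ}

theorem GT.dev {s s' : ResTerm} (h : QC s s') : GT M (s = s') (mT s) (devN s) (devN s') ∧
    ∀ (T T' : BS ℕ) (Q : Prop) (d : ℕ), GB M Q d T T' →
      GT M (s = s' ∧ Q) (mT s * d) (devA s T) (devA s' T') := by
  induction h with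
  | var n =>
    have h := GT.single (K := ℕ) (M := M) (.var n)
    rw [devN_var]
    refine ⟨h, fun T T' Q d hT => ?_⟩
    rw [devA_var, devA_var]
    exact h.APP hT
  | lam h ih =>
    simp only [devN_lam, devA_lam]
    refine ⟨ih.1.LAM.congr (by simp) (by simp), fun T T' Q d hT => ?_⟩
    exact (ih.1.par hT).congr (by simp) (by simp)
  | inl h ih =>
    simp only [devN_inl, devA_inl]
    refine ⟨ih.1.INL.congr (by simp) (by simp), fun T T' Q d hT => ?_⟩
    exact (ih.2 _ _ _ _ hT).INL.congr (by simp) (by simp)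
  | inr h ih =>
    simp only [devN_inr, devA_inr]
    refine ⟨ih.1.INR.congr (by simp) (by simp), fun T T' Q d hT => ?_⟩
    exact (ih.2 _ _ _ _ hT).INR.congr (by simp) (by simp)
  | mix s s' =>
    have hne : qInl s ≠ qInr s' := ne_of_shape_ne (by simp)
    simp only [devN_inl, devA_inl, devN_inr, devA_inr]
    exact ⟨(GT.mix _ _ _).congr (iff_of_false id hne) rfl, fun T T' Q d _ =>
      (GT.mix _ _ _).congr (iff_of_false id fun h => hne h.1) rfl⟩
  | mix' s s' =>
    have hne : qInr s ≠ qInl s' := ne_of_shape_ne (by simp)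
    simp only [devN_inl, devA_inl, devN_inr, devA_inr]
    exact ⟨(GT.mix' _ _ _).congr (iff_of_false id hne) rfl, fun T T' Q d _ =>
      (GT.mix' _ _ _).congr (iff_of_false id fun h => hne h.1) rfl⟩
  | app h h' ih ih' =>
    have hb := GT.bagP (M := M) fun u v hu hv => (ih' u v hu hv).1
    have ha := ih.2 _ _ _ _ hb
    simp only [devN_app, devA_app]
    refine ⟨ha.congr (by simp) (by simp), fun T T' Q d hT => ?_⟩
    exact (ha.APP hT).congr (by simp) (by simp)

end Dev

section Final

theorem devN_coherent {s s' w w' : ResTerm} (hs : QC s s') (hw : devN s w ≠ 0)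
    (hw' : devN s' w' ≠ 0) : QC w w' ∧ (w = w' → s = s') := by
  have h := (GT.dev (M := ⊥) hs).1
  refine ⟨h.coh _ _ hw hw', ?_⟩
  rintro rfl
  by_contra hn
  exact h.disj hn _ hw hw'

theorem Good.coeff_eq {W : Type} {R : W → W → Prop} {m : W → ℕ} {P : Prop} {c : ℕ}
    {S S' : W →₀ ℕ} (h : Good R m ⊥ P c S S') (hP : P) {w : W} (hw : S w ≠ 0) :
    S w * m w = c := by
  obtain ⟨μ, hμ, e⟩ := h.coeff hP w hw
  rw [Submonoid.mem_bot.mp hμ] at e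
  simpa using e

theorem GB.devM {M : Submonoid ℕ} {t t' : Multiset ResTerm} (ht : QCM t t') :
    GB M (t = t') (mMon t) (devM t) (devM t') :=
  GT.bagP fun u v hu hv => (GT.dev (ht u v hu hv)).1

theorem devM_coherent {t t' w w' : Multiset ResTerm} (ht : QCM t t') (hw : devM t w ≠ 0)
    (hw' : devM t' w' ≠ 0) : QCM w w' ∧ (w = w' → t = t') := by
  have h := GB.devM (M := ⊥) ht
  refine ⟨h.coh _ _ hw hw', ?_⟩
  rintro rfl
  by_contra hn
  exact h.disj hn _ hw hw'

theorem GT.devT {c : ℕ} {S S' : TS ℕ} (h : GT ⊥ True c S S') : GT ⊥ True c (devT S) (devT S') := by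
  have e : _root_.devT = lin devN := by simp [_root_.devT, lin]
  rw [e]
  exact Good.lin (fun _ _ _ _ hs hw hw' => devN_coherent hs hw hw')
    (fun s w hs hw => (GT.dev hs).1.coeff_eq rfl hw) h

theorem GB.devB {c : ℕ} {S S' : BS ℕ} (h : GB ⊥ True c S S') : GB ⊥ True c (devB S) (devB S') := by
  have e : _root_.devB = lin _root_.devM := by simp [_root_.devB, lin]
  rw [e]
  exact Good.lin (fun _ _ _ _ hs hw hw' => devM_coherent hs hw hw')
    (fun s w hs hw => (GB.devM hs).coeff_eq rfl hw) h

theorem GT.devT_iterate {c : ℕ} {S : TS ℕ} (h : GT ⊥ True c S S) (n : ℕ) :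
    GT ⊥ True c (_root_.devT^[n] S) (_root_.devT^[n] S) := by
  induction n with
  | zero => exact h
  | succ n ih => rw [Function.iterate_succ_apply']; exact ih.devT

theorem GB.devB_iterate {c : ℕ} {S : BS ℕ} (h : GB ⊥ True c S S) (n : ℕ) :
    GB ⊥ True c (_root_.devB^[n] S) (_root_.devB^[n] S) := by
  induction n with
  | zero => exact h
  | succ n ih => rw [Function.iterate_succ_apply']; exact ih.devB

theorem coeff_NF_mul (e : ResExpr) (he : CohQE e e) (e' : ResExpr) (he' : NF e e' ≠ 0) :
    NF e e' * mE e' = mE e := by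
  obtain ⟨hred, hnf⟩ := NF_spec e
  obtain ⟨n, n', hT, hB⟩ := eq_iterate_dev hred hnf
  rcases e with s | t <;> rcases e' with w | w
  · obtain ⟨a, a', rfl, ha', h⟩ := he
    have hs := QC.of_CohT h
    rw [ha'] at hs
    have e0 : prT (Finsupp.single (.inl (rmk a)) 1) = Finsupp.single (ren id (rmk a)) 1 := by
      simp [prT, lin_single]
    rw [hT, e0] at he' ⊢
    exact (GT.devT_iterate ((GT.ren hs id).congr (by simp) rfl) n).coeff_eq trivial he'
  · have e0 : prB (Finsupp.single (.inl s) 1) = 0 := by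
      simp [prB, lin_single]
    rw [hB, e0, iterate_map_zero] at he'
    exact absurd rfl he'
  · have e0 : prT (Finsupp.single (.inr t) 1) = 0 := by
      simp [prT, lin_single]
    rw [hT, e0, iterate_map_zero] at he'
    exact absurd rfl he'
  · obtain ⟨bs, bs', rfl, hbs', h⟩ := he
    have ht := QCM.of_CohM h
    rw [hbs'] at ht
    have e0 : prB (Finsupp.single (.inr (toMul bs)) 1) =
        Finsupp.single ((toMul bs).map (ren id)) 1 := by
      simp [prB, lin_single]
    have h0 : GB ⊥ True (mMon (toMul bs)) (Finsupp.single ((toMul bs).map (ren id)) 1)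
        (Finsupp.single ((toMul bs).map (ren id)) 1) := by
      rw [← bagP_single]
      exact (GT.bagP fun u v hu hv => GT.ren (ht u v hu hv) id).congr (by simp) rfl
    rw [hB, e0] at he' ⊢
    exact (h0.devB_iterate n').coeff_eq trivial he'

end Final

/-! ### STATEMENT 19:
Let `e` be a uniform resource expression (`e ¨ e`). For every `e'` in the
support of the `→∂`-normal form `NF(e)`, the coefficient of `e'` in `NF(e)`
equals `m(e)/m(e')`. -/
theorem coeff_NF_uniform (e : ResExpr) (he : CohQE e e) (e' : ResExpr)
    (he' : e' ∈ (NF e).support) :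
    ((NF e) e' : ℚ) = (mE e : ℚ) / (mE e' : ℚ) := by
  have hm : mE e' ≠ 0 := by
    rcases e' with w | w
    · exact mT_ne_zero w
    · exact mMon_ne_zero w
  rw [eq_div_iff (Nat.cast_ne_zero.mpr hm)]
  exact_mod_cast coeff_NF_mul e he e' (Finsupp.mem_support_iff.mp he')
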